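/- Up to projective equivalence there are exactly five minimal 1-saturating sets of size 19 and exactly thirty-six minimal 1-saturating sets of size 20 in PG(6,2), and none of them is a cap. -/

import Mathlib

/-- Points of PG(n-1,2) are the nonzero vectors of `Fin n → ZMod 2`.
A set `S` of nonzero vectors is 1-saturating if every nonzero vector `x ∉ S`
is the sum of two distinct elements of `S`. -/
def Saturating {n : ℕ} (S : Set (Fin n → ZMod 2)) : Prop :=
  (∀ s ∈ S, s ≠ 0) ∧
    ∀ x : Fin n → ZMod 2, x ≠ 0 → x ∉ S →
      ∃ a ∈ S, ∃ b ∈ S, a ≠ b ∧ x = a + b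

/-- A minimal 1-saturating set: 1-saturating, and removing any point destroys saturation. -/
def MinSat {n : ℕ} (S : Set (Fin n → ZMod 2)) : Prop :=
  Saturating S ∧ ∀ s ∈ S, ¬ Saturating (S \ {s})

/-- A cap: a set of nonzero vectors no three pairwise distinct elements of which sum to zero. -/
def IsCap {n : ℕ} (S : Set (Fin n → ZMod 2)) : Prop :=
  (∀ s ∈ S, s ≠ 0) ∧
    ∀ a ∈ S, ∀ b ∈ S, ∀ c ∈ S, a ≠ b → a ≠ c → b ≠ c → a + b + c ≠ 0

/-- A complete cap: a cap that is 1-saturating. -/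
def CompleteCap {n : ℕ} (S : Set (Fin n → ZMod 2)) : Prop :=
  IsCap S ∧ Saturating S

/-- Projective equivalence: some element of GL(n, ZMod 2) maps `S` onto `T`. -/
def ProjEquiv {n : ℕ} (S T : Set (Fin n → ZMod 2)) : Prop :=
  ∃ g : Matrix.GeneralLinearGroup (Fin n) (ZMod 2),
    (fun x => Matrix.mulVec (g : Matrix (Fin n) (Fin n) (ZMod 2)) x) '' S = T
namespace MS

/-! ## codes -/
def cd {n : ℕ} (v : Fin n → ZMod 2) : ℕ := Nat.ofBits (fun i => decide (v i = 1))
def dec (n : ℕ) (x : ℕ) : Fin n → ZMod 2 := fun i => if x.testBit i then 1 else 0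

lemma zmod2 (a : ZMod 2) : a = 0 ∨ a = 1 := by revert a; decide
lemma cd_lt {n : ℕ} (v : Fin n → ZMod 2) : cd v < 2 ^ n := Nat.ofBits_lt_two_pow _
lemma dec_cd {n : ℕ} (v : Fin n → ZMod 2) : dec n (cd v) = v := by
  funext i
  simp only [dec, cd, Nat.testBit_ofBits_lt _ _ i.2]
  rcases zmod2 (v i) with h | h <;> simp [h]
lemma cd_dec {n x : ℕ} (h : x < 2 ^ n) : cd (dec n x) = x := by
  apply Nat.eq_of_testBit_eq
  intro i
  by_cases hi : i < n
  · rw [cd, Nat.testBit_ofBits_lt _ _ hi]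
    simp only [dec]
    by_cases h : x.testBit i <;> simp [h]
  · rw [cd, Nat.testBit_ofBits_ge _ _ (not_lt.1 hi), Nat.testBit_lt_two_pow]
    exact lt_of_lt_of_le h (Nat.pow_le_pow_right (by norm_num) (not_lt.1 hi))
lemma dec_xor (n x y : ℕ) : dec n (x ^^^ y) = dec n x + dec n y := by
  funext i
  simp only [dec, Nat.testBit_xor, Pi.add_apply]
  by_cases h : x.testBit i <;> by_cases h' : y.testBit i <;> simp [h, h'] <;> decide
lemma dec_zero (n : ℕ) : dec n 0 = 0 := by funext i; simp [dec]
lemma cd_add {n : ℕ} (u v : Fin n → ZMod 2) : cd (u + v) = cd u ^^^ cd v := by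
  conv_lhs => rw [← dec_cd u, ← dec_cd v, ← dec_xor]
  exact cd_dec (Nat.xor_lt_two_pow (cd_lt u) (cd_lt v))
lemma cd_zero {n : ℕ} : cd (0 : Fin n → ZMod 2) = 0 := by
  rw [← dec_zero, cd_dec (Nat.two_pow_pos n)]
lemma cd_inj {n : ℕ} {u v : Fin n → ZMod 2} (h : cd u = cd v) : u = v := by
  rw [← dec_cd u, ← dec_cd v, h]
lemma cd_eq_zero {n : ℕ} {v : Fin n → ZMod 2} : cd v = 0 ↔ v = 0 :=
  ⟨fun h => cd_inj (h.trans cd_zero.symm), fun h => by rw [h, cd_zero]⟩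
lemma add_self2 {n : ℕ} (v : Fin n → ZMod 2) : v + v = 0 := by
  funext i; rcases zmod2 (v i) with h | h <;> simp [h]; decide
lemma add_eq_zero2 {n : ℕ} {u v : Fin n → ZMod 2} : u + v = 0 ↔ u = v := by
  constructor
  · intro h
    have : u + v + v = v := by rw [h, zero_add]
    rwa [add_assoc, add_self2, add_zero] at this
  · rintro rfl; exact add_self2 _

/-! ## linear maps on codes -/
def app : List ℕ → ℕ → ℕ :=
  List.rec (fun _ => 0) (fun c _ ih x => Nat.xor (Nat.mul (Nat.mod x 2) c) (ih (Nat.div x 2)))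
lemma app_nil (x : ℕ) : app [] x = 0 := rfl
lemma app_cons (c : ℕ) (cs : List ℕ) (x : ℕ) : app (c :: cs) x = ((x % 2) * c) ^^^ app cs (x / 2) := rfl
lemma app_xor (cs : List ℕ) : ∀ x y, app cs (x ^^^ y) = app cs x ^^^ app cs y := by
  induction cs with
  | nil => intro x y; simp [app_nil]
  | cons c cs ih =>
    intro x y
    rw [app_cons, app_cons, app_cons, Nat.xor_div_two, ih]
    have h : (x ^^^ y) % 2 * c = (x % 2 * c) ^^^ (y % 2 * c) := by
      rcases Nat.mod_two_eq_zero_or_one x with hx | hx <;>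
      rcases Nat.mod_two_eq_zero_or_one y with hy | hy <;>
      simp [Nat.xor_mod_two_eq, Nat.add_mod, hx, hy]
    rw [h]
    ac_rfl
def lin (n : ℕ) (cs : List ℕ) : (Fin n → ZMod 2) →ₗ[ZMod 2] (Fin n → ZMod 2) :=
  AddMonoidHom.toZModLinearMap 2
    { toFun := fun v => dec n (app cs (cd v))
      map_zero' := by
        have h : app cs 0 = 0 := by
          have := app_xor cs 0 0
          simpa using this
        simp [cd_zero, h, dec_zero]
      map_add' := fun u v => by simp [cd_add, app_xor, dec_xor] }
lemma lin_apply (n : ℕ) (cs : List ℕ) (v : Fin n → ZMod 2) : lin n cs v = dec n (app cs (cd v)) := rfl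
lemma app_lt {n : ℕ} {cs : List ℕ} (h : ∀ c ∈ cs, c < 2 ^ n) : ∀ x, app cs x < 2 ^ n := by
  induction cs with
  | nil => intro x; simp [app_nil]
  | cons c cs ih =>
    intro x
    rw [app_cons]
    apply Nat.xor_lt_two_pow
    · rcases Nat.mod_two_eq_zero_or_one x with hx | hx <;> simp [hx]
      exact h c (by simp)
    · exact ih (fun c hc => h c (by simp [hc])) _
lemma cd_lin {n : ℕ} {cs : List ℕ} (h : ∀ c ∈ cs, c < 2 ^ n) (v : Fin n → ZMod 2) :
    cd (lin n cs v) = app cs (cd v) := by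
  rw [lin_apply, cd_dec (app_lt h _)]
/-- check for mutually inverse lists of columns -/
def invOK (n : ℕ) (cs ds : List ℕ) : Bool :=
  cs.all (fun c => Nat.blt c (2 ^ n)) && ds.all (fun c => Nat.blt c (2 ^ n)) &&
    (List.range n).all (fun i => Nat.beq (app ds (app cs (2 ^ i))) (2 ^ i))
lemma blt_lt {a b : ℕ} (h : Nat.blt a b = true) : a < b := by
  exact Nat.le_of_ble_eq_true h
lemma dec_single (n : ℕ) (i : Fin n) : dec n (2 ^ (i : ℕ)) = Pi.single i 1 := by
  funext j
  simp only [dec, Nat.testBit_two_pow, Pi.single_apply]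
  by_cases h : j = i
  · subst h; simp
  · have : ¬ (i : ℕ) = j := fun h' => h (Fin.ext h'.symm)
    simp [h, this]
lemma lin_inv {n : ℕ} {cs ds : List ℕ} (h : invOK n cs ds = true) (v : Fin n → ZMod 2) :
    lin n ds (lin n cs v) = v := by
  simp only [invOK, Bool.and_eq_true, List.all_eq_true, List.mem_range] at h
  obtain ⟨⟨h1, h2⟩, h3⟩ := h
  have hc : ∀ c ∈ cs, c < 2 ^ n := fun c hc => blt_lt (h1 c hc)
  have : (lin n ds).comp (lin n cs) = LinearMap.id := by
    apply LinearMap.pi_ext'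
    intro i
    apply LinearMap.ext_ring
    simp only [LinearMap.comp_apply, LinearMap.id_apply, LinearMap.coe_single]
    rw [← dec_single]
    have hp : (2 : ℕ) ^ (i : ℕ) < 2 ^ n := Nat.pow_lt_pow_right (by norm_num) i.2
    rw [lin_apply, cd_lin hc, cd_dec hp, Nat.eq_of_beq_eq_true (h3 i i.2)]
  exact LinearMap.congr_fun this v
noncomputable def linE (n : ℕ) (cs ds : List ℕ) (h : invOK n cs ds = true) :
    (Fin n → ZMod 2) ≃ₗ[ZMod 2] (Fin n → ZMod 2) :=
  LinearEquiv.ofBijective (lin n cs) (by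
    have hi : Function.Injective (lin n cs) := Function.LeftInverse.injective (lin_inv h)
    exact ⟨hi, LinearMap.surjective_of_injective hi⟩)
lemma linE_apply {n : ℕ} {cs ds : List ℕ} (h : invOK n cs ds = true) (v : Fin n → ZMod 2) :
    linE n cs ds h v = lin n cs v := rfl
lemma cd_linE {n : ℕ} {cs ds : List ℕ} (h : invOK n cs ds = true) (v : Fin n → ZMod 2) :
    cd (linE n cs ds h v) = app cs (cd v) := by
  apply cd_lin
  simp only [invOK, Bool.and_eq_true, List.all_eq_true] at h
  exact fun c hc => blt_lt (h.1.1 c hc)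
lemma invOK_lt {n : ℕ} {cs ds : List ℕ} (h : invOK n cs ds = true) :
    (∀ c ∈ cs, c < 2 ^ n) ∧ ∀ c ∈ ds, c < 2 ^ n := by
  simp only [invOK, Bool.and_eq_true, List.all_eq_true] at h
  exact ⟨fun c hc => blt_lt (h.1.1 c hc), fun c hc => blt_lt (h.1.2 c hc)⟩
lemma cd_linE_symm {n : ℕ} {cs ds : List ℕ} (h : invOK n cs ds = true) (v : Fin n → ZMod 2) :
    cd ((linE n cs ds h).symm v) = app ds (cd v) := by
  have : (linE n cs ds h).symm v = lin n ds v := by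
    rw [LinearEquiv.symm_apply_eq, linE_apply]
    obtain ⟨u, rfl⟩ := (linE n cs ds h).surjective v
    rw [linE_apply, lin_inv h]
  rw [this]
  exact cd_lin (invOK_lt h).2 v

/-! ## parity functionals on `E` -/
abbrev E := Fin 6 → ZMod 2
def par (x : ℕ) : ℕ := Nat.land (Nat.shiftRight 0x6996966996696996 x) 1
lemma par_xor : ∀ a < 64, ∀ b < 64, par (a ^^^ b) = (par a + par b) % 2 := by decide +kernel
lemma par_and_ne : ∀ g < 64, g ≠ 0 → ∃ x < 64, par (g &&& x) = 1 := by decide +kernel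
lemma par_lt (x : ℕ) : par x < 2 := by
  have : par x = (Nat.shiftRight 0x6996966996696996 x) % 2 := Nat.and_one_is_mod _
  omega
lemma cd6 (v : E) : cd v < 64 := cd_lt v
lemma and_lt64 (g : ℕ) {x : ℕ} (h : x < 64) : g &&& x < 64 := lt_of_le_of_lt Nat.and_le_right h
def fn (g : ℕ) : E →ₗ[ZMod 2] ZMod 2 :=
  AddMonoidHom.toZModLinearMap 2
    { toFun := fun v => (par (g &&& cd v) : ZMod 2)
      map_zero' := by rw [cd_zero, Nat.and_zero]; rfl
      map_add' := fun u v => by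
        rw [cd_add, Nat.and_xor_distrib_left, par_xor _ (and_lt64 g (cd6 u)) _ (and_lt64 g (cd6 v)),
          ZMod.natCast_mod, Nat.cast_add] }
lemma fn_apply (g : ℕ) (v : E) : fn g v = (par (g &&& cd v) : ZMod 2) := rfl
lemma fn_ne {g : ℕ} (h : g < 64) (h0 : g ≠ 0) : fn g ≠ 0 := by
  obtain ⟨x, hx, h1⟩ := par_and_ne g h h0
  intro h2
  have := LinearMap.congr_fun h2 (dec 6 x)
  rw [fn_apply, cd_dec (by exact hx), h1] at this
  simp at this
noncomputable section
/-! ## the search engine (definitions) -/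
def force (n : ℕ) (k : ℕ → Bool) : Bool := Nat.rec true (fun m _ => k m) (Nat.succ n)
def bor (a b : Bool) : Bool := Bool.rec b true a
def tryF (H : ℕ) (F : ℕ → Bool) (v : ℕ) : Bool :=
  Nat.rec true (fun m _ => Bool.rec true (F m) (Nat.beq (Nat.land m H) H)) (Nat.succ v)
/-- distribute `m` units between low (loss K0) and high (loss K1) -/
def opt (H K0 K1 : ℕ) (m : ℕ) : (ℕ → Bool) → ℕ → Bool :=
  Nat.rec (fun F S => F S)
   (fun m' _ => Nat.rec
      (fun F S => Bool.rec false (tryF H F (Nat.sub S K1)) (tryF H F (Nat.sub S K0)))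
      (fun m'' _ F S => Nat.rec (tryF H F (Nat.sub S (Nat.mul (Nat.succ (Nat.succ m'')) K0)))
         (fun a ih => Bool.rec false ih
            (tryF H F (Nat.sub S (Nat.add (Nat.mul (Nat.succ a) K1) (Nat.mul (Nat.sub (Nat.succ m'') a) K0)))))
         (Nat.succ (Nat.succ m''))) m') m
structure Cell where
  off : ℕ
  Km : ℕ
  K0 : ℕ
  K1 : ℕ
  K2 : ℕ
/-- process the cells of one level -/
def build (P cp cap H : ℕ) (tab : List Cell) : (ℕ → Bool) → ℕ → Bool :=
  List.rec (fun F S => tryF H F S)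
    (fun c _ ih F S =>
      Cell.rec (fun off Km K0 K1 K2 =>
      force (Nat.sub cp (Nat.land (Nat.shiftRight P off) 1023)) (fun n =>
      Nat.rec (ih F S) (fun _ _ =>
       force (Nat.sub n cap) (fun a0 =>
       force (Nat.sub (Nat.add S (Nat.mul n Km)) (Nat.mul a0 K2)) (fun S' =>
       force (Nat.sub n (Nat.mul 2 a0)) (fun m =>
        Nat.rec (ih F S') (fun _ _ => ih (opt H K0 K1 m F) S') m)))) n)) c) tab
def packF {ι : Type} (f : ι → ℕ) (J : List ι) : ℕ := List.rec 0 (fun j _ ih => Nat.add (f j) (Nat.mul 1024 ih)) J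
abbrev Cst := (ℕ → ℕ) × ℕ
def eqb (a b : ℕ) : ℕ := Bool.rec 0 1 (Nat.beq a b)
def neb (a b : ℕ) : ℕ := Bool.rec 1 0 (Nat.beq a b)
def mult (A : List ℕ) (m y : ℕ) : ℕ := List.rec 0 (fun a _ ih => Nat.add (eqb (Nat.mod a m) y) ih) A
def ind (g s x : ℕ) : ℕ := eqb (par (Nat.land g x)) s
def cntA (A : List ℕ) (g s : ℕ) : ℕ := List.rec 0 (fun a _ ih => Nat.add (ind g s a) ih) A
def mapL {α β : Type} (f : α → β) (l : List α) : List β := List.rec [] (fun x _ ih => f x :: ih) l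
def appL {α : Type} (l m : List α) : List α := List.rec m (fun x _ ih => x :: ih) l
def upto (n : ℕ) : List ℕ := Nat.rec (fun l => l) (fun i ih l => ih (i :: l)) n []
/-- smallest admissible side of parity p -/
def ms (w p : ℕ) : ℕ := Nat.add w (Nat.land (Nat.add w p) 1)
/-- lower bound for a half of `B`; `s ≥ 64` means that the sum of `B` is unknown -/
def bnd (A : List ℕ) (w M s g i : ℕ) : ℕ :=
  Bool.rec
    ((fun p0 p1 => max (Nat.sub w p0) (Nat.sub w p1)) (cntA A g 0) (cntA A g 1))
    ((fun p0 p1 bp => max (Nat.sub (ms w (Nat.add p0 bp)) p0) (Nat.sub (ms w (Nat.add p1 bp)) p1))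
      (cntA A g 0) (cntA A g 1)
      (Nat.rec (Nat.add M (par (Nat.land g s))) (fun _ _ => par (Nat.land g s)) i))
    (Nat.blt s 64)
/-- constraints for the level m=2^k -> 2m -/
def cons (A : List ℕ) (w M s m c lb : ℕ) : List Cst :=
  appL (mapL (fun y => (fun x => neb x y, Nat.sub M c)) (upto (Nat.mul 2 m)))
  (appL (mapL (fun y => (fun x => mult A (Nat.mul 2 m) (Nat.xor x y), c)) (upto (Nat.mul 2 m)))
  ((ind m 0, lb) :: appL (mapL (fun g => (ind (Nat.add m g) 0, bnd A w M s (Nat.add m g) 0)) (upto m))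
     (mapL (fun g => (ind (Nat.add m g) 1, bnd A w M s (Nat.add m g) 1)) (upto m))))
def rnd (x : ℕ) : ℕ := Nat.mod (Nat.pow (Nat.add x 3) 41) 0x3FFFFFFFFFFFFC5
def hi64 (a r : ℕ) : ℕ := Nat.add r (Nat.mul 0x10000000000000000 a)
def mkTab (J : List Cst) (m : ℕ) (l : List ℕ) : (List Cell → Bool) → Bool :=
  List.rec (fun k => k []) (fun x _ ih k =>
    force (packF (fun q => q.1 x) J) (fun a => force (packF (fun q => q.1 (Nat.add x m)) J) (fun b =>
    force (packF (fun q => Nat.sub (q.1 (Nat.add x m)) (q.1 x)) J) (fun d =>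
    force (Nat.sub (Nat.add a d) b) (fun f =>
    force (Nat.add 64 (Nat.mul 10 x)) (fun off =>
    force (rnd (Nat.mul 2 x)) (fun r0 => force (rnd (Nat.succ (Nat.mul 2 x))) (fun r1 =>
    force (hi64 (Nat.add a d) (Nat.add r0 r1)) (fun e =>
    force (hi64 d r0) (fun d => force (hi64 f r1) (fun f => force (Nat.add d f) (fun g =>
     ih (fun t => k (Cell.mk off e d f g :: t)))))))))))))) l
structure Lev where
  cp : ℕ
  cap : ℕ
  H : ℕ
  Cb : ℕ
  tab : List Cell
  chk : ℕ → Bool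
def cpOf (M k : ℕ) : ℕ := Nat.add 512 (Nat.sub M (Nat.sub M (2 ^ (6 - k))))
/-! checks on a completed level -/
def dg (N o : ℕ) : ℕ := Nat.land (Nat.shiftRight N o) 1023
def lexgt (N : ℕ) (l : List ℕ) : ℕ → Bool :=
  List.rec (fun _ => false) (fun o _ ih px =>
    force (dg N px) (fun a => force (dg N o) (fun b =>
      bor (Nat.blt a b) (Bool.rec false (ih (Nat.add px 10)) (Nat.beq a b))))) l
def anyL {α : Type} (p : α → Bool) (l : List α) : Bool := List.rec false (fun x _ ih => bor (p x) ih) l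
def swp (q : ℕ × ℕ) (N : ℕ) : ℕ :=
  Nat.lor (Nat.shiftLeft (Nat.land N q.2) q.1) (Nat.land (Nat.shiftRight N q.1) q.2)
def dtree (N nd sh : ℕ) (l : List (ℕ × ℕ)) : ℕ → ℕ → Bool :=
  List.rec (fun N' t => Nat.blt (Nat.land (Nat.shiftRight (Nat.mul N N') sh) 1023) (Nat.land (Nat.shiftRight nd t) 1023))
   (fun q _ ih N' t => bor (ih N' t) (force (swp q N') (fun N'' => ih N'' (Nat.add t q.1)))) l
/-- same as `dtree`, with 64 hash bits below -/
def lowQ (Q N : ℕ) : ℕ := Nat.add (Nat.mod Q 0x10000000000000000) (Nat.mul 0x10000000000000000 N)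
def dtreeQ (N nd sh : ℕ) (l : List (ℕ × ℕ)) : ℕ → ℕ → Bool :=
  List.rec (fun N' t => Nat.blt (Nat.land (Nat.shiftRight (Nat.mul N (Nat.shiftRight N' 64)) sh) 1023) (Nat.land (Nat.shiftRight nd t) 1023))
   (fun q _ ih N' t => bor (ih N' t) (force (lowQ N' (swp q (Nat.shiftRight N' 64))) (fun N'' => ih N'' (Nat.add t q.1)))) l
def aord (A : List ℕ) (m d : ℕ) : ℕ :=
  List.rec 0 (fun a _ ih => Nat.add (mult A m (Nat.xor (Nat.mod a m) d)) ih) A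
def need (A : List ℕ) (k d : ℕ) : ℕ := Nat.rec 0 (fun _ _ => Nat.sub (2 ^ (7 - k)) (aord A (2 ^ k) d)) d
def withQs (k : ℕ) (l : List ℕ) : (List (ℕ × ℕ) → Bool) → Bool :=
  List.rec (fun K => K []) (fun i _ ih K =>
    force (Nat.mul 10 (2 ^ i)) (fun a =>
    force (packF (fun x => Nat.mul 1023 (eqb (Nat.land x (2 ^ i)) 0)) (upto (2 ^ k))) (fun b =>
    ih (fun t => K ((a, b) :: t))))) l
abbrev Gam := List ℕ × List ℕ × ℕ
def mkOffs (cl : ℕ) (g : Gam) (l : List ℕ) : (List ℕ → Bool) → Bool :=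
  List.rec (fun K => K []) (fun x _ ih K =>
    force (Nat.mul 10 (Nat.mod (Nat.xor (app g.1 x) g.2.2) (2 ^ cl))) (fun o => ih (fun t => K (o :: t)))) l
def withGs (cl : ℕ) (G : List Gam) : (List (List ℕ) → Bool) → Bool :=
  List.rec (fun K => K []) (fun g _ ih K => mkOffs cl g (upto (2 ^ cl)) (fun o => ih (fun t => K (o :: t)))) G
/-- parity of the last column -/
def colp (s k N : ℕ) : Bool :=
  Bool.rec false (Bool.rec true false (Nat.beq (Nat.land (Nat.mod (Nat.shiftRight N (Nat.mul 10 (2 ^ (k - 1)))) 1023) 1)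
    (Nat.land (Nat.shiftRight s (k - 1)) 1))) (Nat.blt s 64)
def withChk (A : List ℕ) (M s cl k : ℕ) (gs : List (List ℕ)) (K : (ℕ → Bool) → Bool) : Bool :=
  force (packF (fun _ => cpOf M k) (upto (2 ^ k))) (fun cpp =>
  force (2 ^ (10 * 2 ^ k)) (fun md =>
  Bool.rec
   (K (fun P => force (lowQ P (Nat.sub cpp (Nat.mod (Nat.shiftRight P 64) md))) (fun Q =>
      bor (colp s k (Nat.shiftRight Q 64)) (Bool.rec false (anyL (fun l => lexgt (Nat.shiftRight Q 64) l 0) gs) (Nat.beq k cl)))))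
   (withQs k (upto k) (fun qs =>
    force (packF (fun t => need A k (Nat.xor t (2 ^ k - 1))) (upto (2 ^ k))) (fun nd =>
    force (10 * (2 ^ k - 1)) (fun sh =>
     K (fun P => force (lowQ P (Nat.sub cpp (Nat.mod (Nat.shiftRight P 64) md))) (fun Q =>
      bor (colp s k (Nat.shiftRight Q 64)) (bor (Bool.rec false (anyL (fun l => lexgt (Nat.shiftRight Q 64) l 0) gs) (Nat.beq k cl))
       (dtreeQ (Nat.shiftRight Q 64) nd sh qs Q 0))))))))
   (Nat.blt 4 k)))
def withLev (A : List ℕ) (w M s lb cl k : ℕ) (gs : List (List ℕ)) (K : Lev → Bool) : Bool :=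
  force (2^k) (fun m => force (2^(5-k)) (fun cap =>
  force (cpOf M k) (fun cp =>
  force (hi64 (packF (fun _ => 512) (cons A w M s m cap lb)) 0) (fun H =>
  force (hi64 (packF (fun q => Nat.sub 512 q.2) (cons A w M s m cap lb)) 0) (fun Cb =>
   mkTab (cons A w M s m cap lb) m (upto m) (fun tab =>
   withChk A M s cl (k+1) gs (fun chk => K (Lev.mk cp cap H Cb tab chk))))))))
def withLevs (A : List ℕ) (w M s cl : ℕ) (gs : List (List ℕ)) (lbs : List ℕ) : ℕ → (List Lev → Bool) → Bool :=
  List.rec (fun _ K => K []) (fun lb _ ih k K =>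
    withLev A w M s lb cl k gs (fun L => ih (Nat.succ k) (fun t => K (L :: t)))) lbs
def srch (Ls : List Lev) : ℕ → Bool :=
  List.rec (fun _ => false) (fun L _ ih P =>
    Lev.rec (fun cp cap H Cb tab chk => build P cp cap H tab (fun P' => bor (chk P') (ih P')) Cb) L) Ls
def run (A : List ℕ) (w M s cl : ℕ) (G : List Gam) (lbs : List ℕ) : Bool :=
  withGs cl G (fun gs => withLevs A w M s cl gs lbs 0 (fun Ls => srch Ls (512 * 2 ^ 64)))
end
/-! ## soundness of the engine -/
theorem force_eq (n : ℕ) (k : ℕ → Bool) : force n k = k n := rfl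
theorem bor_eq (a b : Bool) : bor a b = (a || b) := by cases a <;> rfl
theorem mapL_eq {α β : Type} (f : α → β) (l : List α) : mapL f l = l.map f := by
  induction l with
  | nil => rfl
  | cons x l ih => exact congrArg (f x :: ·) ih
theorem appL_eq {α : Type} (l m : List α) : appL l m = l ++ m := by
  induction l with
  | nil => rfl
  | cons x l ih => exact congrArg (x :: ·) ih
theorem anyL_eq {α : Type} (p : α → Bool) (l : List α) : anyL p l = l.any p := by
  induction l with
  | nil => rfl
  | cons x l ih => 
    rw [List.any_cons, ← ih, ← bor_eq]; rfl
theorem upto_eq (n : ℕ) : upto n = List.range n := by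
  have : ∀ n l, (Nat.rec (motive := fun _ => List ℕ → List ℕ) (fun l => l) (fun i ih l => ih (i :: l)) n l) = List.range n ++ l := by
    intro n
    induction n with
    | zero => intro l; rfl
    | succ n ih => intro l; rw [List.range_succ]; simp [ih]
  have h := this n []
  rw [List.append_nil] at h; exact h
theorem packF_nil {ι : Type} (f : ι → ℕ) : packF f [] = 0 := rfl
theorem packF_cons {ι : Type} (f : ι → ℕ) (j : ι) (J : List ι) : packF f (j :: J) = f j + 1024 * packF f J := rfl
theorem packF_add {ι : Type} (f g : ι → ℕ) (J : List ι) : packF (fun q => f q + g q) J = packF f J + packF g J := by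
  induction J with
  | nil => rfl
  | cons j J ih => simp only [packF_cons, ih]; ring
theorem packF_mul {ι : Type} (c : ℕ) (f : ι → ℕ) (J : List ι) : packF (fun q => c * f q) J = c * packF f J := by
  induction J with
  | nil => rfl
  | cons j J ih => simp only [packF_cons, ih]; ring
theorem packF_congr {ι : Type} {f g : ι → ℕ} {J : List ι} (h : ∀ q ∈ J, f q = g q) : packF f J = packF g J := by
  induction J with
  | nil => rfl
  | cons j J ih =>
    rw [packF_cons, packF_cons, h j (by simp), ih (fun q hq => h q (by simp [hq]))]
theorem packF_le {ι : Type} {f g : ι → ℕ} {J : List ι} (h : ∀ q ∈ J, f q ≤ g q) : packF f J ≤ packF g J := by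
  induction J with
  | nil => exact le_refl _
  | cons j J ih =>
    rw [packF_cons, packF_cons]
    have := h j (by simp); have := ih (fun q hq => h q (by simp [hq])); omega
theorem packF_sub {ι : Type} {f g : ι → ℕ} {J : List ι} (h : ∀ q ∈ J, g q ≤ f q) :
    packF (fun q => f q - g q) J = packF f J - packF g J := by
  have h1 := packF_add (fun q => f q - g q) g J
  rw [packF_congr (g := f) (fun q hq => Nat.sub_add_cancel (h q hq))] at h1
  omega
theorem packF_append {ι : Type} (f : ι → ℕ) (J K : List ι) :
    packF f (J ++ K) = packF f J + 1024 ^ J.length * packF f K := by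
  induction J with
  | nil => simp [packF_nil]
  | cons j J ih => rw [List.cons_append, packF_cons, packF_cons, ih, List.length_cons, pow_succ]; ring
theorem packF_map {ι κ : Type} (f : κ → ℕ) (h : ι → κ) (J : List ι) : packF f (J.map h) = packF (fun j => f (h j)) J := by
  induction J with
  | nil => rfl
  | cons j J ih => rw [List.map_cons, packF_cons, packF_cons, ih]
theorem packF_lt {ι : Type} {f : ι → ℕ} {J : List ι} (h : ∀ q ∈ J, f q < 1024) : packF f J < 1024 ^ J.length := by
  induction J with
  | nil => simp [packF_nil]
  | cons j J ih =>
    rw [packF_cons, List.length_cons, pow_succ]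
    have := h j (by simp); have := ih (fun q hq => h q (by simp [hq])); omega
theorem land_base (b a c x y : ℕ) (ha : a < 2 ^ b) (hc : c < 2 ^ b) :
    (a + 2 ^ b * x) &&& (c + 2 ^ b * y) = (a &&& c) + 2 ^ b * (x &&& y) := by
  have hac : a &&& c < 2 ^ b := Nat.and_lt_two_pow _ hc
  apply Nat.eq_of_testBit_eq; intro i
  rw [Nat.testBit_and, add_comm a, add_comm c, add_comm (a &&& c), Nat.testBit_two_pow_mul_add _ ha, Nat.testBit_two_pow_mul_add _ hc,
    Nat.testBit_two_pow_mul_add _ hac]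
  split_ifs <;> simp
theorem land512 (a : ℕ) (h1 : 512 ≤ a) (h2 : a < 1024) : a &&& 512 = 512 := by
  obtain ⟨b, rfl⟩ := Nat.exists_eq_add_of_le h1
  have : (b + 2^9 * 1) &&& (0 + 2 ^ 9 * 1) = (b &&& 0) + 2 ^ 9 * (1 &&& 1) := land_base 9 b 0 1 1 (by omega) (by omega)
  simpa [add_comm] using this
theorem packF_land {ι : Type} {f : ι → ℕ} {J : List ι} (h : ∀ q ∈ J, 512 ≤ f q ∧ f q < 1024) :
    packF f J &&& packF (fun _ => 512) J = packF (fun _ => 512) J := by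
  induction J with
  | nil => simp [packF_nil]
  | cons j J ih =>
    rw [packF_cons, packF_cons]
    have hj := h j (by simp)
    have := land_base 10 (f j) 512 (packF f J) (packF (fun _ => 512) J) (by omega) (by omega)
    norm_num only at this
    rw [this, ih (fun q hq => h q (by simp [hq])), land512 _ hj.1 hj.2]
theorem dg_eq (N o : ℕ) : dg N o = N / 2 ^ o % 1024 := by
  unfold dg
  rw [show Nat.land (Nat.shiftRight N o) 1023 = (N >>> o) &&& (2 ^ 10 - 1) from rfl, Nat.and_two_pow_sub_one_eq_mod, Nat.shiftRight_eq_div_pow]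
/-- the digit of a packed number -/
theorem dg_packF (f : ℕ → ℕ) (m : ℕ) (hf : ∀ x < m, f x < 1024) (r x : ℕ) (hx : x < m) :
    (packF f (List.range m) + 1024 ^ m * r) / 2 ^ (10 * x) % 1024 = f x := by
  have e : List.range m = List.range x ++ (x :: (List.range (m - x - 1)).map (x + 1 + ·)) := by
    have : m = x + (1 + (m - x - 1)) := by omega
    conv_lhs => rw [this, List.range_add, List.range_add]
    simp [List.map_map, Function.comp_def, add_assoc]
  rw [e, packF_append, packF_cons, List.length_range]
  set T := packF f ((List.range (m - x - 1)).map (x + 1 + ·))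
  have hm : 1024 ^ m = 1024 ^ x * (1024 * 1024 ^ (m - x - 1)) := by
    rw [← pow_succ', ← pow_add]; congr 1; omega
  have hlt : packF f (List.range x) < 1024 ^ x := by
    have := packF_lt (f := f) (J := List.range x) (fun q hq => hf q (by have := List.mem_range.1 hq; omega))
    simpa using this
  rw [show (2 : ℕ) ^ (10 * x) = 1024 ^ x by rw [pow_mul]; norm_num, hm]
  rw [show packF f (List.range x) + 1024 ^ x * (f x + 1024 * T) + 1024 ^ x * (1024 * 1024 ^ (m - x - 1)) * r
    = packF f (List.range x) + 1024 ^ x * (f x + 1024 * (T + 1024 ^ (m - x - 1) * r)) by ring]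
  rw [Nat.add_mul_div_left _ _ (by positivity), Nat.div_eq_of_lt hlt, zero_add, Nat.add_mul_mod_self_left]
  exact Nat.mod_eq_of_lt (hf x hx)

/-! ### build -/
theorem tryF_sound {H : ℕ} {F : ℕ → Bool} {v : ℕ} (h : tryF H F v = true) (hv : v &&& H = H) : F v = true := by
  have : tryF H F v = Bool.rec true (F v) (Nat.beq (Nat.land v H) H) := rfl
  rw [this, show Nat.beq (Nat.land v H) H = true from Nat.beq_eq ▸ hv] at h
  exact h
theorem opt_sound {H K0 K1 m : ℕ} {F : ℕ → Bool} {S : ℕ} (hm : 0 < m) (h : opt H K0 K1 m F S = true) (i : ℕ) (hi : i ≤ m) :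
    tryF H F (S - (i * K1 + (m - i) * K0)) = true := by
  match m, hm with
  | 1, _ =>
    have e : opt H K0 K1 1 F S = Bool.rec false (tryF H F (Nat.sub S K1)) (tryF H F (Nat.sub S K0)) := rfl
    rw [e] at h
    have hi' : i = 0 ∨ i = 1 := by omega
    cases h0 : tryF H F (Nat.sub S K0) with
    | false => rw [h0] at h; cases h
    | true =>
      rw [h0] at h
      rcases hi' with rfl | rfl
      · simpa using h0
      · simpa using h
  | m + 2, _ =>
    have e : ∀ j, j ≤ m + 2 → (Nat.rec (motive := fun _ => Bool) (tryF H F (Nat.sub S (Nat.mul (Nat.succ (Nat.succ m)) K0)))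
         (fun a ih => Bool.rec false ih
            (tryF H F (Nat.sub S (Nat.add (Nat.mul (Nat.succ a) K1) (Nat.mul (Nat.sub (Nat.succ m) a) K0)))))
         j) = true → ∀ i ≤ j, tryF H F (S - (i * K1 + (m + 2 - i) * K0)) = true := by
      intro j
      induction j with
      | zero => intro _ h i hi; obtain rfl : i = 0 := by omega
                simpa using h
      | succ j ih =>
        intro hj h i hi
        simp only at h
        cases h0 : (tryF H F (Nat.sub S (Nat.add (Nat.mul (Nat.succ j) K1) (Nat.mul (Nat.sub (Nat.succ m) j) K0)))) with
        | false => rw [h0] at h; cases h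
        | true =>
          rw [h0] at h
          rcases Nat.lt_or_ge i (j+1) with h1 | h1
          · exact ih (by omega) h i (by omega)
          · obtain rfl : i = j + 1 := by omega
            have : m + 2 - (j + 1) = m + 1 - j := by omega
            rw [this]; exact h0
    exact e (m+2) le_rfl h i hi
/-- data attached to a cell -/
structure CellOK (P cp cap : ℕ) (c : Cell) (l h : ℕ) : Prop where
  n : cp - dg P c.off = l + h
  hl : l ≤ cap
  hh : h ≤ cap
  k2 : c.K2 = c.K0 + c.K1
  k0 : c.K0 ≤ c.Km
  k1 : c.K1 ≤ c.Km
def hiV (cap : ℕ) (c : Cell) (l h : ℕ) : ℕ := (l + h) * c.Km - (l + h - cap) * c.K2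
def loV (c : Cell) (l h : ℕ) : ℕ := l * (c.Km - c.K0) + h * (c.Km - c.K1)
theorem loss {P cp cap : ℕ} {c : Cell} {l h : ℕ} (H : CellOK P cp cap c l h) :
    loV c l h + ((h - (l + h - cap)) * c.K1 + ((l + h - 2 * (l + h - cap)) - (h - (l + h - cap))) * c.K0) = hiV cap c l h := by
  obtain ⟨_, hl, hh, k2, k0, k1⟩ := H
  unfold loV hiV
  rw [k2]
  obtain ⟨x, hx⟩ := Nat.exists_eq_add_of_le k0
  obtain ⟨y, hy⟩ := Nat.exists_eq_add_of_le k1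
  rw [show c.Km - c.K0 = x by omega, show c.Km - c.K1 = y by omega]
  obtain ⟨p, hp⟩ : ∃ p, p = l + h - cap := ⟨_, rfl⟩
  rw [← hp]
  obtain ⟨a, ha⟩ := Nat.exists_eq_add_of_le (show p ≤ l by omega)
  obtain ⟨b, hb⟩ := Nat.exists_eq_add_of_le (show p ≤ h by omega)
  rw [show h - p = b by omega, show l + h - 2 * p - b = a by omega]
  apply Nat.eq_sub_of_add_eq
  rw [ha, hb]
  have e1 : (p + a + (p + b)) * c.Km = (p + a) * c.Km + (p + b) * c.Km := by ring
  rw [e1]; nth_rw 1 [hx]; rw [hy]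
  have := hx.symm.trans hy
  ring
theorem build_sound (P cp cap H : ℕ) (lh : Cell → ℕ × ℕ) (tab : List Cell)
    (hc : ∀ c ∈ tab, CellOK P cp cap c (lh c).1 (lh c).2) : ∀ (F : ℕ → Bool) (S : ℕ),
    (∀ t1 t2, t1 ++ t2 = tab → (S + (t1.map (fun c => hiV cap c (lh c).1 (lh c).2)).sum
        + (t2.map (fun c => loV c (lh c).1 (lh c).2)).sum) &&& H = H) →
    build P cp cap H tab F S = true → F (S + (tab.map (fun c => loV c (lh c).1 (lh c).2)).sum) = true := by
  induction tab with
  | nil =>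
    intro F S hg hb
    exact tryF_sound hb (by simpa using hg [] [] rfl)
  | cons c t ih =>
    intro F S hg hb
    have hcc := hc c (by simp)
    have ih' := ih (fun c hc' => hc c (by simp [hc']))
    obtain ⟨l, h⟩ : ∃ x, x = lh c := ⟨_, rfl⟩
    have hn := hcc.n
    have e : build P cp cap H (c :: t) F S = Nat.rec (motive := fun _ => Bool) (build P cp cap H t F S) (fun _ _ =>
        Nat.rec (motive := fun _ => Bool) (build P cp cap H t F (S + (cp - dg P c.off) * c.Km - (cp - dg P c.off - cap) * c.K2)) (fun _ _ =>
          build P cp cap H t (opt H c.K0 c.K1 (cp - dg P c.off - 2 * (cp - dg P c.off - cap)) F) (S + (cp - dg P c.off) * c.Km - (cp - dg P c.off - cap) * c.K2))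
          (cp - dg P c.off - 2 * (cp - dg P c.off - cap))) (cp - dg P c.off) := rfl
    rw [e, hn] at hb
    have hl := loss hcc
    have hhi : hiV cap c (lh c).1 (lh c).2 = ((lh c).1 + (lh c).2) * c.Km - ((lh c).1 + (lh c).2 - cap) * c.K2 := rfl
    have hle : ((lh c).1 + (lh c).2 - cap) * c.K2 ≤ ((lh c).1 + (lh c).2) * c.Km := by
      have h1 := hcc.hl; have h2 := hcc.hh; have h3 := hcc.k0; have h4 := hcc.k1
      rw [hcc.k2]
      calc _ ≤ ((lh c).1 + (lh c).2 - cap) * (2 * c.Km) := Nat.mul_le_mul_left _ (by omega)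
        _ = (2 * ((lh c).1 + (lh c).2 - cap)) * c.Km := by ring
        _ ≤ _ := Nat.mul_le_mul_right _ (by omega)
    have hS : S + ((lh c).1 + (lh c).2) * c.Km - ((lh c).1 + (lh c).2 - cap) * c.K2 = S + hiV cap c (lh c).1 (lh c).2 := by
      rw [hhi]; omega
    rw [hS] at hb
    have hg' : ∀ t1 t2, t1 ++ t2 = t → (S + hiV cap c (lh c).1 (lh c).2 + (t1.map (fun c => hiV cap c (lh c).1 (lh c).2)).sum
        + (t2.map (fun c => loV c (lh c).1 (lh c).2)).sum) &&& H = H := by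
      intro t1 t2 h12
      have := hg (c :: t1) t2 (by simp [h12])
      simpa [add_assoc] using this
    rw [List.map_cons, List.sum_cons]
    set L := (t.map (fun c => loV c (lh c).1 (lh c).2)).sum
    have hgl := hg [] (c :: t) rfl
    rw [List.map_cons, List.sum_cons] at hgl
    simp only [List.map_nil, List.sum_nil, add_zero] at hgl
    cases hN : (lh c).1 + (lh c).2 with
    | zero =>
      have h1 : hiV cap c (lh c).1 (lh c).2 = 0 := by rw [hhi, hN]; simp
      rw [hN] at hb
      have := ih' F S (by simpa [h1] using hg') hb
      rw [show loV c (lh c).1 (lh c).2 = 0 by omega]; simpa using this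
    | succ N =>
      have hb' : Nat.rec (motive := fun _ => Bool) (build P cp cap H t F (S + hiV cap c (lh c).1 (lh c).2)) (fun _ _ =>
          build P cp cap H t (opt H c.K0 c.K1 ((lh c).1 + (lh c).2 - 2 * ((lh c).1 + (lh c).2 - cap)) F) (S + hiV cap c (lh c).1 (lh c).2))
          ((lh c).1 + (lh c).2 - 2 * ((lh c).1 + (lh c).2 - cap)) = true := by
        have : ∃ N, (lh c).1 + (lh c).2 = N + 1 := ⟨N, hN⟩
        revert hb
        generalize (lh c).1 + (lh c).2 - 2 * ((lh c).1 + (lh c).2 - cap) = m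
        generalize S + hiV cap c (lh c).1 (lh c).2 = S'
        rw [hN]; exact fun h => h
      clear hb
      cases hm : (lh c).1 + (lh c).2 - 2 * ((lh c).1 + (lh c).2 - cap) with
      | zero =>
        rw [hm] at hb' hl
        have := ih' F _ hg' hb'
        have h1 := hcc.hl; have h2 := hcc.hh
        rw [show (lh c).2 - ((lh c).1 + (lh c).2 - cap) = 0 by omega] at hl
        simp only [zero_mul, Nat.zero_sub, add_zero] at hl
        rw [hl, ← add_assoc]; exact this
      | succ m' =>
        have hb'' : build P cp cap H t (opt H c.K0 c.K1 ((lh c).1 + (lh c).2 - 2 * ((lh c).1 + (lh c).2 - cap)) F) (S + hiV cap c (lh c).1 (lh c).2) = true := by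
          revert hb'
          generalize build P cp cap H t (opt H c.K0 c.K1 ((lh c).1 + (lh c).2 - 2 * ((lh c).1 + (lh c).2 - cap)) F) (S + hiV cap c (lh c).1 (lh c).2) = X
          rw [hm]; exact fun h => h
        have h3 := ih' _ _ hg' hb''
        have h1 := hcc.hl; have h2 := hcc.hh
        have h4 := opt_sound (by omega) h3 ((lh c).2 - ((lh c).1 + (lh c).2 - cap)) (by omega)
        rw [show S + hiV cap c (lh c).1 (lh c).2 + L - ((((lh c).2 - ((lh c).1 + (lh c).2 - cap)) * c.K1 + ((lh c).1 + (lh c).2 - 2 * ((lh c).1 + (lh c).2 - cap) - ((lh c).2 - ((lh c).1 + (lh c).2 - cap))) * c.K0))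
          = S + (loV c (lh c).1 (lh c).2 + L) by omega] at h4
        exact tryF_sound h4 hgl
def cnt (B : Finset ℕ) (m x : ℕ) : ℕ := (B.filter (fun v => v % m = x)).card
theorem sum_cnt (B : Finset ℕ) (m : ℕ) (hm : 0 < m) (q : ℕ → ℕ) :
    ∑ x ∈ Finset.range m, cnt B m x * q x = ∑ v ∈ B, q (v % m) := by
  rw [← Finset.sum_fiberwise_of_maps_to (s := B) (t := Finset.range m) (g := fun v => v % m)
    (fun v _ => Finset.mem_range.2 (Nat.mod_lt _ hm))]
  refine Finset.sum_congr rfl (fun x _ => ?_)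
  rw [Finset.sum_congr rfl (g := fun _ => q x) (fun v hv => by rw [(Finset.mem_filter.1 hv).2])]
  simp [cnt]
theorem cnt_split (B : Finset ℕ) (m x : ℕ) (hx : x < m) : cnt B (2 * m) x + cnt B (2 * m) (x + m) = cnt B m x := by
  unfold cnt
  rw [← Finset.card_union_of_disjoint]
  · congr 1; ext v
    simp only [Finset.mem_union, Finset.mem_filter]
    have h1 : v % (2 * m) % m = v % m := Nat.mod_mul_left_mod _ _ _
    have h2 : v % (2 * m) < 2 * m := Nat.mod_lt _ (by omega)
    constructor
    · rintro (⟨h, h3⟩ | ⟨h, h3⟩)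
      · refine ⟨h, ?_⟩; rw [← h1, h3]; exact Nat.mod_eq_of_lt hx
      · refine ⟨h, ?_⟩; rw [← h1, h3]; simp [Nat.mod_eq_of_lt hx]
    · rintro ⟨h, h3⟩
      rcases Nat.lt_or_ge (v % (2 * m)) m with h4 | h4
      · left; rw [Nat.mod_eq_of_lt h4] at h1; exact ⟨h, h1.trans h3⟩
      · right; rw [Nat.mod_eq_sub_mod h4, Nat.mod_eq_of_lt (by omega)] at h1; exact ⟨h, by omega⟩
  · rw [Finset.disjoint_filter]; intro v _ h1 h2; omega
theorem cnt_le_card (B : Finset ℕ) (m x : ℕ) : cnt B m x ≤ B.card := Finset.card_filter_le _ _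
theorem cnt_cap (B : Finset ℕ) (hB : ∀ v ∈ B, v < 64) (k x : ℕ) (hk : k ≤ 6) : cnt B (2 ^ k) x ≤ 2 ^ (6 - k) := by
  unfold cnt
  have : ((B.filter (fun v => v % 2 ^ k = x)).image (fun v => v / 2 ^ k)).card = (B.filter (fun v => v % 2 ^ k = x)).card := by
    apply Finset.card_image_of_injOn
    intro a ha b hb hab
    simp only [Finset.coe_filter, Set.mem_ofPred_eq] at ha hb
    simp only at hab
    rw [← Nat.div_add_mod a (2 ^ k), ← Nat.div_add_mod b (2 ^ k), hab, ha.2, hb.2]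
  rw [← this]
  refine (Finset.card_le_card (t := Finset.range (2 ^ (6 - k))) ?_).trans (by simp)
  intro y hy
  simp only [Finset.mem_image, Finset.mem_filter] at hy
  obtain ⟨v, ⟨hv, _⟩, rfl⟩ := hy
  rw [Finset.mem_range, Nat.div_lt_iff_lt_mul (by positivity), ← pow_add, show 6 - k + k = 6 by omega]
  exact hB v hv

theorem packF_zero {ι : Type} (J : List ι) : packF (fun _ => 0) J = 0 := by
  have := packF_mul 0 (fun _ => 0) J
  simpa using this
theorem low_bd (l h r0 r1 : ℕ) (h0 : r0 < 2 ^ 58) (h1 : r1 < 2 ^ 58) : l * r1 + h * r0 ≤ 2 ^ 58 * (l + h) := by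
  have a1 : l * r1 ≤ l * 2 ^ 58 := Nat.mul_le_mul_left _ h1.le
  have a2 : h * r0 ≤ h * 2 ^ 58 := Nat.mul_le_mul_left _ h0.le
  omega
theorem hi64_eq (a r : ℕ) : hi64 a r = r + 2 ^ 64 * a := rfl
theorem rnd_lt (x : ℕ) : rnd x < 2 ^ 58 := lt_trans (Nat.mod_lt _ (by norm_num)) (by norm_num)
def cellOf (J : List Cst) (m x : ℕ) : Cell :=
  ⟨64 + 10 * x, rnd (2 * x) + rnd (2 * x + 1) + 2 ^ 64 * packF (fun q : Cst => q.1 x + (q.1 (x + m) - q.1 x)) J,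
    rnd (2 * x) + 2 ^ 64 * packF (fun q : Cst => q.1 (x + m) - q.1 x) J,
    rnd (2 * x + 1) + 2 ^ 64 * packF (fun q : Cst => q.1 x - q.1 (x + m)) J,
    (rnd (2 * x) + 2 ^ 64 * packF (fun q : Cst => q.1 (x + m) - q.1 x) J) +
    (rnd (2 * x + 1) + 2 ^ 64 * packF (fun q : Cst => q.1 x - q.1 (x + m)) J)⟩
theorem mkTab_eq (J : List Cst) (m : ℕ) (l : List ℕ) (k : List Cell → Bool) : mkTab J m l k = k (l.map (cellOf J m)) := by
  induction l generalizing k with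
  | nil => rfl
  | cons x l ih =>
    rw [List.map_cons]
    refine (ih (fun t => k (Cell.mk _ _ _ _ _ :: t))).trans ?_
    have e : packF (fun q : Cst => q.1 x - q.1 (x + m)) J = packF (fun q => q.1 x) J + packF (fun q : Cst => q.1 (x + m) - q.1 x) J - packF (fun q => q.1 (x + m)) J := by
      rw [← packF_add, ← packF_sub]
      · exact packF_congr (fun q _ => by omega)
      · intro q _; omega
    congr 1
    unfold cellOf
    rw [e, packF_add]
    rfl
section
variable (J : List Cst) (B : Finset ℕ) (m : ℕ)
/-- properties of a partial slack value -/
def PV (l : List ℕ) (X : ℕ) : Prop := ∃ (lo : ℕ) (f : Cst → ℕ), X = lo + 2 ^ 64 * packF f J ∧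
  lo ≤ 2 ^ 59 * (l.map (cnt B m)).sum ∧ ∀ q ∈ J, (l.map (fun x => cnt B (2 * m) x * q.1 x + cnt B (2 * m) (x + m) * q.1 (x + m))).sum ≤ f q ∧
    f q ≤ 16 * (l.map (cnt B m)).sum
theorem PV_add (l1 l2 : List ℕ) (X Y : ℕ) (h1 : PV J B m l1 X) (h2 : PV J B m l2 Y) : PV J B m (l1 ++ l2) (X + Y) := by
  obtain ⟨a, f, rfl, ha, hf⟩ := h1
  obtain ⟨b, g, rfl, hb, hg⟩ := h2
  refine ⟨a + b, fun q => f q + g q, ?_, ?_, ?_⟩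
  · rw [packF_add]; ring
  · rw [List.map_append, List.sum_append]; omega
  · intro q hq
    have := hf q hq; have := hg q hq
    show _ ≤ f q + g q ∧ f q + g q ≤ _
    rw [List.map_append, List.sum_append, List.map_append, List.sum_append]; omega
theorem PV_list (V : ℕ → ℕ) (l : List ℕ) (h : ∀ x ∈ l, PV J B m [x] (V x)) : PV J B m l (l.map V).sum := by
  induction l with
  | nil => exact ⟨0, fun _ => 0, by rw [packF_zero]; simp, by simp, by simp⟩
  | cons x l ih =>
    rw [List.map_cons, List.sum_cons]
    exact PV_add J B m [x] l _ _ (h x (by simp)) (ih (fun y hy => h y (by simp [hy])))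
variable (hJ : ∀ q ∈ J, ∀ x, q.1 x ≤ 16)
theorem loV_eq (x l h : ℕ) : loV (cellOf J m x) l h = (l * rnd (2 * x + 1) + h * rnd (2 * x)) +
    2 ^ 64 * packF (fun q : Cst => l * q.1 x + h * q.1 (x + m)) J := by
  unfold loV cellOf
  simp only
  have e1 : packF (fun q : Cst => q.1 x + (q.1 (x + m) - q.1 x)) J = packF (fun q : Cst => q.1 x) J + packF (fun q : Cst => q.1 (x + m) - q.1 x) J := packF_add _ _ _
  have e2 : packF (fun q : Cst => q.1 x + (q.1 (x + m) - q.1 x)) J = packF (fun q : Cst => q.1 (x + m)) J + packF (fun q : Cst => q.1 x - q.1 (x + m)) J := by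
    rw [← packF_add]; exact packF_congr (fun q _ => by omega)
  rw [packF_add (fun q : Cst => l * q.1 x), packF_mul, packF_mul]
  rw [show rnd (2 * x) + rnd (2 * x + 1) + 2 ^ 64 * packF (fun q : Cst => q.1 x + (q.1 (x + m) - q.1 x)) J - (rnd (2 * x) + 2 ^ 64 * packF (fun q : Cst => q.1 (x + m) - q.1 x) J)
    = rnd (2 * x + 1) + 2 ^ 64 * packF (fun q : Cst => q.1 x) J by rw [e1]; omega]
  rw [show rnd (2 * x) + rnd (2 * x + 1) + 2 ^ 64 * packF (fun q : Cst => q.1 x + (q.1 (x + m) - q.1 x)) J - (rnd (2 * x + 1) + 2 ^ 64 * packF (fun q : Cst => q.1 x - q.1 (x + m)) J)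
    = rnd (2 * x) + 2 ^ 64 * packF (fun q : Cst => q.1 (x + m)) J by rw [e2]; omega]
  ring
include hJ
theorem PV_lo (x : ℕ) (hx : x < m) : PV J B m [x] (loV (cellOf J m x) (cnt B (2 * m) x) (cnt B (2 * m) (x + m))) := by
  refine ⟨_, _, loV_eq J m x _ _, ?_, ?_⟩
  · simp only [List.map_cons, List.map_nil, List.sum_cons, List.sum_nil]
    have h1 := low_bd (cnt B (2 * m) x) (cnt B (2 * m) (x + m)) _ _ (rnd_lt (2 * x)) (rnd_lt (2 * x + 1))
    rw [← cnt_split B m x hx]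
    omega
  · intro q hq
    simp only [List.map_cons, List.map_nil, List.sum_cons, List.sum_nil]
    rw [← cnt_split B m x hx]
    have := hJ q hq x; have := hJ q hq (x + m)
    constructor <;> nlinarith
theorem PV_hi (P cp cap x : ℕ) (hx : x < m) (h : CellOK P cp cap (cellOf J m x) (cnt B (2 * m) x) (cnt B (2 * m) (x + m))) :
    PV J B m [x] (hiV cap (cellOf J m x) (cnt B (2 * m) x) (cnt B (2 * m) (x + m))) := by
  rw [← loss h, loV_eq]
  have h1 := h.hl; have h2 := h.hh
  obtain ⟨l, hl⟩ : ∃ l, l = cnt B (2 * m) x := ⟨_, rfl⟩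
  obtain ⟨r, hr⟩ : ∃ l, l = cnt B (2 * m) (x + m) := ⟨_, rfl⟩
  have hlr := cnt_split B m x hx
  unfold PV
  simp only [List.map_cons, List.map_nil, List.sum_cons, List.sum_nil, add_zero]
  rw [← hlr, ← hl, ← hr]
  rw [← hl] at h1
  rw [← hr] at h2
  obtain ⟨i, hi⟩ : ∃ i, i = r - (l + r - cap) := ⟨_, rfl⟩
  obtain ⟨j, hj⟩ : ∃ j, j = l + r - 2 * (l + r - cap) - (r - (l + r - cap)) := ⟨_, rfl⟩
  rw [← hj, ← hi]
  have hir : i ≤ r := by omega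
  have hjl : j ≤ l := by omega
  have hr1 := low_bd l r _ _ (rnd_lt (2 * x)) (rnd_lt (2 * x + 1))
  have hr2 := low_bd i j _ _ (rnd_lt (2 * x)) (rnd_lt (2 * x + 1))
  refine ⟨l * rnd (2 * x + 1) + r * rnd (2 * x) + i * rnd (2 * x + 1) + j * rnd (2 * x), 
    fun q => (l * q.1 x + r * q.1 (x + m)) + (i * (q.1 x - q.1 (x + m)) + j * (q.1 (x + m) - q.1 x)), ?_, ?_, ?_⟩
  · rw [packF_add (fun q : Cst => l * q.1 x + r * q.1 (x + m)), packF_add (fun q : Cst => i * (q.1 x - q.1 (x + m))), packF_mul i, packF_mul j]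
    unfold cellOf; simp only; ring
  · omega
  · intro q hq
    have := hJ q hq x; have := hJ q hq (x + m)
    refine ⟨Nat.le_add_right _ _, ?_⟩
    show l * q.1 x + r * q.1 (x + m) + (i * (q.1 x - q.1 (x + m)) + j * (q.1 (x + m) - q.1 x)) ≤ _
    rcases le_total (q.1 x) (q.1 (x + m)) with h5 | h5
    · rw [Nat.sub_eq_zero_of_le h5]
      obtain ⟨d, hd⟩ := Nat.exists_eq_add_of_le h5
      rw [hd, show q.1 x + d - q.1 x = d by omega]
      nlinarith
    · rw [Nat.sub_eq_zero_of_le h5]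
      obtain ⟨d, hd⟩ := Nat.exists_eq_add_of_le h5
      rw [hd, show q.1 (x + m) + d - q.1 (x + m) = d by omega]
      nlinarith
end
def St (B : Finset ℕ) (M k P : ℕ) : Prop := ∃ r l, l < 2 ^ 64 ∧
  P = l + 2 ^ 64 * (packF (fun x => cpOf M k - cnt B (2 ^ k) x) (List.range (2 ^ k)) + 1024 ^ (2 ^ k) * r)
theorem cpOf_eq (M k : ℕ) : cpOf M k = 512 + (M - (M - 2 ^ (6 - k))) := rfl
theorem St_dg {B : Finset ℕ} {M k P : ℕ} (hB : ∀ v ∈ B, v < 64) (hc : B.card = M) (hM : M ≤ 31) (hk : k ≤ 6) (h : St B M k P) (x : ℕ)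
    (hx : x < 2 ^ k) : cpOf M k - dg P (64 + 10 * x) = cnt B (2 ^ k) x := by
  obtain ⟨r, l, hl, rfl⟩ := h
  have h1 := cnt_cap B hB k x hk
  have h2 := cnt_le_card B (2 ^ k) x
  rw [dg_eq, pow_add, ← Nat.div_div_eq_div_mul, Nat.add_mul_div_left _ _ (by positivity), Nat.div_eq_of_lt hl, zero_add,
    dg_packF _ _ _ r x hx]
  · rw [cpOf_eq]; omega
  · intro x _; rw [cpOf_eq]; omega
set_option maxHeartbeats 1000000 in
theorem lev_sound {B : Finset ℕ} {M k P : ℕ} (hB : ∀ v ∈ B, v < 64) (hc : B.card = M) (hM : M ≤ 31) (hk : k ≤ 5) (h : St B M k P)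
    (K : List Cst) (J : List Cst)
    (hJe : J = (List.range (2 * 2 ^ k)).map (fun y => ((fun x => neb x y, M - 2 ^ (5 - k)) : Cst)) ++ K)
    (hJ : ∀ q ∈ J, ∀ x, q.1 x ≤ 16)
    (hq : ∀ q ∈ J, q.2 ≤ ∑ v ∈ B, q.1 (v % 2 ^ (k + 1))) (F : ℕ → Bool)
    (hb : build P (cpOf M k) (2 ^ (5 - k)) (hi64 (packF (fun _ => 512) J) 0) ((List.range (2 ^ k)).map (cellOf J (2 ^ k))) F
      (hi64 (packF (fun q => 512 - q.2) J) 0) = true) : ∃ P', St B M (k + 1) P' ∧ F P' = true := by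
  set m := 2 ^ k with hm
  have hm0 : 0 < m := by positivity
  have h2m : 2 ^ (k + 1) = 2 * m := by rw [pow_succ]; ring
  rw [h2m] at hq
  set lh : Cell → ℕ × ℕ := fun c => (cnt B (2 * m) ((c.off - 64) / 10), cnt B (2 * m) ((c.off - 64) / 10 + m)) with hlh
  have hlhx : ∀ x, lh (cellOf J m x) = (cnt B (2 * m) x, cnt B (2 * m) (x + m)) := by
    intro x
    have : ((cellOf J m x).off - 64) / 10 = x := by
      show (64 + 10 * x - 64) / 10 = x
      omega
    rw [hlh]; simp only [this]
  have hok : ∀ x < m, CellOK P (cpOf M k) (2 ^ (5 - k)) (cellOf J m x) (cnt B (2 * m) x) (cnt B (2 * m) (x + m)) := by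
    intro x hx
    refine ⟨?_, ?_, ?_, rfl, ?_, ?_⟩
    · rw [cnt_split B m x hx]; exact St_dg hB hc hM (by omega) h x hx
    · rw [← h2m]; exact (cnt_cap B hB (k + 1) x (by omega)).trans (by rw [show 6 - (k + 1) = 5 - k by omega])
    · rw [← h2m]; exact (cnt_cap B hB (k + 1) _ (by omega)).trans (by rw [show 6 - (k + 1) = 5 - k by omega])
    · have : packF (fun q : Cst => q.1 (x + m) - q.1 x) J ≤ packF (fun q : Cst => q.1 x + (q.1 (x + m) - q.1 x)) J :=
        packF_le (fun q _ => by omega)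
      show rnd (2 * x) + 2 ^ 64 * _ ≤ rnd (2 * x) + rnd (2 * x + 1) + 2 ^ 64 * _
      omega
    · have : packF (fun q : Cst => q.1 x - q.1 (x + m)) J ≤ packF (fun q : Cst => q.1 x + (q.1 (x + m) - q.1 x)) J :=
        packF_le (fun q _ => by omega)
      show rnd (2 * x + 1) + 2 ^ 64 * _ ≤ rnd (2 * x) + rnd (2 * x + 1) + 2 ^ 64 * _
      omega
  have hsumM : ((List.range m).map (cnt B m)).sum = M := by
    have h1 := sum_cnt B m hm0 (fun _ => 1)
    simp only [mul_one, Finset.sum_const, smul_eq_mul] at h1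
    rw [← hc, ← h1]; rfl
  have hsumq : ∀ q : ℕ → ℕ, ((List.range m).map (fun x => cnt B (2 * m) x * q x + cnt B (2 * m) (x + m) * q (x + m))).sum
      = ∑ v ∈ B, q (v % (2 * m)) := by
    intro q
    rw [← sum_cnt B (2 * m) (by omega) q, two_mul, Finset.sum_range_add, ← two_mul]
    rw [← Finset.sum_add_distrib]
    simp only [add_comm m]
    rfl
  -- all partial values are good
  have hgood : ∀ X, PV J B m (List.range m) X → (hi64 (packF (fun q => 512 - q.2) J) 0 + X) &&& (hi64 (packF (fun _ => 512) J) 0)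
      = hi64 (packF (fun _ => 512) J) 0 := by
    rintro X ⟨lo, f, rfl, hlo, hf⟩
    rw [hsumM] at hlo
    rw [hi64_eq, hi64_eq]
    have e : 0 + 2 ^ 64 * packF (fun q : Cst => 512 - q.2) J + (lo + 2 ^ 64 * packF f J) = lo + 2 ^ 64 * packF (fun q : Cst => (512 - q.2) + f q) J := by
      rw [packF_add]; ring
    rw [e, land_base 64 lo 0 _ _ (by omega) (by positivity), packF_land]
    · simp
    · intro q hqJ
      have h1 := hf q hqJ
      rw [hsumM, hsumq] at h1
      have h2 := hq q hqJ
      constructor <;> omega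
  have key := build_sound P (cpOf M k) (2 ^ (5 - k)) _ lh _ (by
    intro c hc'
    obtain ⟨x, hx, rfl⟩ := List.mem_map.1 hc'
    rw [hlhx]; exact hok x (List.mem_range.1 hx)) F _ (by
    intro t1 t2 h12
    obtain ⟨l1, l2, hl, rfl, rfl⟩ := List.map_eq_append_iff.1 h12.symm
    have hlt : ∀ x, x ∈ l1 ∨ x ∈ l2 → x < m := by
      intro x hx; rw [← List.mem_range, hl]; simpa using hx
    rw [add_assoc]
    apply hgood
    rw [hl, List.map_map, List.map_map]
    apply PV_add
    · apply PV_list; intro x hx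
      simp only [Function.comp, hlhx]
      exact PV_hi J B m hJ P _ _ x (hlt x (Or.inl hx)) (hok x (hlt x (Or.inl hx)))
    · apply PV_list; intro x hx
      simp only [Function.comp, hlhx]
      exact PV_lo J B m hJ x (hlt x (Or.inr hx))) hb
  refine ⟨_, ?_, key⟩
  rw [List.map_map]
  have e1 : ∀ l : List ℕ, (l.map ((fun c => loV c (lh c).1 (lh c).2) ∘ cellOf J m)).sum =
      (l.map (fun x => cnt B (2 * m) x * rnd (2 * x + 1) + cnt B (2 * m) (x + m) * rnd (2 * x))).sum +
      2 ^ 64 * packF (fun q : Cst => (l.map (fun x => cnt B (2 * m) x * q.1 x + cnt B (2 * m) (x + m) * q.1 (x + m))).sum) J := by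
    intro l
    induction l with
    | nil => simp only [List.map_nil, List.sum_nil]
             rw [packF_zero]; rfl
    | cons x l ih =>
      simp only [List.map_cons, List.sum_cons]
      rw [ih, packF_add]; simp only [Function.comp, hlhx, loV_eq]; ring
  rw [e1]
  have hlow : ∀ l : List ℕ, (∀ x ∈ l, x < m) → (l.map (fun x => cnt B (2 * m) x * rnd (2 * x + 1) + cnt B (2 * m) (x + m) * rnd (2 * x))).sum ≤
      2 ^ 59 * (l.map (cnt B m)).sum := by
    intro l hl
    induction l with
    | nil => simp
    | cons x l ih =>
      simp only [List.map_cons, List.sum_cons]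
      have h1 := ih (fun y hy => hl y (by simp [hy]))
      have h3 := low_bd (cnt B (2 * m) x) (cnt B (2 * m) (x + m)) _ _ (rnd_lt (2 * x)) (rnd_lt (2 * x + 1))
      rw [← cnt_split B m x (hl x (by simp))]
      omega
  have hlow' := hlow (List.range m) (fun x hx => List.mem_range.1 hx)
  rw [hsumM] at hlow'
  refine ⟨packF (fun q : Cst => (512 - q.2) + ∑ v ∈ B, q.1 (v % (2 * m))) K, _, lt_of_le_of_lt hlow' (by omega), ?_⟩
  simp only [hsumq]
  rw [hi64_eq]
  generalize ((List.range m).map (fun x => cnt B (2 * m) x * rnd (2 * x + 1) + cnt B (2 * m) (x + m) * rnd (2 * x))).sum = W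
  have e2 : packF (fun q : Cst => (512 - q.2) + ∑ v ∈ B, q.1 (v % (2 * m))) J =
     packF (fun x => cpOf M (k + 1) - cnt B (2 ^ (k + 1)) x) (List.range (2 ^ (k + 1))) + 1024 ^ (2 ^ (k + 1)) *
       packF (fun q : Cst => (512 - q.2) + ∑ v ∈ B, q.1 (v % (2 * m))) K := by
    rw [hJe, packF_append, packF_map, List.length_map, List.length_range, h2m]
    congr 1
    apply packF_congr
    intro y hy
    have : ∑ v ∈ B, neb (v % (2 * m)) y + cnt B (2 * m) y = M := by
      have e3 : cnt B (2 * m) y = ∑ v ∈ B, (if v % (2 * m) = y then 1 else 0) := by simp [cnt]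
      rw [e3, ← Finset.sum_add_distrib, ← hc, Finset.card_eq_sum_ones]
      refine Finset.sum_congr rfl (fun v _ => ?_)
      unfold neb
      by_cases hv : v % (2 * m) = y
      · rw [show Nat.beq (v % (2 * m)) y = true from Nat.beq_eq ▸ hv, if_pos hv]
      · rw [show Nat.beq (v % (2 * m)) y = false by rw [← Bool.not_eq_true, Nat.beq_eq]; exact hv, if_neg hv]
    have h5 : 2 ^ (6 - (k + 1)) = 2 ^ (5 - k) := by rw [show 6 - (k + 1) = 5 - k by omega]
    rw [cpOf_eq, h5]
    have hM' : M - 2 ^ (5 - k) ≤ 31 := (Nat.sub_le _ _).trans hM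
    show 512 - (M - 2 ^ (5 - k)) + ∑ v ∈ B, neb (v % (2 * m)) y = _
    have := cnt_cap B hB (k + 1) y (by omega)
    rw [h2m, h5] at this
    omega
  rw [← e2, packF_add]
  ring
theorem eqb_eq (a b : ℕ) : eqb a b = if a = b then 1 else 0 := by
  unfold eqb
  by_cases h : a = b
  · rw [show Nat.beq a b = true from Nat.beq_eq ▸ h, if_pos h]
  · rw [show Nat.beq a b = false by rw [← Bool.not_eq_true, Nat.beq_eq]; exact h, if_neg h]
theorem eqb_le (a b : ℕ) : eqb a b ≤ 1 := by rw [eqb_eq]; split_ifs <;> simp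
theorem neb_eq (a b : ℕ) : neb a b = if a = b then 0 else 1 := by
  unfold neb
  by_cases h : a = b
  · rw [show Nat.beq a b = true from Nat.beq_eq ▸ h, if_pos h]
  · rw [show Nat.beq a b = false by rw [← Bool.not_eq_true, Nat.beq_eq]; exact h, if_neg h]
theorem mult_eq (A : List ℕ) (m y : ℕ) : mult A m y = (A.filter (fun a => a % m = y)).length := by
  induction A with
  | nil => rfl
  | cons a A ih =>
    have : mult (a :: A) m y = eqb (a % m) y + mult A m y := rfl
    rw [this, ih, eqb_eq, List.filter_cons]
    by_cases h : a % m = y <;> simp [h, add_comm]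
theorem mult_le (A : List ℕ) (m y : ℕ) : mult A m y ≤ A.length := by rw [mult_eq]; exact List.length_filter_le _ _
def hc (B : Finset ℕ) (g i : ℕ) : ℕ := ∑ v ∈ B, ind g i v
structure VB (A : List ℕ) (w M s : ℕ) (B : Finset ℕ) : Prop where
  lt : ∀ v ∈ B, v < 64
  card : B.card = M
  hM : M ≤ 31
  hA : A.length ≤ 16
  cov : ∀ u < 64, ∃ a ∈ A, ∃ v ∈ B, a ^^^ v = u
  dif : ∀ d < 64, d ≠ 0 → (∃ a ∈ A, ∃ a' ∈ A, a ^^^ a' = d) ∨ ∃ v ∈ B, ∃ v' ∈ B, v ^^^ v' = d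
  half : ∀ g < 64, g ≠ 0 → ∀ i < 2, ∀ j < 2, w ≤ cntA A g j + hc B g i
  sum : s < 64 → ∀ g < 64, hc B g 1 % 2 = par (g &&& s)
variable {A : List ℕ} {w M s : ℕ} {B : Finset ℕ}
theorem residues (j : ℕ) (hj : j ≤ 6) (y : ℕ) (hy : y < 2 ^ j) :
    2 ^ (6 - j) ≤ ((Finset.range 64).filter (fun u => u % 2 ^ j = y)).card := by
  have h64 : 2 ^ (6 - j) * 2 ^ j = 64 := by rw [← pow_add, show 6 - j + j = 6 by omega]; norm_num
  calc 2 ^ (6 - j) = ((Finset.range (2 ^ (6 - j))).image (fun t => y + 2 ^ j * t)).card := by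
        rw [Finset.card_image_of_injective, Finset.card_range]
        intro a b h
        have := Nat.eq_of_mul_eq_mul_left (show 0 < 2 ^ j by positivity) (Nat.add_left_cancel h)
        exact this
    _ ≤ _ := by
        apply Finset.card_le_card
        intro u hu
        obtain ⟨t, ht, rfl⟩ := Finset.mem_image.1 hu
        rw [Finset.mem_filter, Finset.mem_range]
        rw [Finset.mem_range] at ht
        constructor
        · have : 2 ^ j * (t + 1) ≤ 2 ^ j * 2 ^ (6 - j) := Nat.mul_le_mul_left _ ht
          rw [mul_comm (2 ^ j) (2 ^ (6 - j)), h64] at this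
          rw [mul_add] at this; omega
        · rw [Nat.add_mul_mod_self_left]; exact Nat.mod_eq_of_lt hy
theorem cover_ok (h : VB A w M s B) (j : ℕ) (hj : j ≤ 6) (y : ℕ) (hy : y < 2 ^ j) :
    2 ^ (6 - j) ≤ ∑ v ∈ B, mult A (2 ^ j) ((v % 2 ^ j) ^^^ y) := by
  refine (residues j hj y hy).trans ?_
  have hsub : (Finset.range 64).filter (fun u => u % 2 ^ j = y) ⊆ B.biUnion (fun v => ((A.filter (fun a => a % 2 ^ j = (v % 2 ^ j) ^^^ y)).map (fun a => a ^^^ v)).toFinset) := by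
    intro u hu
    rw [Finset.mem_filter, Finset.mem_range] at hu
    obtain ⟨a, ha, v, hv, rfl⟩ := h.cov u hu.1
    rw [Finset.mem_biUnion]
    refine ⟨v, hv, ?_⟩
    rw [List.mem_toFinset, List.mem_map]
    refine ⟨a, ?_, rfl⟩
    rw [List.mem_filter]
    refine ⟨ha, ?_⟩
    have := hu.2
    rw [Nat.xor_mod_two_pow] at this
    rw [← this]; simp
  refine (Finset.card_le_card hsub).trans (Finset.card_biUnion_le.trans ?_)
  refine Finset.sum_le_sum (fun v _ => ?_)
  refine (List.toFinset_card_le _).trans ?_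
  rw [List.length_map, mult_eq]
theorem land1 (a : ℕ) : Nat.land a 1 = a % 2 := Nat.and_one_is_mod a
theorem ms_le (w p h : ℕ) (h1 : w ≤ h) (h2 : h % 2 = p % 2) : ms w p ≤ h := by
  have : ms w p = w + (w + p) % 2 := by
    show w + Nat.land (w + p) 1 = _
    rw [land1]
  omega
theorem hc_add (B : Finset ℕ) (g : ℕ) : hc B g 0 + hc B g 1 = B.card := by
  unfold hc
  rw [← Finset.sum_add_distrib, Finset.card_eq_sum_ones]
  refine Finset.sum_congr rfl (fun v _ => ?_)
  unfold ind
  rw [eqb_eq, eqb_eq]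
  have : par (Nat.land g v) < 2 := par_lt _
  split_ifs <;> omega
theorem bnd_ok (h : VB A w M s B) (g i : ℕ) (hg : g < 64) (hg0 : g ≠ 0) (hi : i < 2) : bnd A w M s g i ≤ hc B g i := by
  have h0 := h.half g hg hg0 i hi 0 (by omega)
  have h1 := h.half g hg hg0 i hi 1 (by omega)
  by_cases hs : s < 64
  · have e : bnd A w M s g i = max (ms w (cntA A g 0 + Nat.rec (M + par (g &&& s)) (fun _ _ => par (g &&& s)) i) - cntA A g 0)
       (ms w (cntA A g 1 + Nat.rec (M + par (g &&& s)) (fun _ _ => par (g &&& s)) i) - cntA A g 1) := by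
      unfold bnd
      rw [show Nat.blt s 64 = true by rw [Nat.blt_eq]; exact hs]
      rfl
    rw [e]
    have hp := h.sum hs g hg
    have ha := hc_add B g
    rw [h.card] at ha
    have hb : hc B g i % 2 = (Nat.rec (M + par (g &&& s)) (fun _ _ => par (g &&& s)) i : ℕ) % 2 := by
      interval_cases i
      · show _ = (M + par (g &&& s)) % 2
        omega
      · show _ = par (g &&& s) % 2
        omega
    have e0 := ms_le w (cntA A g 0 + Nat.rec (M + par (g &&& s)) (fun _ _ => par (g &&& s)) i) _ h0 (by omega)
    have e1 := ms_le w (cntA A g 1 + Nat.rec (M + par (g &&& s)) (fun _ _ => par (g &&& s)) i) _ h1 (by omega)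
    omega
  · have e : bnd A w M s g i = max (w - cntA A g 0) (w - cntA A g 1) := by
      unfold bnd
      rw [show Nat.blt s 64 = false by rw [← Bool.not_eq_true, Nat.blt_eq]; exact hs]
      rfl
    rw [e]; omega
theorem ind_mod (g i v j : ℕ) (hg : g < 2 ^ j) : ind g i (v % 2 ^ j) = ind g i v := by
  unfold ind
  have : g &&& (v % 2 ^ j) = g &&& v := by
    apply Nat.eq_of_testBit_eq; intro p
    rw [Nat.testBit_and, Nat.testBit_and, Nat.testBit_mod_two_pow]
    by_cases hp : p < j
    · simp [hp]
    · rw [Nat.testBit_lt_two_pow (lt_of_lt_of_le hg (Nat.pow_le_pow_right (by norm_num) (by omega)))]; simp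
  show eqb (par (g &&& (v % 2 ^ j))) i = eqb (par (g &&& v)) i
  rw [this]
theorem cons_eq (A : List ℕ) (w M s m c lb : ℕ) : cons A w M s m c lb =
  (List.range (2 * m)).map (fun y => ((fun x => neb x y, M - c) : Cst)) ++
  ((List.range (2 * m)).map (fun y => ((fun x => mult A (2 * m) (x ^^^ y), c) : Cst)) ++
  ((ind m 0, lb) :: ((List.range m).map (fun g => ((ind (m + g) 0, bnd A w M s (m + g) 0) : Cst)) ++
     (List.range m).map (fun g => ((ind (m + g) 1, bnd A w M s (m + g) 1) : Cst))))) := by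
  unfold cons
  simp only [appL_eq, mapL_eq, upto_eq]
  rfl
theorem cons_ok (h : VB A w M s B) (k lb : ℕ) (hk : k ≤ 5) (hlb : lb ≤ hc B (2 ^ k) 0) (q : Cst)
    (hq : q ∈ cons A w M s (2 ^ k) (2 ^ (5 - k)) lb) : (∀ x, q.1 x ≤ 16) ∧ q.2 ≤ ∑ v ∈ B, q.1 (v % 2 ^ (k + 1)) := by
  have h2m : 2 * 2 ^ k = 2 ^ (k + 1) := by rw [pow_succ]; ring
  have h5 : 2 ^ (6 - (k + 1)) = 2 ^ (5 - k) := by rw [show 6 - (k + 1) = 5 - k by omega]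
  have h64 : 2 ^ (k + 1) ≤ 64 := (Nat.pow_le_pow_right (by norm_num) (show k + 1 ≤ 6 by omega)).trans (by norm_num)
  have hpos : 0 < 2 ^ k := by positivity
  rw [cons_eq, h2m] at hq
  have hind : ∀ g i x, ind g i x ≤ 16 := fun g i x => (eqb_le _ _).trans (by norm_num)
  rcases List.mem_append.1 hq with hq | hq
  · obtain ⟨y, hy, rfl⟩ := List.mem_map.1 hq
    refine ⟨fun x => by show neb x y ≤ 16; rw [neb_eq]; split_ifs <;> omega, ?_⟩
    show M - 2 ^ (5 - k) ≤ ∑ v ∈ B, neb (v % 2 ^ (k + 1)) y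
    have : ∑ v ∈ B, neb (v % 2 ^ (k + 1)) y + cnt B (2 ^ (k + 1)) y = M := by
      have e3 : cnt B (2 ^ (k + 1)) y = ∑ v ∈ B, (if v % (2 ^ (k + 1)) = y then 1 else 0) := by simp [cnt]
      rw [e3, ← Finset.sum_add_distrib, ← h.card, Finset.card_eq_sum_ones]
      refine Finset.sum_congr rfl (fun v _ => ?_)
      rw [neb_eq]; split_ifs <;> rfl
    have h1 := cnt_cap B h.lt (k + 1) y (by omega)
    omega
  rcases List.mem_append.1 hq with hq | hq
  · obtain ⟨y, hy, rfl⟩ := List.mem_map.1 hq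
    refine ⟨fun x => (mult_le _ _ _).trans h.hA, ?_⟩
    have := cover_ok h (k + 1) (by omega) y (List.mem_range.1 hy)
    rw [h5] at this
    exact this
  rcases List.mem_cons.1 hq with rfl | hq
  · refine ⟨hind _ _, hlb.trans (le_of_eq ?_)⟩
    exact Finset.sum_congr rfl (fun v _ => (ind_mod _ _ _ _ (by omega)).symm)
  rcases List.mem_append.1 hq with hq | hq
  · obtain ⟨g, hg, rfl⟩ := List.mem_map.1 hq
    have hg' := List.mem_range.1 hg
    refine ⟨hind _ _, (bnd_ok h (2 ^ k + g) 0 (by omega) (by omega) (by omega)).trans (le_of_eq ?_)⟩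
    exact Finset.sum_congr rfl (fun v _ => (ind_mod _ _ _ _ (by omega)).symm)
  · obtain ⟨g, hg, rfl⟩ := List.mem_map.1 hq
    have hg' := List.mem_range.1 hg
    refine ⟨hind _ _, (bnd_ok h (2 ^ k + g) 1 (by omega) (by omega) (by omega)).trans (le_of_eq ?_)⟩
    exact Finset.sum_congr rfl (fun v _ => (ind_mod _ _ _ _ (by omega)).symm)
theorem withLev_eq (A : List ℕ) (w M s lb cl k : ℕ) (gs : List (List ℕ)) (K : Lev → Bool) :
    withLev A w M s lb cl k gs K = withChk A M s cl (k + 1) gs (fun chk => K ⟨cpOf M k, 2 ^ (5 - k),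
      hi64 (packF (fun _ => 512) (cons A w M s (2 ^ k) (2 ^ (5 - k)) lb)) 0,
      hi64 (packF (fun q => 512 - q.2) (cons A w M s (2 ^ k) (2 ^ (5 - k)) lb)) 0,
      (List.range (2 ^ k)).map (cellOf (cons A w M s (2 ^ k) (2 ^ (5 - k)) lb) (2 ^ k)), chk⟩) := by
  unfold withLev
  simp only [force_eq]
  rw [mkTab_eq, upto_eq]
  rfl
/-- specification of the check function of a level -/
def ChkOK (A : List ℕ) (M s cl k : ℕ) (gs : List (List ℕ)) (B : Finset ℕ) : Prop :=
  ∃ chk : ℕ → Bool, (∀ K, withChk A M s cl k gs K = K chk) ∧ ∀ P, St B M k P → chk P = false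
theorem levs_sound (h : VB A w M s B) (cl : ℕ) (gs : List (List ℕ)) (hchk : ∀ k < 6, ChkOK A M s cl (k + 1) gs B) (lbs : List ℕ) :
    ∀ k, k + lbs.length ≤ 6 → (∀ i (hi : i < lbs.length), lbs[i] ≤ hc B (2 ^ (k + i)) 0) →
    ∃ Ls, (∀ K, withLevs A w M s cl gs lbs k K = K Ls) ∧ ∀ P, St B M k P → srch Ls P = false := by
  induction lbs with
  | nil => intro k _ _; exact ⟨[], fun K => rfl, fun P _ => rfl⟩
  | cons lb lbs ih =>
    intro k hk hl
    rw [List.length_cons] at hk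
    obtain ⟨Ls, hLs, hs⟩ := ih (k + 1) (by omega) (by
      intro i hi
      have := hl (i + 1) (by rw [List.length_cons]; omega)
      rw [show k + (i + 1) = k + 1 + i by omega] at this
      exact this)
    obtain ⟨chk, hc1, hc2⟩ := hchk k (by omega)
    refine ⟨⟨cpOf M k, 2 ^ (5 - k),
      hi64 (packF (fun _ => 512) (cons A w M s (2 ^ k) (2 ^ (5 - k)) lb)) 0,
      hi64 (packF (fun q => 512 - q.2) (cons A w M s (2 ^ k) (2 ^ (5 - k)) lb)) 0,
      (List.range (2 ^ k)).map (cellOf (cons A w M s (2 ^ k) (2 ^ (5 - k)) lb) (2 ^ k)), chk⟩ :: Ls, ?_, ?_⟩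
    · intro K
      refine Eq.trans (b := withLev A w M s lb cl k gs (fun L => withLevs A w M s cl gs lbs (k + 1) (fun t => K (L :: t)))) rfl ?_
      rw [withLev_eq, hc1, hLs]
    · intro P hP
      by_contra hne
      rw [Bool.not_eq_false] at hne
      have hl0 := hl 0 (by simp)
      obtain ⟨P', hP', hF⟩ := lev_sound (F := fun P' => bor (chk P') (srch Ls P')) h.lt h.card h.hM (by omega) hP _ _ (cons_eq A w M s (2 ^ k) (2 ^ (5 - k)) lb)
        (fun q hq => (cons_ok h k lb (by omega) hl0 q hq).1) (fun q hq => (cons_ok h k lb (by omega) hl0 q hq).2) hne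
      rw [bor_eq, hc2 P' hP', hs P' hP'] at hF
      cases hF
theorem St_init (h : VB A w M s B) : St B M 0 (512 * 2 ^ 64) := by
  refine ⟨0, 0, by positivity, ?_⟩
  have : cnt B 1 0 = M := by
    unfold cnt; rw [← h.card]; congr 1; ext v; simp [Nat.mod_one]
  have h2 := h.hM
  have e : packF (fun x => cpOf M 0 - cnt B (2 ^ 0) x) (List.range (2 ^ 0)) = 512 := by
    show cpOf M 0 - cnt B 1 0 + 1024 * 0 = 512
    rw [this, cpOf_eq]; norm_num; omega
  rw [e]; norm_num
variable {A : List ℕ} {w M s : ℕ} {B : Finset ℕ}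
abbrev pk (B : Finset ℕ) (k : ℕ) : ℕ := packF (cnt B (2 ^ k)) (List.range (2 ^ k))
theorem St_N (h : VB A w M s B) {k P : ℕ} (hk : k ≤ 6) (hP : St B M k P) :
    packF (fun _ => cpOf M k) (upto (2 ^ k)) - (P >>> 64) % 2 ^ (10 * 2 ^ k) = pk B k := by
  obtain ⟨r, l, hl, rfl⟩ := hP
  have hM := h.hM
  have hle : ∀ x, cnt B (2 ^ k) x ≤ cpOf M k := by
    intro x
    have h1 := cnt_cap B h.lt k x hk
    have h2 := cnt_le_card B (2 ^ k) x
    rw [h.card] at h2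
    rw [cpOf_eq]; omega
  have hlt : packF (fun x => cpOf M k - cnt B (2 ^ k) x) (List.range (2 ^ k)) < 1024 ^ (2 ^ k) := by
    have := packF_lt (f := fun x => cpOf M k - cnt B (2 ^ k) x) (J := List.range (2 ^ k)) (fun x _ => by rw [cpOf_eq]; omega)
    simpa using this
  rw [Nat.shiftRight_eq_div_pow, Nat.add_mul_div_left _ _ (by positivity), Nat.div_eq_of_lt hl, zero_add,
    show (2 : ℕ) ^ (10 * 2 ^ k) = 1024 ^ (2 ^ k) by rw [pow_mul]; norm_num, Nat.add_mul_mod_self_left, Nat.mod_eq_of_lt hlt, upto_eq,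
    ← packF_sub (fun x _ => by omega)]
  exact packF_congr (fun x _ => by have := hle x; omega)
/-! ### column parity -/
theorem packF_mod {ι : Type} (f : ι → ℕ) (J : List ι) : packF f J % 1023 = (J.map f).sum % 1023 := by
  induction J with
  | nil => rfl
  | cons j J ih => rw [packF_cons, List.map_cons, List.sum_cons]; omega
theorem pk_bound (h : VB A w M s B) (k x : ℕ) : cnt B (2 ^ k) x < 1024 := by
  have := cnt_le_card B (2 ^ k) x
  have := h.card; have := h.hM; omega
theorem par_pow (k : ℕ) (hk : k < 6) (x : ℕ) (hx : x < 64) : par (2 ^ k &&& x) = x / 2 ^ k % 2 := by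
  have : ∀ k < 6, ∀ x < 64, par (2 ^ k &&& x) = x / 2 ^ k % 2 := by decide +kernel
  exact this k hk x hx
theorem colp_ok (h : VB A w M s B) (k : ℕ) (hk : k < 6) : colp s (k + 1) (pk B (k + 1)) = false := by
  by_cases hs : s < 64
  swap
  · unfold colp
    rw [show Nat.blt s 64 = false by rw [← Bool.not_eq_true, Nat.blt_eq]; exact hs]
  have e2 : 2 ^ (k + 1) = 2 ^ k + 2 ^ k := by rw [pow_succ]; ring
  have e1 : Nat.shiftRight (pk B (k + 1)) (Nat.mul 10 (2 ^ (k + 1 - 1))) = packF (cnt B (2 ^ (k + 1))) ((List.range (2 ^ k)).map (2 ^ k + ·)) := by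
    show (pk B (k + 1)) >>> (10 * 2 ^ k) = _
    unfold pk
    nth_rw 2 [e2]
    rw [List.range_add, packF_append, Nat.shiftRight_eq_div_pow, List.length_range,
      show (2 : ℕ) ^ (10 * 2 ^ k) = 1024 ^ (2 ^ k) by rw [pow_mul]; norm_num, Nat.add_mul_div_left _ _ (by positivity), Nat.div_eq_of_lt, zero_add]
    have := packF_lt (f := cnt B (2 ^ (k + 1))) (J := List.range (2 ^ k)) (fun x _ => pk_bound h _ x)
    simpa using this
  have e3 : (((List.range (2 ^ k)).map (2 ^ k + ·)).map (cnt B (2 ^ (k + 1)))).sum = hc B (2 ^ k) 1 := by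
    have h1 := sum_cnt B (2 ^ (k + 1)) (by positivity) (ind (2 ^ k) 1)
    have h2 : ∑ v ∈ B, ind (2 ^ k) 1 (v % 2 ^ (k + 1)) = hc B (2 ^ k) 1 :=
      Finset.sum_congr rfl (fun v _ => ind_mod _ _ _ _ (by rw [pow_succ]; have : 0 < 2 ^ k := by positivity
                                                           omega))
    rw [h2] at h1
    nth_rw 1 [e2] at h1
    rw [Finset.sum_range_add] at h1
    have h64 : 2 ^ k + 2 ^ k ≤ 64 := by rw [← e2]; exact (Nat.pow_le_pow_right (by norm_num) (show k + 1 ≤ 6 by omega)).trans (by norm_num)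
    have h3 : ∑ x ∈ Finset.range (2 ^ k), cnt B (2 ^ (k + 1)) x * ind (2 ^ k) 1 x = 0 := by
      apply Finset.sum_eq_zero
      intro x hx
      have hx := Finset.mem_range.1 hx
      have : ind (2 ^ k) 1 x = 0 := by
        unfold ind
        rw [eqb_eq, show Nat.land (2 ^ k) x = 2 ^ k &&& x from rfl, par_pow k hk x (by omega), Nat.div_eq_of_lt hx]; simp
      rw [this, mul_zero]
    rw [h3, zero_add] at h1
    rw [← h1, List.map_map]
    have : ∀ x ∈ Finset.range (2 ^ k), cnt B (2 ^ (k + 1)) (2 ^ k + x) * ind (2 ^ k) 1 (2 ^ k + x) = cnt B (2 ^ (k + 1)) (2 ^ k + x) := by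
      intro x hx
      have hx := Finset.mem_range.1 hx
      have : ind (2 ^ k) 1 (2 ^ k + x) = 1 := by
        unfold ind
        rw [eqb_eq, show Nat.land (2 ^ k) (2 ^ k + x) = 2 ^ k &&& (2 ^ k + x) from rfl, par_pow k hk _ (by omega), 
          show (2 ^ k + x) / 2 ^ k = 1 by rw [Nat.add_div_left _ (by positivity), Nat.div_eq_of_lt hx]]; simp
      rw [this, mul_one]
    rw [Finset.sum_congr rfl this]
    rfl
  have h4 := hc_add B (2 ^ k)
  have hM := h.hM
  rw [h.card] at h4
  have hk64 : 2 ^ k < 64 := (Nat.pow_lt_pow_right (by norm_num) hk).trans_eq (by norm_num)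
  have h5 := h.sum hs (2 ^ k) hk64
  rw [par_pow k hk s hs] at h5
  unfold colp
  rw [show Nat.blt s 64 = true by rw [Nat.blt_eq]; exact hs, e1]
  have e4 : Nat.land (Nat.mod (packF (cnt B (2 ^ (k + 1))) ((List.range (2 ^ k)).map (2 ^ k + ·))) 1023) 1 = Nat.land (Nat.shiftRight s (k + 1 - 1)) 1 := by
    rw [land1, land1]
    show packF _ _ % 1023 % 2 = (s >>> k) % 2
    rw [packF_mod, e3, Nat.mod_eq_of_lt (show hc B (2 ^ k) 1 < 1023 by omega), Nat.shiftRight_eq_div_pow, h5]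
  rw [e4, show ∀ a, Nat.beq a a = true from fun a => Nat.beq_eq ▸ rfl]
/-! ### difference check -/
theorem packF_range (f : ℕ → ℕ) (m : ℕ) : packF f (List.range m) = ∑ x ∈ Finset.range m, f x * 1024 ^ x := by
  induction m with
  | zero => rfl
  | succ m ih => rw [List.range_succ, packF_append, ih, Finset.sum_range_succ, List.length_range, packF_cons, packF_nil]; ring
theorem prod_coef (f g : ℕ → ℕ) (m j : ℕ) (hj : j < 2 * m) (hb : (∑ x ∈ Finset.range m, f x) * (∑ x ∈ Finset.range m, g x) < 1024) :
    (packF f (List.range m) * packF g (List.range m)) / 2 ^ (10 * j) % 1024 =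
      ∑ x ∈ Finset.range m, ∑ y ∈ Finset.range m, if x + y = j then f x * g y else 0 := by
  set c : ℕ → ℕ := fun j => ∑ x ∈ Finset.range m, ∑ y ∈ Finset.range m, if x + y = j then f x * g y else 0 with hc
  have e : packF f (List.range m) * packF g (List.range m) = packF c (List.range (2 * m)) + 1024 ^ (2 * m) * 0 := by
    rw [packF_range, packF_range, packF_range, Finset.sum_mul_sum, mul_zero, add_zero, hc]
    simp only [Finset.sum_mul]
    symm
    rw [Finset.sum_comm]
    refine Finset.sum_congr rfl (fun x hx => ?_)
    rw [Finset.sum_comm]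
    refine Finset.sum_congr rfl (fun y hy => ?_)
    have hx := Finset.mem_range.1 hx
    have hy := Finset.mem_range.1 hy
    rw [Finset.sum_eq_single (x + y)]
    · rw [if_pos rfl, pow_add]; ring
    · intro b _ hb; rw [if_neg (Ne.symm hb), zero_mul]
    · intro hn; exact absurd (Finset.mem_range.2 (by omega)) hn
  rw [e]
  refine dg_packF c (2 * m) (fun j _ => lt_of_le_of_lt ?_ hb) 0 j hj
  rw [hc, Finset.sum_mul_sum]
  refine Finset.sum_le_sum (fun x _ => Finset.sum_le_sum (fun y _ => ?_))
  split_ifs <;> simp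
theorem testBit_packF (f : ℕ → ℕ) (m : ℕ) (hf : ∀ x, f x < 1024) (p : ℕ) :
    (packF f (List.range m)).testBit p = (decide (p / 10 < m) && (f (p / 10)).testBit (p % 10)) := by
  by_cases hp : p / 10 < m
  · have h := dg_packF f m (fun x _ => hf x) 0 (p / 10) hp
    rw [mul_zero, add_zero] at h
    rw [← h, show (1024 : ℕ) = 2 ^ 10 by norm_num, Nat.testBit_mod_two_pow, Nat.testBit_div_two_pow]
    have : p % 10 < 10 := Nat.mod_lt _ (by norm_num)
    rw [show 10 * (p / 10) = p - p % 10 by omega, show p % 10 + (p - p % 10) = p by have := Nat.mod_le p 10; omega]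
    simp [hp, this]
  · have : packF f (List.range m) < 2 ^ p := by
      have h1 := packF_lt (f := f) (J := List.range m) (fun x _ => hf x)
      rw [List.length_range, show (1024 : ℕ) = 2 ^ 10 by norm_num, ← pow_mul] at h1
      exact lt_of_lt_of_le h1 (Nat.pow_le_pow_right (by norm_num) (by omega))
    rw [Nat.testBit_lt_two_pow this]; simp [hp]
def qOf (k i : ℕ) : ℕ × ℕ := (10 * 2 ^ i, packF (fun x => 1023 * eqb (x &&& 2 ^ i) 0) (List.range (2 ^ k)))
theorem bitfact0 : ∀ i < 6, ∀ x < 64, x &&& 2 ^ i = 0 → x ^^^ 2 ^ i = x + 2 ^ i := by decide +kernel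
theorem bitfact1 : ∀ i < 6, ∀ x < 64, x &&& 2 ^ i = 0 → 2 ^ i ≤ x → ¬ ((x - 2 ^ i) &&& 2 ^ i = 0) := by decide +kernel
theorem bitfact2 : ∀ i < 6, ∀ x < 64, x &&& 2 ^ i = 0 ∨ (2 ^ i ≤ x ∧ x ^^^ 2 ^ i = x - 2 ^ i ∧ (x - 2 ^ i) &&& 2 ^ i = 0) := by decide +kernel
theorem bitfact (i : ℕ) (hi : i < 6) (x : ℕ) (hx : x < 64) : (x &&& 2 ^ i = 0 → x ^^^ 2 ^ i = x + 2 ^ i ∧ (2 ^ i ≤ x → (x - 2 ^ i) &&& 2 ^ i ≠ 0)) ∧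
    (x &&& 2 ^ i ≠ 0 → 2 ^ i ≤ x ∧ x ^^^ 2 ^ i = x - 2 ^ i ∧ (x - 2 ^ i) &&& 2 ^ i = 0) :=
  ⟨fun h => ⟨bitfact0 i hi x hx h, bitfact1 i hi x hx h⟩, fun h => (bitfact2 i hi x hx).resolve_left h⟩
theorem swp_ok (f : ℕ → ℕ) (k i : ℕ) (hk : k ≤ 6) (hi : i < k) (hf : ∀ x, f x < 1024) :
    swp (qOf k i) (packF f (List.range (2 ^ k))) = packF (fun x => f (x ^^^ 2 ^ i)) (List.range (2 ^ k)) := by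
  have h64 : 2 ^ k ≤ 64 := (Nat.pow_le_pow_right (by norm_num) hk).trans (by norm_num)
  have hik : 2 ^ i < 2 ^ k := Nat.pow_lt_pow_right (by norm_num) hi
  have hmask : ∀ x, 1023 * eqb (x &&& 2 ^ i) 0 < 1024 := fun x => by have := eqb_le (x &&& 2 ^ i) 0; omega
  have hmb : ∀ x p, p < 10 → (1023 * eqb (x &&& 2 ^ i) 0).testBit p = decide (x &&& 2 ^ i = 0) := by
    intro x p hp
    rw [eqb_eq]
    by_cases hx : x &&& 2 ^ i = 0
    · rw [if_pos hx]; simp only [hx, decide_true, mul_one]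
      have : (2 ^ 10 - 1).testBit p = decide (p < 10) := Nat.testBit_two_pow_sub_one 10 p
      simpa [hp] using this
    · rw [if_neg hx]; simp [hx]
  apply Nat.eq_of_testBit_eq; intro p
  have hp10 : p % 10 < 10 := Nat.mod_lt _ (by norm_num)
  have e : swp (qOf k i) (packF f (List.range (2 ^ k))) = ((packF f (List.range (2 ^ k)) &&& (qOf k i).2) <<< (qOf k i).1) |||
     ((packF f (List.range (2 ^ k)) >>> (qOf k i).1) &&& (qOf k i).2) := rfl
  rw [e, Nat.testBit_or, Nat.testBit_shiftLeft, Nat.testBit_and, Nat.testBit_and, Nat.testBit_shiftRight]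
  unfold qOf
  simp only
  rw [testBit_packF _ _ hf, testBit_packF _ _ hmask, testBit_packF _ _ hf, testBit_packF _ _ hmask, testBit_packF _ _ (fun x => hf _)]
  rw [hmb _ _ (Nat.mod_lt _ (by norm_num)), hmb _ _ hp10]
  rw [show (10 * 2 ^ i + p) / 10 = p / 10 + 2 ^ i by omega, show (10 * 2 ^ i + p) % 10 = p % 10 by omega]
  by_cases hx : p / 10 < 2 ^ k
  swap
  · have : ¬ (p / 10 < 2 ^ k) := hx
    rw [show (decide (p / 10 < 2 ^ k)) = false by simpa using this]
    simp only [Bool.false_and, Bool.and_false, Bool.or_false]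
    by_cases hge : p ≥ 10 * 2 ^ i
    · rw [show (p - 10 * 2 ^ i) / 10 = p / 10 - 2 ^ i by omega]
      by_cases hlt : p / 10 - 2 ^ i < 2 ^ k
      · -- the source has bit i set
        have hm : (p / 10 - 2 ^ i) &&& 2 ^ i ≠ 0 := by
          intro h0
          have h1 := ((bitfact i (by omega) _ (lt_of_lt_of_le hlt h64)).1 h0).1
          have h2 : (p / 10 - 2 ^ i) ^^^ 2 ^ i < 2 ^ k := Nat.xor_lt_two_pow hlt hik
          omega
        simp [hm]
      · simp [hlt]
    · simp [hge]
  · have hx64 : p / 10 < 64 := by omega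
    simp only [hx, decide_true, Bool.true_and]
    by_cases h0 : (p / 10) &&& 2 ^ i = 0
    · obtain ⟨h1, h2⟩ := (bitfact i (by omega) _ hx64).1 h0
      have h3 : (p / 10) ^^^ 2 ^ i < 2 ^ k := Nat.xor_lt_two_pow hx hik
      rw [h1] at h3 ⊢
      simp only [h0, h3, decide_true, Bool.true_and, Bool.and_true]
      by_cases hge : p ≥ 10 * 2 ^ i
      · rw [show (p - 10 * 2 ^ i) / 10 = p / 10 - 2 ^ i by omega]
        have := h2 (by omega)
        simp [this]
      · simp [hge]
    · obtain ⟨h1, h2, h3⟩ := (bitfact i (by omega) _ hx64).2 h0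
      rw [h2]
      have hge : p ≥ 10 * 2 ^ i := by omega
      rw [show (p - 10 * 2 ^ i) / 10 = p / 10 - 2 ^ i by omega, show (p - 10 * 2 ^ i) % 10 = p % 10 by omega]
      have h4 : p / 10 - 2 ^ i < 2 ^ k := by omega
      simp [h0, hge, h3, h4]
theorem withQs_eq (k : ℕ) (l : List ℕ) (K : List (ℕ × ℕ) → Bool) : withQs k l K = K (l.map (qOf k)) := by
  induction l generalizing K with
  | nil => rfl
  | cons i l ih =>
    rw [List.map_cons]
    refine (ih (fun t => K (_ :: t))).trans ?_
    unfold qOf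
    rw [upto_eq]
    rfl
theorem dtree_ok (N nd sh k : ℕ) (f : ℕ → ℕ) (hk : k ≤ 6) (hf : ∀ x, f x < 1024)
    (hleaf : ∀ t < 2 ^ k, dg nd (10 * t) ≤ dg (N * packF (fun x => f (x ^^^ t)) (List.range (2 ^ k))) sh) :
    ∀ (j t : ℕ), j ≤ k → t % 2 ^ (k - j) = t → 
    dtree N nd sh (((List.range k).drop (k - j)).map (qOf k)) (packF (fun x => f (x ^^^ t)) (List.range (2 ^ k))) (10 * t) = false := by
  intro j
  induction j with
  | zero =>
    intro t _ ht
    rw [Nat.sub_zero] at ht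
    have : (List.range k).drop (k - 0) = [] := by simp
    rw [this]
    show Nat.blt (dg _ _) (dg nd (10 * t)) = false
    rw [← Bool.not_eq_true, Nat.blt_eq, not_lt]
    exact hleaf t (by rw [← ht]; exact Nat.mod_lt _ (by positivity))
  | succ j ih =>
    intro t hj ht
    have e : (List.range k).drop (k - (j + 1)) = (k - (j + 1)) :: (List.range k).drop (k - j) := by
      rw [List.drop_eq_getElem_cons (by simp; omega)]
      simp only [List.getElem_range]
      rw [show k - (j + 1) + 1 = k - j by omega]
    set i := k - (j + 1) with hi
    have hkj : k - j = i + 1 := by omega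
    rw [e, List.map_cons]
    have ht' : t < 2 ^ i := by rw [← ht]; exact Nat.mod_lt _ (by positivity)
    have h1 := ih t (by omega) (by rw [hkj]; exact Nat.mod_eq_of_lt (by rw [pow_succ]; omega))
    have hxor : t ^^^ 2 ^ i = t + 2 ^ i := by
      have hb := (bitfact i (by omega) t (lt_of_lt_of_le ht' ((Nat.pow_le_pow_right (by norm_num) (show i ≤ 6 by omega)).trans (by norm_num)))).2
      by_contra hne
      have hc := fun h => hne ((bitfact i (by omega) t (lt_of_lt_of_le ht' ((Nat.pow_le_pow_right (by norm_num) (show i ≤ 6 by omega)).trans (by norm_num)))).1 h).1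
      have := (hb hc).1
      omega
    have h2 := ih (t + 2 ^ i) (by omega) (by rw [hkj]; exact Nat.mod_eq_of_lt (by rw [pow_succ]; omega))
    refine Eq.trans (b := bor (dtree N nd sh (((List.range k).drop (k - j)).map (qOf k)) (packF (fun x => f (x ^^^ t)) (List.range (2 ^ k))) (10 * t))
      (dtree N nd sh (((List.range k).drop (k - j)).map (qOf k)) (swp (qOf k i) (packF (fun x => f (x ^^^ t)) (List.range (2 ^ k)))) (10 * t + (qOf k i).1))) rfl ?_
    rw [h1, swp_ok (fun x => f (x ^^^ t)) k i hk (by omega) (fun x => hf _)]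
    have e3 : 10 * t + (qOf k i).1 = 10 * (t + 2 ^ i) := by unfold qOf; simp only; ring
    have e4 : (fun x => f (x ^^^ 2 ^ i ^^^ t)) = (fun x => f (x ^^^ (t + 2 ^ i))) := by
      funext x; rw [← hxor, Nat.xor_assoc, Nat.xor_comm (2 ^ i)]
    rw [e3, e4, h2]; rfl
variable {A : List ℕ} {w M s : ℕ} {B : Finset ℕ}
theorem aord_eq (A : List ℕ) (m d : ℕ) : aord A m d = (A.map (fun a => mult A m ((a % m) ^^^ d))).sum := by
  have : ∀ L : List ℕ, List.rec (motive := fun _ => ℕ) 0 (fun a _ ih => Nat.add (mult A m (Nat.xor (Nat.mod a m) d)) ih) L = (L.map (fun a => mult A m ((a % m) ^^^ d))).sum := by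
    intro L
    induction L with
    | nil => rfl
    | cons a L ih => rw [List.map_cons, List.sum_cons, ← ih]; rfl
  exact this A
theorem pairs_card (S : Finset ℕ) (k d : ℕ) :
    ((S ×ˢ S).filter (fun p => (p.1 ^^^ p.2) % 2 ^ k = d)).card ≤ ∑ v ∈ S, cnt S (2 ^ k) ((v % 2 ^ k) ^^^ d) := by
  rw [Finset.card_filter, Finset.sum_product]
  refine Finset.sum_le_sum (fun v _ => ?_)
  rw [cnt, Finset.card_filter]
  refine Finset.sum_le_sum (fun v' _ => ?_)
  by_cases h : (v ^^^ v') % 2 ^ k = d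
  · rw [if_pos h, if_pos]
    rw [← h, Nat.xor_mod_two_pow, ← Nat.xor_assoc, Nat.xor_self, Nat.zero_xor]
  · rw [if_neg h]; exact Nat.zero_le _
theorem diff_count (h : VB A w M s B) (hnd : A.Nodup) (k d : ℕ) (hk : k ≤ 6) (hd : d < 2 ^ k) :
    need A k d ≤ ∑ x ∈ Finset.range (2 ^ k), cnt B (2 ^ k) x * cnt B (2 ^ k) (x ^^^ d) := by
  rcases Nat.eq_zero_or_pos d with rfl | hd0
  · exact Nat.zero_le _
  obtain ⟨e, rfl⟩ := Nat.exists_eq_succ_of_ne_zero hd0.ne'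
  show 2 ^ (7 - k) - aord A (2 ^ k) (e + 1) ≤ _
  set d := e + 1 with hde
  rw [tsub_le_iff_left]
  set D := (Finset.range 64).filter (fun u => u % 2 ^ k = d) with hD
  have h1 : 2 ^ (6 - k) ≤ D.card := residues k hk d hd
  have hA : ((A.toFinset ×ˢ A.toFinset).filter (fun p => (p.1 ^^^ p.2) % 2 ^ k = d)).card ≤ aord A (2 ^ k) d := by
    refine (pairs_card _ _ _).trans (le_of_eq ?_)
    rw [aord_eq, ← List.sum_toFinset _ hnd]
    refine Finset.sum_congr rfl (fun a _ => ?_)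
    rw [mult_eq, cnt, ← List.toFinset_card_of_nodup (hnd.filter _), List.toFinset_filter]
    simp
  have hB : ((B ×ˢ B).filter (fun p => (p.1 ^^^ p.2) % 2 ^ k = d)).card ≤ ∑ x ∈ Finset.range (2 ^ k), cnt B (2 ^ k) x * cnt B (2 ^ k) (x ^^^ d) := by
    refine (pairs_card _ _ _).trans (le_of_eq ?_)
    exact (sum_cnt B (2 ^ k) (by positivity) (fun x => cnt B (2 ^ k) (x ^^^ d))).symm
  refine le_trans ?_ (Nat.add_le_add hA hB)
  have key : ∀ S : Finset ℕ, ((S ×ˢ S).filter (fun p => (p.1 ^^^ p.2) % 2 ^ k = d)).card ≥ ∑ u ∈ D, ((S ×ˢ S).filter (fun p => p.1 ^^^ p.2 = u)).card := by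
    intro S
    rw [← Finset.card_biUnion]
    · apply Finset.card_le_card
      intro p hp
      obtain ⟨u, hu, hp⟩ := Finset.mem_biUnion.1 hp
      rw [Finset.mem_filter] at hp ⊢
      rw [hD, Finset.mem_filter] at hu
      exact ⟨hp.1, by rw [hp.2]; exact hu.2⟩
    · intro u _ u' _ hne
      refine Finset.disjoint_left.2 ?_
      intro p hp hp'
      rw [Finset.mem_filter] at hp hp'
      exact hne (hp.2.symm.trans hp'.2)
  refine le_trans ?_ (Nat.add_le_add (key A.toFinset) (key B))
  rw [← Finset.sum_add_distrib]
  have two : ∀ (S : Finset ℕ) (u : ℕ), u ≠ 0 → (∃ a ∈ S, ∃ a' ∈ S, a ^^^ a' = u) → 2 ≤ ((S ×ˢ S).filter (fun p => p.1 ^^^ p.2 = u)).card := by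
    rintro S u hu ⟨a, ha, a', ha', e⟩
    have hne : (a, a') ≠ (a', a) := by
      intro h
      rw [Prod.mk.injEq] at h
      rw [h.1, Nat.xor_self] at e
      exact hu e.symm
    rw [← Finset.card_pair hne]
    apply Finset.card_le_card
    intro p hp
    rw [Finset.mem_insert, Finset.mem_singleton] at hp
    rw [Finset.mem_filter, Finset.mem_product]
    rcases hp with rfl | rfl
    · exact ⟨⟨ha, ha'⟩, e⟩
    · exact ⟨⟨ha', ha⟩, by rw [← e]; exact Nat.xor_comm _ _⟩
  have : ∑ _u ∈ D, 2 ≤ ∑ u ∈ D, (((A.toFinset ×ˢ A.toFinset).filter (fun p => p.1 ^^^ p.2 = u)).card + ((B ×ˢ B).filter (fun p => p.1 ^^^ p.2 = u)).card) := by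
    refine Finset.sum_le_sum (fun u hu => ?_)
    rw [hD, Finset.mem_filter, Finset.mem_range] at hu
    have hu0 : u ≠ 0 := by rintro rfl; rw [Nat.zero_mod] at hu; omega
    rcases h.dif u hu.1 hu0 with ⟨a, ha, a', ha', e⟩ | hh
    · have := two A.toFinset u hu0 ⟨a, List.mem_toFinset.2 ha, a', List.mem_toFinset.2 ha', e⟩; omega
    · have := two B u hu0 hh; omega
  refine le_trans ?_ this
  rw [Finset.sum_const, smul_eq_mul, show 7 - k = (6 - k) + 1 by omega, pow_succ]
  omega
theorem compl_xor : ∀ k ≤ 6, ∀ x < 2 ^ k, 2 ^ k - 1 - x = x ^^^ (2 ^ k - 1) := by decide +kernel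
theorem need_le (A : List ℕ) (k d : ℕ) (hk : k ≤ 6) : need A k d < 1024 := by
  cases d with
  | zero => exact Nat.zero_lt_of_lt (show 0 < 1024 by norm_num)
  | succ e =>
    show 2 ^ (7 - k) - aord A (2 ^ k) (e + 1) < 1024
    have : 2 ^ (7 - k) ≤ 2 ^ 7 := Nat.pow_le_pow_right (by norm_num) (by omega)
    omega
theorem leaf_ok (h : VB A w M s B) (hnd : A.Nodup) (k : ℕ) (hk : k ≤ 6) (t : ℕ) (ht : t < 2 ^ k) :
    dg (packF (fun t => need A k (t ^^^ (2 ^ k - 1))) (List.range (2 ^ k))) (10 * t) ≤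
    dg (pk B k * packF (fun x => cnt B (2 ^ k) (x ^^^ t)) (List.range (2 ^ k))) (10 * (2 ^ k - 1)) := by
  have hp : 0 < 2 ^ k := by positivity
  have h1 := dg_packF (fun t => need A k (t ^^^ (2 ^ k - 1))) (2 ^ k) (fun x _ => need_le _ _ _ hk) 0 t ht
  rw [mul_zero, add_zero] at h1
  rw [dg_eq, dg_eq, h1]
  have hsum : ∑ x ∈ Finset.range (2 ^ k), cnt B (2 ^ k) x = M := by
    have := sum_cnt B (2 ^ k) hp (fun _ => 1)
    simp only [mul_one, Finset.sum_const, smul_eq_mul] at this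
    rw [this, h.card]
  have hsum2 : ∑ x ∈ Finset.range (2 ^ k), cnt B (2 ^ k) (x ^^^ t) = M := by
    rw [← hsum]
    refine Finset.sum_nbij' (fun x => x ^^^ t) (fun x => x ^^^ t) ?_ ?_ ?_ ?_ ?_
    · intro x hx; exact Finset.mem_range.2 (Nat.xor_lt_two_pow (Finset.mem_range.1 hx) ht)
    · intro x hx; exact Finset.mem_range.2 (Nat.xor_lt_two_pow (Finset.mem_range.1 hx) ht)
    · intro x _; simp [Nat.xor_assoc]
    · intro x _; simp [Nat.xor_assoc]
    · intro x _; rfl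
  have hM := h.hM
  rw [pk, prod_coef _ _ _ _ (by omega) (by rw [hsum, hsum2]; nlinarith)]
  refine (diff_count h hnd k (t ^^^ (2 ^ k - 1)) hk (Nat.xor_lt_two_pow ht (by omega))).trans (le_of_eq ?_)
  refine Finset.sum_congr rfl (fun x hx => ?_)
  have hx' := Finset.mem_range.1 hx
  rw [Finset.sum_eq_single (2 ^ k - 1 - x)]
  · rw [if_pos (by omega), compl_xor k hk x hx', Nat.xor_assoc, Nat.xor_comm t]
  · intro y _ hy; rw [if_neg (by omega)]
  · intro hy; exact absurd (Finset.mem_range.2 (by omega)) hy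
/-! ### assembling -/
theorem mkOffs_eq (cl : ℕ) (g : Gam) (l : List ℕ) (K : List ℕ → Bool) :
    mkOffs cl g l K = K (l.map (fun x => 10 * ((app g.1 x ^^^ g.2.2) % 2 ^ cl))) := by
  induction l generalizing K with
  | nil => rfl
  | cons i l ih => exact (ih (fun t => K (_ :: t)))
def offs (cl : ℕ) (g : Gam) : List ℕ := (List.range (2 ^ cl)).map (fun x => 10 * ((app g.1 x ^^^ g.2.2) % 2 ^ cl))
theorem withGs_eq (cl : ℕ) (G : List Gam) (K : List (List ℕ) → Bool) : withGs cl G K = K (G.map (offs cl)) := by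
  induction G generalizing K with
  | nil => rfl
  | cons g G ih =>
    refine (mkOffs_eq cl g (upto (2 ^ cl)) _).trans ?_
    have e : (upto (2 ^ cl)).map (fun x => 10 * ((app g.1 x ^^^ g.2.2) % 2 ^ cl)) = offs cl g := by rw [upto_eq]; rfl
    rw [e]
    exact ih (fun t => K (offs cl g :: t))
theorem lowQ_sh (Q N : ℕ) : Nat.shiftRight (lowQ Q N) 64 = N := by
  show (Q % 0x10000000000000000 + 0x10000000000000000 * N) >>> 64 = N
  rw [Nat.shiftRight_eq_div_pow, Nat.add_mul_div_left _ _ (by norm_num), Nat.div_eq_of_lt (Nat.mod_lt _ (by norm_num)), zero_add]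
theorem dtreeQ_eq (N nd sh : ℕ) (l : List (ℕ × ℕ)) : ∀ Q t, dtreeQ N nd sh l Q t = dtree N nd sh l (Nat.shiftRight Q 64) t := by
  induction l with
  | nil => intro Q t; rfl
  | cons q l ih =>
    intro Q t
    show bor (dtreeQ N nd sh l Q t) (force (lowQ Q (swp q (Nat.shiftRight Q 64))) (fun N'' => dtreeQ N nd sh l N'' (Nat.add t q.1)))
      = bor (dtree N nd sh l _ t) (force (swp q (Nat.shiftRight Q 64)) (fun N'' => dtree N nd sh l N'' (Nat.add t q.1)))
    rw [force_eq, force_eq, ih, ih, lowQ_sh]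
theorem chk_ok (h : VB A w M s B) (hnd : A.Nodup) (cl : ℕ) (gs : List (List ℕ))
    (hlex : ∀ l ∈ gs, lexgt (pk B cl) l 0 = false) (k : ℕ) (hk : k < 6) : ChkOK A M s cl (k + 1) gs B := by
  have hany : (Bool.rec false (anyL (fun l => lexgt (pk B (k + 1)) l 0) gs) (Nat.beq (k + 1) cl) : Bool) = false := by
    by_cases e : k + 1 = cl
    · rw [show Nat.beq (k + 1) cl = true from Nat.beq_eq ▸ e]
      show anyL _ _ = false
      rw [anyL_eq, List.any_eq_false]
      intro l hl
      rw [e, hlex l hl]; simp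
    · rw [show Nat.beq (k + 1) cl = false by rw [← Bool.not_eq_true, Nat.beq_eq]; exact e]
  unfold ChkOK withChk
  by_cases h4 : 4 < k + 1
  · rw [show Nat.blt 4 (k + 1) = true from by rw [Nat.blt_eq]; exact h4]
    refine ⟨fun P => force (lowQ P (Nat.sub (packF (fun _ => cpOf M (k + 1)) (upto (2 ^ (k + 1)))) (Nat.mod (Nat.shiftRight P 64) (2 ^ (10 * 2 ^ (k + 1)))))) (fun Q =>
      bor (colp s (k + 1) (Nat.shiftRight Q 64)) (bor (Bool.rec false (anyL (fun l => lexgt (Nat.shiftRight Q 64) l 0) gs) (Nat.beq (k + 1) cl))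
       (dtreeQ (Nat.shiftRight Q 64) (packF (fun t => need A (k + 1) (Nat.xor t (2 ^ (k + 1) - 1))) (upto (2 ^ (k + 1)))) (10 * (2 ^ (k + 1) - 1)) ((upto (k + 1)).map (qOf (k + 1))) Q 0))), fun K => ?_, ?_⟩
    · exact withQs_eq (k + 1) (upto (k + 1)) _
    · intro P hP
      have e := St_N h (show k + 1 ≤ 6 by omega) hP
      simp only [force_eq, dtreeQ_eq, lowQ_sh]
      rw [show Nat.sub (packF (fun _ => cpOf M (k + 1)) (upto (2 ^ (k + 1)))) (Nat.mod (Nat.shiftRight P 64) (2 ^ (10 * 2 ^ (k + 1)))) = pk B (k + 1) from e, bor_eq, bor_eq, colp_ok h k hk, hany]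
      have := dtree_ok (pk B (k + 1)) (packF (fun t => need A (k + 1) (t ^^^ (2 ^ (k + 1) - 1))) (List.range (2 ^ (k + 1)))) (10 * (2 ^ (k + 1) - 1)) (k + 1)
        (cnt B (2 ^ (k + 1))) (by omega) (pk_bound h (k + 1)) (leaf_ok h hnd (k + 1) (by omega)) (k + 1) 0 le_rfl (by simp)
      rw [Nat.sub_self, List.drop_zero] at this
      simp only [Nat.xor_zero, mul_zero] at this
      rw [upto_eq, upto_eq, Bool.false_or, Bool.false_or]
      exact this
  · rw [show Nat.blt 4 (k + 1) = false from by rw [← Bool.not_eq_true, Nat.blt_eq]; exact h4]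
    refine ⟨_, fun K => rfl, ?_⟩
    intro P hP
    have e := St_N h (show k + 1 ≤ 6 by omega) hP
    simp only [force_eq, lowQ_sh]
    rw [show Nat.sub (packF (fun _ => cpOf M (k + 1)) (upto (2 ^ (k + 1)))) (Nat.mod (Nat.shiftRight P 64) (2 ^ (10 * 2 ^ (k + 1)))) = pk B (k + 1) from e, bor_eq, colp_ok h k hk, hany]
    rfl
theorem run_sound (cl : ℕ) (G : List Gam) (lbs : List ℕ) (hr : run A w M s cl G lbs = true) (hnd : A.Nodup) (hl : lbs.length = 6)
    (h : VB A w M s B) (hlb : ∀ i (hi : i < lbs.length), lbs[i] ≤ hc B (2 ^ i) 0)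
    (hlex : ∀ g ∈ G, lexgt (pk B cl) (offs cl g) 0 = false) : False := by
  obtain ⟨Ls, h1, h2⟩ := levs_sound h cl (G.map (offs cl)) (chk_ok h hnd cl _ (by
    intro l hl
    obtain ⟨g, hg, rfl⟩ := List.mem_map.1 hl
    exact hlex g hg)) lbs 0 (by omega) (by simpa using hlb)
  unfold run at hr
  rw [withGs_eq, h1, h2 _ (St_init h)] at hr
  cases hr
/-! ### pairs of finite sets in `E` -/
structure GP (w : ℕ) (A B : Finset E) : Prop where
  cov : ∀ u, ∃ a ∈ A, ∃ b ∈ B, a + b = u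
  dif : ∀ d, d ≠ 0 → (∃ a ∈ A, ∃ a' ∈ A, a + a' = d) ∨ ∃ b ∈ B, ∃ b' ∈ B, b + b' = d
  half : ∀ f : E →ₗ[ZMod 2] ZMod 2, f ≠ 0 → ∀ i j, w ≤ (A.filter (fun v => f v = i)).card + (B.filter (fun v => f v = j)).card
def aff (L : E ≃ₗ[ZMod 2] E) (a : E) (x : E) : E := L x + a
theorem aff_inj (L : E ≃ₗ[ZMod 2] E) (a : E) : Function.Injective (aff L a) := fun _ _ h => L.injective (add_right_cancel h)
theorem aff_filter (L : E ≃ₗ[ZMod 2] E) (a : E) (A : Finset E) (f : E →ₗ[ZMod 2] ZMod 2) (i : ZMod 2) :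
    ((A.image (aff L a)).filter (fun v => f v = i)).card = (A.filter (fun v => (f ∘ₗ L.toLinearMap) v = i - f a)).card := by
  rw [Finset.filter_image, Finset.card_image_of_injective _ (aff_inj L a)]
  congr 1; ext v
  simp only [Finset.mem_filter, aff, map_add, eq_sub_iff_add_eq]; rfl
theorem GP.map {w : ℕ} {A B : Finset E} (h : GP w A B) (L : E ≃ₗ[ZMod 2] E) (a b : E) :
    GP w (A.image (aff L a)) (B.image (aff L b)) := by
  refine ⟨fun u => ?_, fun d hd => ?_, fun f hf i j => ?_⟩
  · obtain ⟨x, hx, y, hy, e⟩ := h.cov (L.symm (u + a + b))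
    refine ⟨_, Finset.mem_image_of_mem _ hx, _, Finset.mem_image_of_mem _ hy, ?_⟩
    have : L x + L y = u + a + b := by rw [← map_add, e]; simp
    calc L x + a + (L y + b) = (L x + L y) + a + b := by abel
      _ = u + (a + a) + (b + b) := by rw [this]; abel
      _ = u := by rw [add_self2, add_self2]; simp
  · have hd' : L.symm d ≠ 0 := by simpa using hd
    have key : ∀ c x y : E, x + y = L.symm d → aff L c x + aff L c y = d := by
      intro c x y e
      calc L x + c + (L y + c) = L (x + y) + (c + c) := by rw [map_add]; abel
        _ = d := by rw [e, add_self2]; simp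
    rcases h.dif _ hd' with ⟨x, hx, y, hy, e⟩ | ⟨x, hx, y, hy, e⟩
    · exact Or.inl ⟨_, Finset.mem_image_of_mem _ hx, _, Finset.mem_image_of_mem _ hy, key _ _ _ e⟩
    · exact Or.inr ⟨_, Finset.mem_image_of_mem _ hx, _, Finset.mem_image_of_mem _ hy, key _ _ _ e⟩
  · rw [aff_filter, aff_filter]
    refine h.half _ ?_ _ _
    intro h0
    apply hf
    refine LinearMap.ext (fun v => ?_)
    have := LinearMap.congr_fun h0 (L.symm v)
    simpa using this
theorem aff_sum (L : E ≃ₗ[ZMod 2] E) (a : E) (B : Finset E) : ∑ v ∈ B.image (aff L a), v = L (∑ v ∈ B, v) + B.card • a := by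
  rw [Finset.sum_image (fun x _ y _ h => aff_inj L a h)]
  simp [aff, Finset.sum_add_distrib]
def dl (Al : List ℕ) : Finset E := (Al.map (dec 6)).toFinset
theorem cd_bij {u v : E} : cd u = cd v ↔ u = v := ⟨fun h => cd_inj h, fun h => by rw [h]⟩
theorem ind_fn (g i : ℕ) (hi : i < 2) (v : E) : ind g i (cd v) = if fn g v = (i : ZMod 2) then 1 else 0 := by
  unfold ind
  rw [eqb_eq, fn_apply]
  have : ((par (g &&& cd v) : ℕ) : ZMod 2) = i ↔ par (g &&& cd v) = i := by
    rw [ZMod.natCast_eq_natCast_iff', Nat.mod_eq_of_lt (par_lt _), Nat.mod_eq_of_lt hi]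
  by_cases h : par (g &&& cd v) = i
  · rw [if_pos (this.2 h)]; exact if_pos h
  · rw [if_neg (fun h' => h (this.1 h'))]; exact if_neg h
theorem hc_fn (B : Finset E) (g i : ℕ) (hi : i < 2) : hc (B.image cd) g i = (B.filter (fun v => fn g v = (i : ZMod 2))).card := by
  unfold hc
  rw [Finset.sum_image (fun x _ y _ h => cd_inj h), Finset.card_filter]
  exact Finset.sum_congr rfl (fun v _ => ind_fn g i hi v)
theorem cntA_fn (Al : List ℕ) (hlt : ∀ a ∈ Al, a < 64) (g i : ℕ) (hi : i < 2) : ((dl Al).filter (fun v => fn g v = (i : ZMod 2))).card ≤ cntA Al g i := by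
  induction Al with
  | nil => exact Nat.zero_le _
  | cons a Al ih =>
    have e : cntA (a :: Al) g i = ind g i a + cntA Al g i := rfl
    have e2 : dl (a :: Al) = insert (dec 6 a) (dl Al) := by simp [dl]
    have ih := ih (fun x hx => hlt x (List.mem_cons_of_mem _ hx))
    have h1 := ind_fn g i hi (dec 6 a)
    rw [cd_dec (by exact hlt a (by simp))] at h1
    rw [e, e2, h1, Finset.filter_insert]
    split_ifs
    · exact (Finset.card_insert_le _ _).trans (by omega)
    · omega
theorem GP.toVB {w M s : ℕ} {Al : List ℕ} {B : Finset E} (h : GP w (dl Al) B) (hl : Al.length ≤ 16) (hlt : ∀ a ∈ Al, a < 64)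
    (hB : B.card = M) (hM : M ≤ 31) (hs : s < 64 → ∑ v ∈ B, v = dec 6 s) : VB Al w M s (B.image cd) := by
  have memA : ∀ {a : E}, a ∈ dl Al → cd a ∈ Al := by
    intro a ha
    obtain ⟨x, hx, rfl⟩ := List.mem_map.1 (List.mem_toFinset.1 ha)
    rw [cd_dec (by exact hlt x hx)]; exact hx
  refine ⟨?_, ?_, hM, hl, ?_, ?_, ?_, ?_⟩
  · intro v hv; obtain ⟨x, _, rfl⟩ := Finset.mem_image.1 hv; exact cd6 x
  · rw [Finset.card_image_of_injective _ (fun x y h => cd_inj h), hB]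
  · intro u hu
    obtain ⟨a, ha, b, hb, e⟩ := h.cov (dec 6 u)
    refine ⟨_, memA ha, _, Finset.mem_image_of_mem _ hb, ?_⟩
    rw [← cd_add, e, cd_dec (by exact hu)]
  · intro d hd hd0
    have hd' : dec 6 d ≠ 0 := by
      intro e; apply hd0; rw [← cd_dec (n := 6) (x := d) (by exact hd), e, cd_zero]
    rcases h.dif _ hd' with ⟨a, ha, b, hb, e⟩ | ⟨a, ha, b, hb, e⟩
    · exact Or.inl ⟨_, memA ha, _, memA hb, by rw [← cd_add, e, cd_dec (by exact hd)]⟩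
    · exact Or.inr ⟨_, Finset.mem_image_of_mem _ ha, _, Finset.mem_image_of_mem _ hb, by rw [← cd_add, e, cd_dec (by exact hd)]⟩
  · intro g hg hg0 i hi j hj
    rw [hc_fn B g i hi]
    exact (h.half (fn g) (fn_ne hg hg0) j i).trans (Nat.add_le_add_right (cntA_fn Al hlt g j hj) _)
  · intro hs' g hg
    have e : ((hc (B.image cd) g 1 : ℕ) : ZMod 2) = fn g (∑ v ∈ B, v) := by
      unfold hc
      rw [Finset.sum_image (fun x _ y _ h => cd_inj h), Nat.cast_sum, map_sum]
      refine Finset.sum_congr rfl (fun v _ => ?_)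
      rw [ind_fn g 1 (by norm_num)]
      rcases zmod2 (fn g v) with h | h <;> simp [h]
    rw [hs hs', fn_apply, cd_dec (by exact hs'), ZMod.natCast_eq_natCast_iff'] at e
    rw [e, Nat.mod_eq_of_lt (par_lt _)]
/-! ### canonical choice -/
def gOK (Al : List ℕ) (M s cl : ℕ) (g : Gam) : Bool :=
  invOK 6 g.1 g.2.1 && Nat.blt g.2.2 64 &&
  (List.range (2 ^ (6 - cl))).all (fun h => Nat.beq (app g.1 (2 ^ cl * h) % 2 ^ cl) 0 && Nat.beq (app g.2.1 (2 ^ cl * h) % 2 ^ cl) 0) &&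
  Al.any (fun a => Al.all (fun x => Al.any (fun y => Nat.beq (app g.2.1 x ^^^ a) y))) &&
  (Nat.ble 64 s || Nat.beq (app g.2.1 s ^^^ (M % 2 * app g.2.1 g.2.2)) s)
theorem split_xor : ∀ cl ≤ 6, ∀ v < 64, v = (v % 2 ^ cl) ^^^ (2 ^ cl * (v / 2 ^ cl)) ∧ v / 2 ^ cl < 2 ^ (6 - cl) := by decide +kernel
theorem app_mod {cs : List ℕ} {cl : ℕ} (hcl : cl ≤ 6) (h : ∀ h < 2 ^ (6 - cl), app cs (2 ^ cl * h) % 2 ^ cl = 0) (v : ℕ) (hv : v < 64) :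
    app cs v % 2 ^ cl = app cs (v % 2 ^ cl) % 2 ^ cl := by
  obtain ⟨h1, h2⟩ := split_xor cl hcl v hv
  conv_lhs => rw [h1, app_xor, Nat.xor_mod_two_pow, h _ h2, Nat.xor_zero]
noncomputable def pull (g : Gam) (h : invOK 6 g.1 g.2.1 = true) (B : Finset E) : Finset E :=
  B.image (aff (linE 6 g.1 g.2.1 h).symm ((linE 6 g.1 g.2.1 h).symm (dec 6 g.2.2)))
def keyL (B : Finset E) (cl : ℕ) : List ℕ := (List.range (2 ^ cl)).map (cnt (B.image cd) (2 ^ cl))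
/-- the sets under consideration -/
def Cl (Al : List ℕ) (w M s : ℕ) (B : Finset E) : Prop := GP w (dl Al) B ∧ B.card = M ∧ (s < 64 → ∑ v ∈ B, v = dec 6 s)
theorem smul2 (M : ℕ) (a : E) : M • a = dec 6 (M % 2 * cd a) := by
  conv_lhs => rw [← Nat.div_add_mod M 2]
  rw [add_smul, mul_comm, mul_smul, two_smul, add_self2, smul_zero, zero_add]
  rcases Nat.mod_two_eq_zero_or_one M with h | h
  · rw [h, zero_smul, zero_mul, dec_zero]
  · rw [h, one_smul, one_mul, dec_cd]
theorem Cl_pull {Al : List ℕ} {w M s cl : ℕ} {g : Gam} (hcl : cl ≤ 6) (hg : gOK Al M s cl g = true) (hlt : ∀ a ∈ Al, a < 64) {B : Finset E}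
    (hB : Cl Al w M s B) : ∃ B', Cl Al w M s B' ∧ keyL B' cl = (List.range (2 ^ cl)).map (fun x => cnt (B.image cd) (2 ^ cl) ((app g.1 x ^^^ g.2.2) % 2 ^ cl)) := by
  unfold gOK at hg
  simp only [Bool.and_eq_true, List.all_eq_true, List.any_eq_true, List.mem_range, Bool.or_eq_true] at hg
  obtain ⟨⟨⟨⟨hi, ht⟩, hm⟩, a, ha, hA⟩, hs⟩ := hg
  have ht : g.2.2 < 64 := blt_lt ht
  set L := linE 6 g.1 g.2.1 hi with hL
  have c1 : ∀ v, cd (L v) = app g.1 (cd v) := cd_linE hi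
  have c2 : ∀ v, cd (L.symm v) = app g.2.1 (cd v) := cd_linE_symm hi
  have ht2 : cd (dec 6 g.2.2) = g.2.2 := cd_dec (by exact ht)
  obtain ⟨h1, h2, h3⟩ := hB
  refine ⟨pull g hi B, ⟨?_, ?_, ?_⟩, ?_⟩
  · have e : (dl Al).image (aff L.symm (dec 6 a)) = dl Al := by
      apply Finset.eq_of_subset_of_card_le
      · intro v hv
        obtain ⟨x, hx, rfl⟩ := Finset.mem_image.1 hv
        obtain ⟨x, hx', rfl⟩ := List.mem_map.1 (List.mem_toFinset.1 hx)
        obtain ⟨y, hy, e⟩ := hA x hx'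
        refine List.mem_toFinset.2 (List.mem_map.2 ⟨y, hy, ?_⟩)
        rw [← Nat.eq_of_beq_eq_true e, dec_xor, aff]
        congr 1
        apply cd_inj
        rw [c2, cd_dec (app_lt (invOK_lt hi).2 x), cd_dec (by exact hlt x hx')]
      · rw [Finset.card_image_of_injective _ (aff_inj _ _)]
    have := h1.map L.symm (dec 6 a) (L.symm (dec 6 g.2.2))
    rw [e] at this
    exact this
  · rw [pull, Finset.card_image_of_injective _ (aff_inj _ _), h2]
  · intro hs'
    have hs := hs.resolve_left (by rw [Nat.ble_eq]; omega)
    have hs := congrArg (dec 6) (Nat.eq_of_beq_eq_true hs)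
    rw [dec_xor] at hs
    rw [pull, aff_sum, h3 hs', h2, smul2, c2, ht2, ← hs]
    congr 1
    apply cd_inj
    rw [hs, c2, cd_dec (app_lt (invOK_lt hi).2 s), cd_dec (by exact hs')]
  · refine List.map_congr_left (fun x hx => ?_)
    have hx := List.mem_range.1 hx
    have h64 : (2 : ℕ) ^ cl ≤ 64 := (Nat.pow_le_pow_right (by norm_num) hcl).trans (by norm_num)
    have m1 := app_mod hcl (fun h hh => Nat.eq_of_beq_eq_true (hm h hh).1)
    have m2 := app_mod hcl (fun h hh => Nat.eq_of_beq_eq_true (hm h hh).2)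
    unfold cnt
    rw [pull, Finset.image_image, Finset.filter_image, Finset.filter_image, Finset.card_image_of_injective, Finset.card_image_of_injective]
    · congr 1
      refine Finset.filter_congr (fun u _ => ?_)
      have eu : cd (aff L.symm (L.symm (dec 6 g.2.2)) u) = app g.2.1 (cd u ^^^ g.2.2) := by
        rw [aff, ← map_add, c2, cd_add, ht2]
      show cd (aff L.symm (L.symm (dec 6 g.2.2)) u) % _ = _ ↔ _
      constructor
      · intro h
        have e2 : cd u = app g.1 (cd (aff L.symm (L.symm (dec 6 g.2.2)) u)) ^^^ g.2.2 := by
          rw [← c1, aff, ← map_add, L.apply_symm_apply, cd_add, ht2, Nat.xor_assoc, Nat.xor_self, Nat.xor_zero]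
        rw [e2, Nat.xor_mod_two_pow, m1 _ (cd6 _), h, ← Nat.xor_mod_two_pow]
      · intro h
        have hu : cd u ^^^ g.2.2 < 64 := by rw [← ht2, ← cd_add]; exact cd6 _
        rw [eu, m2 _ hu, Nat.xor_mod_two_pow, h, ← Nat.xor_mod_two_pow, Nat.xor_assoc, Nat.xor_self, Nat.xor_zero,
          ← m2 _ (app_lt (invOK_lt hi).1 x)]
        have : app g.2.1 (app g.1 x) = x := by
          have := congrArg cd (L.symm_apply_apply (dec 6 x))
          rwa [c2, c1, cd_dec (by exact lt_of_lt_of_le hx h64)] at this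
        rw [this, Nat.mod_eq_of_lt hx]
    · exact fun x y h => cd_inj h
    · intro x y h
      exact aff_inj _ _ (cd_inj h)
theorem lexgt_lt (N : ℕ) (f : ℕ → ℕ) (p : ℕ → ℕ) (m : ℕ) (hd : ∀ x < m, dg N (10 * x) = f x) (hp : ∀ x < m, p x < m) (n : ℕ) :
    ∀ j, j + n ≤ m → lexgt N ((List.range' j n).map (fun x => 10 * p x)) (10 * j) = true → (List.range' j n).map f < (List.range' j n).map (fun x => f (p x)) := by
  induction n with
  | zero => intro j _ h; cases h
  | succ n ih =>
    intro j hj h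
    rw [List.range'_succ, List.map_cons] at h ⊢
    rw [List.map_cons, List.cons_lt_cons_iff]
    have h : bor (Nat.blt (dg N (10 * j)) (dg N (10 * p j))) (Bool.rec false (lexgt N ((List.range' (j + 1) n).map (fun x => 10 * p x)) (10 * j + 10)) (Nat.beq (dg N (10 * j)) (dg N (10 * p j)))) = true := h
    rw [hd j (by omega), hd (p j) (hp j (by omega)), bor_eq, Bool.or_eq_true] at h
    rcases h with h | h
    · exact Or.inl (blt_lt h)
    · by_cases e : f j = f (p j)
      · refine Or.inr ⟨e, ih (j + 1) (by omega) ?_⟩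
        rw [show Nat.beq (f j) (f (p j)) = true from Nat.beq_eq ▸ e] at h
        exact h
      · rw [show Nat.beq (f j) (f (p j)) = false by rw [← Bool.not_eq_true, Nat.beq_eq]; exact e] at h
        cases h
def colz (cl : ℕ) (B : Finset E) : ℕ := ∑ k ∈ Finset.Ico cl 6, hc (B.image cd) (2 ^ k) 0
def lbsOf (cl M : ℕ) (maj : Bool) : List ℕ := (List.range 6).map (fun i => if maj = true ∧ cl ≤ i then (M + 1) / 2 else 0)
theorem trans_fact : ∀ cl ≤ 6, ∀ k < 6, cl ≤ k → ∀ v < 64, (v ^^^ 2 ^ k) % 2 ^ cl = v % 2 ^ cl := by decide +kernel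
theorem trans_fact2 : ∀ k < 6, ∀ j < 6, ∀ v < 64, ind (2 ^ j) 0 (v ^^^ 2 ^ k) = if j = k then ind (2 ^ j) 1 v else ind (2 ^ j) 0 v := by decide +kernel
theorem Cl_trans {Al : List ℕ} {w M s cl : ℕ} (hpar : 64 ≤ s ∨ M % 2 = 0) {B : Finset E} (hcl : cl ≤ 6) (k : ℕ) (hk : k < 6) (hk2 : cl ≤ k)
    (hB : Cl Al w M s B) : ∃ B', Cl Al w M s B' ∧ keyL B' cl = keyL B cl ∧ colz cl B' + hc (B.image cd) (2 ^ k) 0 = colz cl B + hc (B.image cd) (2 ^ k) 1 := by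
  obtain ⟨h1, h2, h3⟩ := hB
  have hpk : (2 : ℕ) ^ k < 2 ^ 6 := Nat.pow_lt_pow_right (by norm_num) hk
  have inj := aff_inj (LinearEquiv.refl (ZMod 2) E) (dec 6 (2 ^ k))
  have cda : ∀ v, cd (aff (LinearEquiv.refl (ZMod 2) E) (dec 6 (2 ^ k)) v) = cd v ^^^ 2 ^ k := by
    intro v; rw [aff, cd_add, cd_dec hpk]; rfl
  refine ⟨B.image (aff (LinearEquiv.refl _ _) (dec 6 (2 ^ k))), ⟨?_, ?_, ?_⟩, ?_, ?_⟩
  · have := h1.map (LinearEquiv.refl _ _) 0 (dec 6 (2 ^ k))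
    have e : (dl Al).image (aff (LinearEquiv.refl (ZMod 2) E) 0) = dl Al := by
      have : aff (LinearEquiv.refl (ZMod 2) E) 0 = id := by funext x; simp [aff]
      rw [this, Finset.image_id]
    rwa [e] at this
  · rw [Finset.card_image_of_injective _ inj, h2]
  · intro hs
    rw [aff_sum, smul2, h2, hpar.resolve_left (by omega), zero_mul, dec_zero, h3 hs]
    simp
  · refine List.map_congr_left (fun x hx => ?_)
    unfold cnt
    rw [Finset.image_image, Finset.filter_image, Finset.filter_image, Finset.card_image_of_injective, Finset.card_image_of_injective]
    · congr 1
      refine Finset.filter_congr (fun u _ => ?_)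
      rw [Function.comp, cda, trans_fact cl hcl k hk hk2 _ (cd6 u)]
    · exact fun x y h => cd_inj h
    · intro x y h
      exact inj (cd_inj h)
  · have e : ∀ j < 6, hc ((B.image (aff (LinearEquiv.refl _ _) (dec 6 (2 ^ k)))).image cd) (2 ^ j) 0 = if j = k then hc (B.image cd) (2 ^ j) 1 else hc (B.image cd) (2 ^ j) 0 := by
      intro j hj
      unfold hc
      rw [Finset.sum_image (fun x _ y _ h => cd_inj h), Finset.sum_image (fun x _ y _ h => inj h), Finset.sum_image (fun x _ y _ h => cd_inj h), Finset.sum_image (fun x _ y _ h => cd_inj h)]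
      rw [Finset.sum_congr rfl (fun v _ => by rw [cda v, trans_fact2 k hk j hj _ (cd6 v)])]
      split_ifs <;> rfl
    have mem : k ∈ Finset.Ico cl 6 := Finset.mem_Ico.2 ⟨hk2, hk⟩
    unfold colz
    rw [← Finset.add_sum_erase _ _ mem, ← Finset.add_sum_erase _ (fun k => hc (B.image cd) (2 ^ k) 0) mem, e k hk, if_pos rfl]
    rw [Finset.sum_congr rfl (fun j hj => by
      rw [e j (Finset.mem_Ico.1 (Finset.mem_of_mem_erase hj)).2, if_neg (Finset.ne_of_mem_erase hj)])]
    ring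
noncomputable def goodRun (Al : List ℕ) (w M s cl : ℕ) (G : List Gam) (maj : Bool) : Bool :=
  (Al.all (fun a => Nat.blt a 64) && decide Al.Nodup && Nat.ble Al.length 16 && Nat.ble M 31 && Nat.ble cl 6 && G.all (gOK Al M s cl) &&
   (Nat.ble 64 s || Nat.beq (M % 2) 0 || !maj)) && run Al w M s cl G (lbsOf cl M maj)
theorem engine (Al : List ℕ) (w M s cl : ℕ) (G : List Gam) (maj : Bool) (hr : goodRun Al w M s cl G maj = true) (B : Finset E)
    (h1 : GP w (dl Al) B) (h2 : B.card = M) (h3 : s < 64 → ∑ v ∈ B, v = dec 6 s) : False := by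
  unfold goodRun at hr
  simp only [Bool.and_eq_true, List.all_eq_true, Bool.or_eq_true, decide_eq_true_eq, Nat.ble_eq, Bool.not_eq_true'] at hr
  obtain ⟨⟨⟨⟨⟨⟨⟨a1, a2⟩, a3⟩, a4⟩, a5⟩, a6⟩, a7⟩, a8⟩ := hr
  have hlt : ∀ a ∈ Al, a < 64 := fun a ha => blt_lt (a1 a ha)
  classical
  obtain ⟨C, hC, hmax⟩ := Finset.exists_max_image (Finset.univ.filter (fun B : Finset E => Cl Al w M s B)) (fun B => toLex (keyL B cl, colz cl B))
    ⟨B, Finset.mem_filter.2 ⟨Finset.mem_univ _, h1, h2, h3⟩⟩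
  have hC := (Finset.mem_filter.1 hC).2
  have hmax : ∀ B', Cl Al w M s B' → toLex (keyL B' cl, colz cl B') ≤ toLex (keyL C cl, colz cl C) := fun B' h => hmax B' (Finset.mem_filter.2 ⟨Finset.mem_univ _, h⟩)
  have hV := hC.1.toVB a3 hlt hC.2.1 a4 hC.2.2
  refine run_sound cl G _ a8 a2 (by simp [lbsOf]) hV ?_ ?_
  · intro i hi
    have hi6 : i < 6 := by simpa [lbsOf] using hi
    have e : (lbsOf cl M maj)[i] = if maj = true ∧ cl ≤ i then (M + 1) / 2 else 0 := by simp [lbsOf]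
    refine le_trans (le_of_eq e) ?_
    split_ifs with hm
    · obtain ⟨B', c1, c2, c3⟩ := Cl_trans (by
        rcases a7 with (h | h) | h
        · exact Or.inl h
        · exact Or.inr (Nat.eq_of_beq_eq_true h)
        · rw [hm.1] at h; cases h) a5 i hi6 hm.2 hC
      have := hmax B' c1
      rw [c2, Prod.Lex.toLex_le_toLex] at this
      have h4 := hc_add (C.image cd) (2 ^ i)
      rw [hV.card] at h4
      rcases this with h | h
      · exact absurd h (lt_irrefl _)
      · have := h.2
        simp only at this
        omega
    · exact Nat.zero_le _
  · intro g hg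
    obtain ⟨B', c1, c2⟩ := Cl_pull a5 (a6 g hg) hlt hC
    by_contra hne
    rw [Bool.not_eq_false] at hne
    have hpos : 0 < 2 ^ cl := by positivity
    have := lexgt_lt (pk (C.image cd) cl) (cnt (C.image cd) (2 ^ cl)) (fun x => (app g.1 x ^^^ g.2.2) % 2 ^ cl) (2 ^ cl) (by
      intro x hx
      have := dg_packF (cnt (C.image cd) (2 ^ cl)) (2 ^ cl) (fun x _ => pk_bound hV cl x) 0 x hx
      rw [mul_zero, add_zero] at this
      rw [dg_eq]; exact this) (fun x _ => Nat.mod_lt _ hpos) (2 ^ cl) 0 (by omega) (by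
        rw [← List.range_eq_range', mul_zero]; exact hne)
    rw [← List.range_eq_range', ← c2] at this
    have h5 := hmax B' c1
    rw [Prod.Lex.toLex_le_toLex] at h5
    rcases h5 with h | h
    · exact absurd (lt_trans this h) (lt_irrefl _)
    · have h6 := h.1
      simp only at h6
      rw [h6] at this
      exact absurd this (lt_irrefl _)
set_option maxRecDepth 100000
def dG (n : ℕ) : Gam := ((List.range 6).map (fun i => n / 64 ^ i % 64), (List.range 6).map (fun i => n / 64 ^ (6 + i) % 64), n / 64 ^ 12)
theorem r_w4 : goodRun [0,8,16,32] 4 17 63 5 ([40158707099002875166857, 2379775271230085546633, 2379777522480143450753].map dG) false = true := by decide +kernel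
theorem r_w5 : goodRun [0,4,8,16,32] 5 16 64 5 ([115707278825212629517953, 134596744827059954550657, 2370695978647046602881, 2379704338986197614977, 2379704305451092967573, 2379775325381033215389, 2379704303801825525889, 115716570843608896258457, 115716570877968634626957, 2379775237145225085081, 21269241167249416405125, 2379775341049073911425, 2379775358641259956097].map dG) true = true := by decide +kernel
theorem r_w6r4 : goodRun [0,4,8,16,32,48] 6 15 0 4 ([].map dG) false = true := by decide +kernel
theorem r_w6r6 : goodRun [0,4,8,16,32,60] 6 15 0 4 ([].map dG) false = true := by decide +kernel
theorem r_w6 : goodRun [0,2,4,8,16,32] 6 15 0 4 ([2379667175905495106061, 2379702641340243804417, 2379704303801825525889, 2379775236458030317711, 2379775235908274503815, 2379775235633396596867, 2379775235770835550341, 2379775236183152410763, 2379774681342097236225, 2379774681754414096647].map dG) false = true := by decide +kernel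
theorem r_w7r4 : goodRun [0,2,4,8,16,32,48] 7 14 1 4 ([2379702641340243804417, 2379704303801825525889, 11824508201235248070785, 49603440064192409780353].map dG) true = true := by decide +kernel
theorem r_w7r6 : goodRun [0,2,4,8,16,32,62] 7 14 1 4 ([2379702641340243804417, 11824508201235248070785, 2379704303801825525889, 30713973578559968518401, 59048173029931700207745, 49603439510038549373185, 2379774681342097236225, 68492905995670990635137].map dG) true = true := by decide +kernel
theorem r_w7s0 : goodRun [0,1,2,4,8,16,32] 7 14 0 4 ([40158582123769617191048, 2379774668354116129026, 7102141164211742449921, 2379704303801825525889, 2379774681342097236225, 16546874679775566250050, 35436340615583474139265, 2379775231166630608962, 63770539512801345421441, 73215272478540635848833, 7102069124209889018113, 54325698487059275596289, 54325698456753986093570].map dG) true = true := by decide +kernel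
theorem r_w7s48 : goodRun [0,1,2,4,8,16,32] 7 14 48 4 ([40158582123769617191048, 2379774668354116129026, 7102141164211742449921, 2379704303801825525889, 2379774681342097236225, 16546874679775566250050, 35436340615583474139265, 2379775231166630608962, 63770539512801345421441, 73215272478540635848833, 7102069124209889018113, 54325698487059275596289, 54325698456753986093570].map dG) true = true := by decide +kernel
theorem r_w7s15 : goodRun [0,1,2,4,8,16,32] 7 14 15 4 ([40158580998144587481224, 2379774668354116129026, 7102141718365602857089, 2379702641340243804417, 59048173029931700207745, 73215272478540635848833, 2379704303801825525889, 68492905991341663600706].map dG) true = true := by decide +kernel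
theorem r_w7s31 : goodRun [0,1,2,4,8,16,32] 7 14 31 4 ([40158580998144587481224, 2379774668354116129026, 7102141718365602857089, 2379702641340243804417, 59048173029931700207745, 73215272478540635848833, 2379704303801825525889, 68492905991341663600706].map dG) true = true := by decide +kernel
theorem r_w8 : goodRun [0,1,2,4,8,16,32,63] 8 13 0 4 ([2379702611034954301698, 2379702641340243804417, 2379704303801825525889].map dG) false = true := by decide +kernel
theorem r_n20 : goodRun [0,8,16,32] 4 16 64 5 ([40158707098453119352961, 2379775236045713457289, 2379775270680329732737, 2379777487295771361409].map dG) true = true := by decide +kernel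
/-! ### affine equivalence, normal forms -/
abbrev V := Fin 7 → ZMod 2
def AE (S T : Finset V) : Prop := ∃ (L : V ≃ₗ[ZMod 2] V) (c : V), T = S.image (fun x => L x + c)
theorem AE.refl (S : Finset V) : AE S S := ⟨LinearEquiv.refl _ _, 0, by simp⟩
theorem AE.trans {S T U : Finset V} (h : AE S T) (h' : AE T U) : AE S U := by
  obtain ⟨L, c, rfl⟩ := h
  obtain ⟨L', c', rfl⟩ := h'
  refine ⟨L.trans L', L' c + c', ?_⟩
  rw [Finset.image_image]
  congr 1; funext x; simp [add_assoc]
theorem AE.symm {S T : Finset V} (h : AE S T) : AE T S := by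
  obtain ⟨L, c, rfl⟩ := h
  refine ⟨L.symm, L.symm c, ?_⟩
  rw [Finset.image_image]
  conv_lhs => rw [← Finset.image_id (s := S)]
  congr 1; funext x
  simp only [Function.comp, map_add, LinearEquiv.symm_apply_apply, id, add_assoc, add_self2, add_zero]
theorem AE.card {S T : Finset V} (h : AE S T) : T.card = S.card := by
  obtain ⟨L, c, rfl⟩ := h
  exact Finset.card_image_of_injective _ (fun x y e => L.injective (add_right_cancel e))
def Good (T : Finset V) : Prop := ∀ v, ∃ a ∈ T, ∃ b ∈ T, a + b = v
theorem Good.ae {S T : Finset V} (hg : Good S) (h : AE S T) : Good T := by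
  obtain ⟨L, c, rfl⟩ := h
  intro v
  obtain ⟨a, ha, b, hb, e⟩ := hg (L.symm v)
  refine ⟨_, Finset.mem_image_of_mem _ ha, _, Finset.mem_image_of_mem _ hb, ?_⟩
  calc L a + c + (L b + c) = L (a + b) + (c + c) := by rw [map_add]; abel
    _ = v := by rw [e, add_self2]; simp
def sn (x : E) (t : ZMod 2) : V := Fin.snoc (α := fun _ => ZMod 2) x t
def ini (v : V) : E := fun i => v i.castSucc
theorem ini_sn (x : E) (t : ZMod 2) : ini (sn x t) = x := by funext i; simp [ini, sn]
theorem sn_last (x : E) (t : ZMod 2) : sn x t 6 = t := Fin.snoc_last (α := fun _ => ZMod 2) t x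
theorem sn_ini (v : V) : sn (ini v) (v 6) = v := by
  have := Fin.snoc_init_self (α := fun _ => ZMod 2) v
  exact this
theorem sn_ext {u v : V} (h : ini u = ini v) (h' : u 6 = v 6) : u = v := by rw [← sn_ini u, ← sn_ini v, h, h']
theorem ini_add (u v : V) : ini (u + v) = ini u + ini v := rfl
theorem ini_smul (c : ZMod 2) (v : V) : ini (c • v) = c • ini v := rfl
theorem sn_add (x y : E) (s t : ZMod 2) : sn x s + sn y t = sn (x + y) (s + t) := by
  apply sn_ext
  · rw [ini_add, ini_sn, ini_sn, ini_sn]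
  · rw [Pi.add_apply, sn_last, sn_last, sn_last]
theorem sn_inj {x y : E} {s t : ZMod 2} (h : sn x s = sn y t) : x = y ∧ s = t :=
  ⟨by rw [← ini_sn x s, h, ini_sn], by rw [← sn_last x s, h, sn_last]⟩
def jn (A B : Finset E) : Finset V := A.image (fun x => sn x 1) ∪ B.image (fun x => sn x 0)
theorem mem_jn {A B : Finset E} {v : V} : v ∈ jn A B ↔ (v 6 = 1 ∧ ini v ∈ A) ∨ (v 6 = 0 ∧ ini v ∈ B) := by
  unfold jn
  rw [Finset.mem_union, Finset.mem_image, Finset.mem_image]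
  constructor
  · rintro (⟨x, hx, rfl⟩ | ⟨x, hx, rfl⟩)
    · left; rw [sn_last, ini_sn]; exact ⟨rfl, hx⟩
    · right; rw [sn_last, ini_sn]; exact ⟨rfl, hx⟩
  · rintro (⟨h, h'⟩ | ⟨h, h'⟩)
    · left; exact ⟨_, h', by rw [← h, sn_ini]⟩
    · right; exact ⟨_, h', by rw [← h, sn_ini]⟩
theorem jn_card (A B : Finset E) : (jn A B).card = A.card + B.card := by
  unfold jn
  rw [Finset.card_union_of_disjoint, Finset.card_image_of_injective _ (fun x y e => (sn_inj e).1),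
    Finset.card_image_of_injective _ (fun x y e => (sn_inj e).1)]
  rw [Finset.disjoint_left]
  intro v h1 h2
  obtain ⟨x, _, rfl⟩ := Finset.mem_image.1 h1
  obtain ⟨y, _, e⟩ := Finset.mem_image.1 h2
  exact absurd (sn_inj e).2 (by decide)
noncomputable def ext7 (L : E ≃ₗ[ZMod 2] E) (c : E) : V ≃ₗ[ZMod 2] V where
  toFun v := sn (L (ini v) + v 6 • c) (v 6)
  map_add' u v := by rw [ini_add, sn_add, map_add, Pi.add_apply, add_smul]; congr 1; abel
  map_smul' a v := by
    apply sn_ext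
    · rw [ini_sn, ini_smul, RingHom.id_apply, ini_smul, ini_sn, map_smul, Pi.smul_apply, smul_add, smul_assoc]
    · rw [sn_last, RingHom.id_apply, Pi.smul_apply, Pi.smul_apply, sn_last]
  invFun v := sn (L.symm (ini v + v 6 • c)) (v 6)
  left_inv v := by
    apply sn_ext
    · simp only [ini_sn, sn_last, add_assoc, add_self2, add_zero, LinearEquiv.symm_apply_apply]
    · simp only [sn_last]
  right_inv v := by
    apply sn_ext
    · simp only [ini_sn, sn_last, LinearEquiv.apply_symm_apply, add_assoc, add_self2, add_zero]
    · simp only [sn_last]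
theorem jn_ae (A B : Finset E) (L : E ≃ₗ[ZMod 2] E) (a b : E) : AE (jn A B) (jn (A.image (aff L a)) (B.image (aff L b))) := by
  refine ⟨ext7 L (a + b), sn b 0, ?_⟩
  have h0 : ∀ x, ext7 L (a + b) (sn x 0) + sn b 0 = sn (aff L b x) 0 := by
    intro x
    show sn (L (ini (sn x 0)) + (sn x 0) 6 • (a + b)) ((sn x 0) 6) + sn b 0 = _
    rw [ini_sn, sn_last, sn_add, zero_smul, add_zero, add_zero]; rfl
  have h1 : ∀ x, ext7 L (a + b) (sn x 1) + sn b 0 = sn (aff L a x) 1 := by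
    intro x
    show sn (L (ini (sn x 1)) + (sn x 1) 6 • (a + b)) ((sn x 1) 6) + sn b 0 = _
    rw [ini_sn, sn_last, sn_add, one_smul, add_zero]
    congr 1
    show L x + (a + b) + b = L x + a
    rw [add_assoc, add_assoc, add_self2, add_zero]
  unfold jn
  rw [Finset.image_union, Finset.image_image, Finset.image_image, Finset.image_image, Finset.image_image]
  congr 1
  · congr 1; funext x; exact (h1 x).symm
  · congr 1; funext x; exact (h0 x).symm
/-- a linear equivalence with prescribed last coordinate -/
theorem exists_last (f : V →ₗ[ZMod 2] ZMod 2) (hf : f ≠ 0) : ∃ L : V ≃ₗ[ZMod 2] V, ∀ v, L v 6 = f v := by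
  have : ∃ i, f (Pi.single i 1) = 1 := by
    by_contra h
    push Not at h
    apply hf
    refine LinearMap.pi_ext' (fun i => LinearMap.ext_ring ?_)
    rcases zmod2 (f (Pi.single i 1)) with e | e
    · simpa using e
    · exact absurd e (h i)
  obtain ⟨i, hi⟩ := this
  let F : V →ₗ[ZMod 2] V :=
    { toFun := fun v j => if Equiv.swap i 6 j = i then f v else v (Equiv.swap i 6 j)
      map_add' := by intro u v; funext j; simp only [Pi.add_apply, map_add]; split <;> rfl
      map_smul' := by intro c v; funext j; simp only [Pi.smul_apply, map_smul, RingHom.id_apply]; split <;> rfl }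
  have hF : ∀ v j, F v j = if Equiv.swap i 6 j = i then f v else v (Equiv.swap i 6 j) := fun _ _ => rfl
  have inj : Function.Injective F := by
    rw [← LinearMap.ker_eq_bot, LinearMap.ker_eq_bot']
    intro v hv
    have h6 : f v = 0 := by
      have := congrFun hv 6
      rwa [hF, Equiv.swap_apply_right, if_pos rfl] at this
    have ho : ∀ j, j ≠ i → v j = 0 := by
      intro j hj
      have := congrFun hv (Equiv.swap i 6 j)
      rwa [hF, Equiv.swap_apply_self, if_neg hj] at this
    have e : v = v i • Pi.single i 1 := by
      funext j
      by_cases hj : j = i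
      · subst hj; simp
      · simp [ho j hj, hj]
    have : v i = 0 := by
      rw [e, map_smul, hi] at h6
      simpa using h6
    rw [e, this, zero_smul]
  refine ⟨LinearEquiv.ofInjectiveEndo F inj, fun v => ?_⟩
  show F v 6 = f v
  rw [hF, Equiv.swap_apply_right, if_pos rfl]
def ct (f : V →ₗ[ZMod 2] ZMod 2) (T : Finset V) (i : ZMod 2) : ℕ := (T.filter (fun v => f v = i)).card
theorem ct_add (f : V →ₗ[ZMod 2] ZMod 2) (T : Finset V) (i : ZMod 2) : ct f T i + ct f T (i + 1) = T.card := by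
  unfold ct
  rw [← Finset.card_filter_add_card_filter_not (fun v => f v = i) (s := T)]
  congr 2
  ext v
  simp only [Finset.mem_filter]
  refine and_congr_right (fun _ => ?_)
  generalize f v = a
  revert a i; decide
theorem half64 (f : V →ₗ[ZMod 2] ZMod 2) (hf : f ≠ 0) : ct f Finset.univ 1 = 64 := by
  obtain ⟨L, hL⟩ := exists_last f hf
  have h1 : ct f Finset.univ 1 = ct f Finset.univ 0 := by
    unfold ct
    refine Finset.card_bij' (fun v _ => v + L.symm (Pi.single 6 1)) (fun v _ => v + L.symm (Pi.single 6 1)) ?_ ?_ ?_ ?_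
    · intro v hv
      simp only [Finset.mem_filter, Finset.mem_univ, true_and] at hv ⊢
      rw [map_add, hv, ← hL (L.symm _)]
      simp; decide
    · intro v hv
      simp only [Finset.mem_filter, Finset.mem_univ, true_and] at hv ⊢
      rw [map_add, hv, ← hL (L.symm _)]
      simp
    · intro v _; rw [add_assoc, add_self2, add_zero]
    · intro v _; rw [add_assoc, add_self2, add_zero]
  have h2 := ct_add f Finset.univ 0
  have h3 : (Finset.univ : Finset V).card = 128 := by simp [V]
  rw [h3, zero_add] at h2
  omega
theorem Good.prod {T : Finset V} (hT : Good T) (f : V →ₗ[ZMod 2] ZMod 2) (hf : f ≠ 0) : 64 ≤ ct f T 0 * ct f T 1 := by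
  rw [← half64 f hf]
  unfold ct
  rw [← Finset.card_product]
  refine le_trans (Finset.card_le_card ?_) (Finset.card_image_le (f := fun p : V × V => p.1 + p.2))
  intro v hv
  have hv := (Finset.mem_filter.1 hv).2
  obtain ⟨a, ha, b, hb, e⟩ := hT v
  rw [← e, map_add] at hv
  simp only [Finset.mem_image, Finset.mem_product, Finset.mem_filter, Prod.exists]
  rcases zmod2 (f a) with h | h
  · rw [h, zero_add] at hv
    exact ⟨a, b, ⟨⟨ha, h⟩, hb, hv⟩, e⟩
  · have : f b = 0 := by rw [h] at hv; simpa using hv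
    exact ⟨b, a, ⟨⟨hb, this⟩, ha, h⟩, by rw [add_comm, e]⟩
def fv (g : V) : V →ₗ[ZMod 2] ZMod 2 where
  toFun v := g ⬝ᵥ v
  map_add' := dotProduct_add g
  map_smul' c v := dotProduct_smul c g v
theorem fv_ne {g : V} (h : g ≠ 0) : fv g ≠ 0 := by
  intro e
  apply h
  funext i
  have := LinearMap.congr_fun e (Pi.single i 1)
  simpa [fv] using this
theorem fv_comm (g v : V) : fv g v = fv v g := dotProduct_comm g v
theorem exists_small {T : Finset V} (hT : T.card = 21) : ∃ f : V →ₗ[ZMod 2] ZMod 2, f ≠ 0 ∧ ∃ i, ct f T i ≤ 8 := by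
  by_contra hc
  push Not at hc
  have key : ∀ g : V, g ≠ 0 → 216 ≤ ((T ×ˢ T).filter (fun p => fv g (p.1 + p.2) = 1)).card := by
    intro g hg
    have h0 := hc _ (fv_ne hg) 0
    have h1 := hc _ (fv_ne hg) 1
    have h2 := ct_add (fv g) T 0
    rw [zero_add, hT] at h2
    have e : (T ×ˢ T).filter (fun p => fv g (p.1 + p.2) = 1) =
       (T.filter (fun v => fv g v = 0) ×ˢ T.filter (fun v => fv g v = 1)) ∪ (T.filter (fun v => fv g v = 1) ×ˢ T.filter (fun v => fv g v = 0)) := by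
      ext ⟨a, b⟩
      simp only [Finset.mem_filter, Finset.mem_product, Finset.mem_union, map_add]
      generalize fv g a = x
      generalize fv g b = y
      have : ∀ x y : ZMod 2, x + y = 1 ↔ (x = 0 ∧ y = 1) ∨ (x = 1 ∧ y = 0) := by decide
      rw [this]; tauto
    rw [e, Finset.card_union_of_disjoint, Finset.card_product, Finset.card_product]
    · change 216 ≤ ct (fv g) T 0 * ct (fv g) T 1 + ct (fv g) T 1 * ct (fv g) T 0
      generalize ct (fv g) T 0 = x at *
      generalize ct (fv g) T 1 = y at *
      have : x = 9 ∨ x = 10 ∨ x = 11 ∨ x = 12 := by omega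
      have : y = 21 - x := by omega
      subst this
      rcases ‹x = 9 ∨ _› with rfl | rfl | rfl | rfl <;> norm_num
    · rw [Finset.disjoint_left]
      rintro ⟨a, b⟩ h h'
      simp only [Finset.mem_filter, Finset.mem_product] at h h'
      exact absurd (h.1.2.symm.trans h'.1.2) (by decide)
  have s1 : 127 * 216 ≤ ∑ g : V, ((T ×ˢ T).filter (fun p => fv g (p.1 + p.2) = 1)).card := by
    have : (Finset.univ.erase (0 : V)).card = 127 := by rw [Finset.card_erase_of_mem (Finset.mem_univ _)]; simp [V]
    rw [← this, ← smul_eq_mul]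
    refine le_trans (Finset.card_nsmul_le_sum _ _ _ (fun g hg => key g (Finset.ne_of_mem_erase hg))) ?_
    exact Finset.sum_le_sum_of_subset (Finset.subset_univ _)
  have s2 : ∑ g : V, ((T ×ˢ T).filter (fun p => fv g (p.1 + p.2) = 1)).card = ∑ p ∈ T ×ˢ T, (Finset.univ.filter (fun g : V => fv g (p.1 + p.2) = 1)).card := by
    simp only [Finset.card_filter]
    exact Finset.sum_comm
  have s3 : ∑ p ∈ T ×ˢ T, (Finset.univ.filter (fun g : V => fv g (p.1 + p.2) = 1)).card ≤ ∑ p ∈ T ×ˢ T, (if p.1 = p.2 then 0 else 64) := by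
    refine Finset.sum_le_sum (fun p _ => ?_)
    split
    · rename_i h
      rw [h, add_self2]
      simp
    · rename_i h
      have h' : p.1 + p.2 ≠ 0 := fun e => h (add_eq_zero2.1 e)
      rw [← half64 _ (fv_ne h')]
      unfold ct
      refine le_of_eq (congrArg Finset.card (Finset.filter_congr (fun g _ => ?_)))
      rw [fv_comm]
  have s4 : ∑ p ∈ T ×ˢ T, (if p.1 = p.2 then 0 else 64) = 64 * 420 := by
    rw [Finset.sum_product]
    have : ∀ x ∈ T, ∑ y ∈ T, (if x = y then 0 else 64) = 64 * 20 := by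
      intro x hx
      have h : ∑ y ∈ T, (if x = y then 0 else 64) + ∑ y ∈ T, (if x = y then 64 else 0) = ∑ y ∈ T, 64 := by
        rw [← Finset.sum_add_distrib]
        exact Finset.sum_congr rfl (fun y _ => by split <;> rfl)
      rw [Finset.sum_ite_eq, if_pos hx, Finset.sum_const, hT] at h
      simp at h ⊢
      omega
    rw [Finset.sum_congr rfl this, Finset.sum_const, hT]; rfl
  omega
theorem gp_of {T' : Finset V} (hg : Good T') (w : ℕ) (h : ∀ f : V →ₗ[ZMod 2] ZMod 2, f ≠ 0 → ∀ j, w ≤ ct f T' j) (A B : Finset E)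
    (e : T' = jn A B) : GP w A B := by
  have h01 : ∀ x : ZMod 2, x = 0 ∨ x = 1 := zmod2
  refine ⟨fun u => ?_, fun d _ => ?_, fun f hf i j => ?_⟩
  · obtain ⟨a, ha, b, hb, e'⟩ := hg (sn u 1)
    have e1 : ini a + ini b = u := by rw [← ini_add, e', ini_sn]
    have e2 : a 6 + b 6 = 1 := by rw [← Pi.add_apply, e', sn_last]
    rw [e, mem_jn] at ha hb
    rcases ha with ⟨x, ha⟩ | ⟨x, ha⟩ <;> rcases hb with ⟨y, hb⟩ | ⟨y, hb⟩ <;> rw [x, y] at e2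
    · exact absurd e2 (by decide)
    · exact ⟨_, ha, _, hb, e1⟩
    · exact ⟨_, hb, _, ha, by rw [add_comm]; exact e1⟩
    · exact absurd e2 (by decide)
  · obtain ⟨a, ha, b, hb, e'⟩ := hg (sn d 0)
    have e1 : ini a + ini b = d := by rw [← ini_add, e', ini_sn]
    have e2 : a 6 + b 6 = 0 := by rw [← Pi.add_apply, e', sn_last]
    rw [e, mem_jn] at ha hb
    rcases ha with ⟨x, ha⟩ | ⟨x, ha⟩ <;> rcases hb with ⟨y, hb⟩ | ⟨y, hb⟩ <;> rw [x, y] at e2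
    · exact Or.inl ⟨_, ha, _, hb, e1⟩
    · exact absurd e2 (by decide)
    · exact absurd e2 (by decide)
    · exact Or.inr ⟨_, ha, _, hb, e1⟩
  · let F : V →ₗ[ZMod 2] ZMod 2 :=
      { toFun := fun v => f (ini v) + (i + j) * v 6
        map_add' := by intro u v; rw [ini_add, map_add, Pi.add_apply]; ring
        map_smul' := by intro c v; rw [ini_smul, map_smul, Pi.smul_apply, RingHom.id_apply, smul_eq_mul, smul_eq_mul, smul_eq_mul]; ring }
    have hF : ∀ x t, F (sn x t) = f x + (i + j) * t := by
      intro x t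
      show f (ini (sn x t)) + (i + j) * (sn x t) 6 = _
      rw [ini_sn, sn_last]
    have hF0 : F ≠ 0 := by
      intro h0
      apply hf
      refine LinearMap.ext (fun x => ?_)
      have := LinearMap.congr_fun h0 (sn x 0)
      rw [hF] at this
      simpa using this
    refine le_trans (h F hF0 j) ?_
    unfold ct
    rw [e]
    unfold jn
    rw [Finset.filter_union]
    refine le_trans (Finset.card_union_le _ _) ?_
    rw [Finset.filter_image, Finset.filter_image]
    refine Nat.add_le_add (le_trans Finset.card_image_le ?_) (le_trans Finset.card_image_le ?_)
    · refine Finset.card_le_card (fun x hx => ?_)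
      rw [Finset.mem_filter] at hx ⊢
      refine ⟨hx.1, ?_⟩
      have := hx.2
      rw [hF] at this
      have q : ∀ i j y : ZMod 2, y + (i+j)*1 = j → y = i := by decide
      exact q _ _ _ this
    · refine Finset.card_le_card (fun x hx => ?_)
      rw [Finset.mem_filter] at hx ⊢
      refine ⟨hx.1, ?_⟩
      have := hx.2
      rw [hF] at this
      simpa using this
theorem eq_jn (T : Finset V) : T = jn (Finset.univ.filter (fun x => sn x 1 ∈ T)) (Finset.univ.filter (fun x => sn x 0 ∈ T)) := by
  ext v
  rw [mem_jn]
  simp only [Finset.mem_filter, Finset.mem_univ, true_and]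
  have := sn_ini v
  rcases zmod2 (v 6) with h | h <;> rw [h] at this <;> simp [h, this]
/-- normal form -/
theorem normal {T : Finset V} (hg : Good T) (hT : T.card = 21) : ∃ w A B, 4 ≤ w ∧ w ≤ 8 ∧ A.card = w ∧ B.card = 21 - w ∧ GP w A B ∧ AE T (jn A B) := by
  classical
  obtain ⟨f0, hf0, i0, h8⟩ := exists_small hT
  have hex : ∃ w, ∃ f : V →ₗ[ZMod 2] ZMod 2, f ≠ 0 ∧ ∃ i, ct f T i = w := ⟨_, f0, hf0, i0, rfl⟩
  obtain ⟨f, hf, i, hw⟩ := Nat.find_spec hex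
  have hmin : ∀ f : V →ₗ[ZMod 2] ZMod 2, f ≠ 0 → ∀ j, Nat.find hex ≤ ct f T j := fun f hf j => Nat.find_min' hex ⟨f, hf, j, rfl⟩
  have hw8 : Nat.find hex ≤ 8 := (hmin f0 hf0 i0).trans h8
  generalize Nat.find hex = w at *
  have hw4 : 4 ≤ w := by
    have h1 := hg.prod f hf
    have h2 := ct_add f T i
    rw [hT] at h2
    have h3 : ct f T 0 * ct f T 1 = ct f T i * ct f T (i + 1) := by
      rcases zmod2 i with rfl | rfl
      · rw [zero_add]
      · rw [show (1 : ZMod 2) + 1 = 0 by decide, mul_comm]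
    rw [h3, hw] at h1
    rw [hw] at h2
    by_contra hc
    have : ct f T (i + 1) = 21 - w := by omega
    rw [this] at h1
    have : w = 0 ∨ w = 1 ∨ w = 2 ∨ w = 3 := by omega
    rcases this with rfl | rfl | rfl | rfl <;> omega
  obtain ⟨L, hL⟩ := exists_last f hf
  let c : V := sn 0 (1 + i)
  have hae : AE T (T.image (fun x => L x + c)) := ⟨L, c, rfl⟩
  set T' := T.image (fun x => L x + c) with hT'
  have hct : ∀ f : V →ₗ[ZMod 2] ZMod 2, ∀ j, ct f T' j = ct (f ∘ₗ L.toLinearMap) T (j - f c) := by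
    intro f j
    unfold ct
    rw [hT', Finset.filter_image, Finset.card_image_of_injective _ (fun x y e => L.injective (add_right_cancel e))]
    congr 1; ext v
    simp only [Finset.mem_filter, map_add, eq_sub_iff_add_eq]; rfl
  have hm' : ∀ f : V →ₗ[ZMod 2] ZMod 2, f ≠ 0 → ∀ j, w ≤ ct f T' j := by
    intro f hf j
    rw [hct]
    refine hmin _ ?_ _
    intro h0
    apply hf
    refine LinearMap.ext (fun v => ?_)
    have := LinearMap.congr_fun h0 (L.symm v)
    simpa using this
  have hj := eq_jn T'
  have hcA : (Finset.univ.filter (fun x => sn x 1 ∈ T')).card = w := by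
    rw [← hw]
    unfold ct
    rw [← Finset.card_image_of_injective (s := Finset.univ.filter (fun x => sn x 1 ∈ T')) (f := fun x => sn x 1) (fun x y e => (sn_inj e).1)]
    rw [← Finset.card_image_of_injective (s := T.filter (fun v => f v = i)) (f := fun x => L x + c) (fun x y e => L.injective (add_right_cancel e))]
    congr 1
    ext v
    have hlast : ∀ x, (L x + c) 6 = 1 ↔ f x = i := by
      intro x
      rw [Pi.add_apply, hL, show c 6 = 1 + i from sn_last _ _]
      have q : ∀ i y : ZMod 2, y + (1 + i) = 1 ↔ y = i := by decide
      exact q _ _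
    simp only [Finset.mem_image, Finset.mem_filter, Finset.mem_univ, true_and]
    constructor
    · rintro ⟨x, hx, rfl⟩
      obtain ⟨y, hy, e⟩ := Finset.mem_image.1 hx
      refine ⟨y, ⟨hy, (hlast y).1 ?_⟩, e⟩
      rw [e, sn_last]
    · rintro ⟨y, ⟨hy, hy'⟩, rfl⟩
      have h6 := (hlast y).2 hy'
      have e := sn_ini (L y + c)
      rw [h6] at e
      exact ⟨ini (L y + c), by rw [e]; exact Finset.mem_image_of_mem _ hy, e⟩
  refine ⟨w, _, _, hw4, hw8, hcA, ?_, gp_of (hg.ae hae) w hm' _ _ hj, hj ▸ hae⟩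
  have h1 := jn_card (Finset.univ.filter (fun x => sn x 1 ∈ T')) (Finset.univ.filter (fun x => sn x 0 ∈ T'))
  rw [← hj, hae.card, hT, hcA] at h1
  omega
/-! ### frames -/
def Mv (v j i : ℕ) : ℕ := if i = j then v else 2 ^ i
def lowb (v : ℕ) : ℕ := if v % 2 = 1 then 0 else if v / 2 % 2 = 1 then 1 else if v / 4 % 2 = 1 then 2 else if v / 8 % 2 = 1 then 3 else if v / 16 % 2 = 1 then 4 else 5
def swl (j k : ℕ) : List ℕ := (List.range 6).map (fun i => 2 ^ (if i = j then k else if i = k then j else i))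
def Mc (v j : ℕ) : List ℕ := (List.range 6).map (Mv v j)
def fc (v k : ℕ) : List ℕ := (Mc v (lowb v)).map (app (swl (lowb v) k))
def fd (v k : ℕ) : List ℕ := (swl (lowb v) k).map (app (Mc v (lowb v)))
theorem f_ok0 : ∀ k < 6, ∀ v < 64, (v % 2 ^ (k + 1) == 0 || (invOK 6 (fc v k) (fd v k) && app (fc v k) v == 2 ^ k &&
    (List.range 6).all (fun i => i ≤ k || app (fc v k) (2 ^ i) == 2 ^ i))) = true := by decide +kernel
theorem f_ok (k : ℕ) (hk : k < 6) (v : ℕ) (hv : v < 64) (h0 : v % 2 ^ (k + 1) ≠ 0) : invOK 6 (fc v k) (fd v k) = true ∧ app (fc v k) v = 2 ^ k ∧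
    ∀ i < 6, k < i → app (fc v k) (2 ^ i) = 2 ^ i := by
  have := f_ok0 k hk v hv
  simp only [Bool.or_eq_true, Bool.and_eq_true, beq_iff_eq, h0, false_or, List.all_eq_true, List.mem_range, decide_eq_true_eq] at this
  exact ⟨this.1.1, this.1.2, fun i hi hk => (this.2 i hi).resolve_left (by omega)⟩
def FR (m : ℕ) (A : Finset E) : Prop := (0 : E) ∈ A ∧ ∀ i, m ≤ i → i < 6 → dec 6 (2 ^ i) ∈ A
theorem linE_dec {cs ds : List ℕ} (h : invOK 6 cs ds = true) {x : ℕ} (hx : x < 64) : linE 6 cs ds h (dec 6 x) = dec 6 (app cs x) := by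
  rw [linE_apply, lin_apply, cd_dec (by exact hx)]
theorem frame0 (m : ℕ) : ∀ A : Finset E, m ≤ 6 → FR m A → ∃ m' ≤ 6, ∃ L : E ≃ₗ[ZMod 2] E, FR m' (A.image (aff L 0)) ∧ ∀ v ∈ A.image (aff L 0), cd v % 2 ^ m' = 0 := by
  induction m with
  | zero =>
    intro A _ h
    refine ⟨0, by omega, LinearEquiv.refl _ _, ?_, fun v _ => Nat.mod_one _⟩
    have : A.image (aff (LinearEquiv.refl (ZMod 2) E) 0) = A := by
      conv_rhs => rw [← Finset.image_id (s := A)]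
      congr 1; funext x; simp [aff]
    rwa [this]
  | succ k ih =>
    intro A hk h
    by_cases hc : ∀ v ∈ A, cd v % 2 ^ (k + 1) = 0
    · refine ⟨k + 1, hk, LinearEquiv.refl _ _, ?_⟩
      have : A.image (aff (LinearEquiv.refl (ZMod 2) E) 0) = A := by
        conv_rhs => rw [← Finset.image_id (s := A)]
        congr 1; funext x; simp [aff]
      rw [this]; exact ⟨h, hc⟩
    · push Not at hc
      obtain ⟨v, hv, hv0⟩ := hc
      obtain ⟨h1, h2, h3⟩ := f_ok k (by omega) (cd v) (cd6 v) hv0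
      have hfr : FR k (A.image (aff (linE 6 _ _ h1) 0)) := by
        refine ⟨Finset.mem_image.2 ⟨0, h.1, by simp [aff]⟩, fun i hi hi6 => ?_⟩
        rcases Nat.eq_or_lt_of_le hi with rfl | hi
        · refine Finset.mem_image.2 ⟨v, hv, ?_⟩
          rw [aff, add_zero]
          have := linE_dec h1 (cd6 v)
          rwa [dec_cd, h2] at this
        · refine Finset.mem_image.2 ⟨_, h.2 i hi hi6, ?_⟩
          rw [aff, add_zero, linE_dec h1 (by interval_cases i <;> norm_num), h3 i hi6 hi]
      obtain ⟨m', hm', L, hL⟩ := ih _ (by omega) hfr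
      refine ⟨m', hm', (linE 6 _ _ h1).trans L, ?_⟩
      have : A.image (aff ((linE 6 _ _ h1).trans L) 0) = (A.image (aff (linE 6 _ _ h1) 0)).image (aff L 0) := by
        rw [Finset.image_image]; congr 1; funext x; simp [aff]
      rw [this]; exact hL
theorem aff_aff (A : Finset E) (L M : E ≃ₗ[ZMod 2] E) (a b : E) : (A.image (aff L a)).image (aff M b) = A.image (aff (L.trans M) (M a + b)) := by
  rw [Finset.image_image]; congr 1; funext x; simp [aff, add_assoc]
theorem frame {A : Finset E} (hA : A.Nonempty) : ∃ m ≤ 6, ∃ (L : E ≃ₗ[ZMod 2] E) (a : E), FR m (A.image (aff L a)) ∧ ∀ v ∈ A.image (aff L a), cd v % 2 ^ m = 0 := by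
  obtain ⟨a, ha⟩ := hA
  have h : FR 6 (A.image (aff (LinearEquiv.refl _ _) a)) := ⟨Finset.mem_image.2 ⟨a, ha, by simp [aff, add_self2]⟩, fun i h h' => by omega⟩
  obtain ⟨m, hm, L, hL⟩ := frame0 6 _ le_rfl h
  rw [aff_aff] at hL
  exact ⟨m, hm, _, _, hL⟩
/-! ### relabelling -/
def mapOK (Al Al' : List ℕ) (g : Gam) : Bool :=
  invOK 6 g.1 g.2.1 && Al.all (fun x => Nat.blt x 64) && Nat.blt g.2.2 64 && Al.all (fun x => Al'.contains (Nat.xor (app g.1 x) g.2.2)) &&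
    Al'.all (fun y => (Al.map (fun x => Nat.xor (app g.1 x) g.2.2)).contains y)
theorem mapOK_dl {Al Al' : List ℕ} {g : Gam} (h : mapOK Al Al' g = true) : ∃ hi : invOK 6 g.1 g.2.1 = true, (dl Al).image (aff (linE 6 _ _ hi) (dec 6 g.2.2)) = dl Al' := by
  simp only [mapOK, Bool.and_eq_true, List.all_eq_true] at h
  obtain ⟨⟨⟨⟨hi, hl⟩, hg⟩, h1⟩, h2⟩ := h
  refine ⟨hi, ?_⟩
  have key : ∀ x ∈ Al, aff (linE 6 _ _ hi) (dec 6 g.2.2) (dec 6 x) = dec 6 (Nat.xor (app g.1 x) g.2.2) := by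
    intro x hx
    rw [aff, linE_dec hi (blt_lt (hl x hx)), ← dec_xor]; rfl
  ext v
  simp only [dl, Finset.mem_image, List.mem_toFinset, List.mem_map]
  constructor
  · rintro ⟨_, ⟨x, hx, rfl⟩, rfl⟩
    exact ⟨_, List.contains_iff_mem.1 (h1 x hx), (key x hx).symm⟩
  · rintro ⟨y, hy, rfl⟩
    obtain ⟨x, hx, rfl⟩ := List.mem_map.1 (List.contains_iff_mem.1 (h2 y hy))
    exact ⟨_, ⟨x, hx, rfl⟩, key x hx⟩
theorem mem_dl {Al : List ℕ} (hl : ∀ x ∈ Al, x < 64) {v : E} : v ∈ dl Al ↔ cd v ∈ Al := by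
  simp only [dl, List.mem_toFinset, List.mem_map]
  constructor
  · rintro ⟨x, hx, rfl⟩; rwa [cd_dec (by exact hl x hx)]
  · intro h; exact ⟨_, h, dec_cd v⟩
theorem dl_card {Al : List ℕ} (hl : ∀ x ∈ Al, x < 64) (hn : Al.Nodup) : (dl Al).card = Al.length := by
  unfold dl
  rw [List.toFinset_card_of_nodup, List.length_map]
  refine List.Nodup.map_on (fun x hx y hy e => ?_) hn
  rw [← cd_dec (n := 6) (x := x) (by exact hl x hx), e, cd_dec (by exact hl y hy)]
def frl (m : ℕ) : List ℕ := 0 :: ((List.range (6 - m)).map (fun i => 2 ^ (m + i)))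
theorem frl_ok : ∀ m ≤ 6, (∀ x ∈ frl m, x < 64) ∧ (frl m).Nodup ∧ (frl m).length = 7 - m := by decide +kernel
theorem FR.sub {m : ℕ} {A : Finset E} (hm : m ≤ 6) (h : FR m A) : dl (frl m) ⊆ A := by
  intro v hv
  simp only [dl, frl, List.mem_toFinset, List.mem_map, List.mem_cons, List.mem_range] at hv
  obtain ⟨x, rfl | ⟨i, hi, rfl⟩, rfl⟩ := hv
  · rw [dec_zero]; exact h.1
  · exact h.2 _ (by omega) (by omega)
theorem FR.eq {m : ℕ} {A : Finset E} (hm : m ≤ 6) (h : FR m A) (hA : A.card = 7 - m) : A = dl (frl m) := by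
  refine (Finset.eq_of_subset_of_card_le (h.sub hm) ?_).symm
  rw [dl_card (frl_ok m hm).1 (frl_ok m hm).2.1, (frl_ok m hm).2.2, hA]
theorem FR.eqx {m : ℕ} {A : Finset E} (hm : m ≤ 6) (h : FR m A) (hA : A.card = 8 - m) (hc : ∀ v ∈ A, cd v % 2 ^ m = 0) :
    ∃ x < 64, x % 2 ^ m = 0 ∧ x ∉ frl m ∧ A = dl (x :: frl m) := by
  have hcard := dl_card (frl_ok m hm).1 (frl_ok m hm).2.1
  rw [(frl_ok m hm).2.2] at hcard
  obtain ⟨v, hv, hn⟩ : ∃ v ∈ A, v ∉ dl (frl m) := by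
    by_contra hcc
    push Not at hcc
    have := Finset.card_le_card (show A ⊆ dl (frl m) from hcc)
    omega
  refine ⟨cd v, cd6 v, hc v hv, fun h => hn ((mem_dl (frl_ok m hm).1).2 h), ?_⟩
  have e : dl (cd v :: frl m) = insert v (dl (frl m)) := by simp [dl, dec_cd]
  rw [e]
  refine (Finset.eq_of_subset_of_card_le (Finset.insert_subset hv (h.sub hm)) ?_).symm
  rw [Finset.card_insert_of_notMem hn, hcard, hA]; omega
/-- closed set of full size -/
theorem FR.le_card {m : ℕ} {A : Finset E} (hc : ∀ v ∈ A, cd v % 2 ^ m = 0) : A.card ≤ ((List.range 64).filter (fun x => x % 2 ^ m = 0)).length := by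
  have hs : A ⊆ dl ((List.range 64).filter (fun x => x % 2 ^ m = 0)) := by
    intro v hv
    rw [mem_dl (by intro x hx; exact List.mem_range.1 (List.mem_of_mem_filter hx))]
    simp [cd6, hc v hv]
  refine (Finset.card_le_card hs).trans ?_
  rw [dl_card (by intro x hx; exact List.mem_range.1 (List.mem_of_mem_filter hx)) (List.nodup_range.filter _)]
/-! ### slices and halves -/
theorem slice {w : ℕ} {A B : Finset E} (h : GP w A B) (hA : ∀ v ∈ A, cd v < 8) (y : ℕ) (hy : y < 8) : 8 ≤ A.card * (B.filter (fun v => cd v / 8 = y)).card := by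
  rw [← Finset.card_product]
  have e : (dl ((List.range 8).map (fun i => 8 * y + i))).card = 8 := by
    rw [dl_card]
    · simp
    · intro x hx; simp at hx; omega
    · refine List.Nodup.map (fun a b h => by simpa using h) List.nodup_range
  refine e.symm.le.trans (le_trans (Finset.card_le_card ?_) (Finset.card_image_le (f := fun p : E × E => p.1 + p.2)))
  intro v hv
  rw [mem_dl (by intro x hx; simp at hx; omega)] at hv
  obtain ⟨a, ha, b, hb, e⟩ := h.cov v
  refine Finset.mem_image.2 ⟨(a, b), Finset.mem_product.2 ⟨ha, Finset.mem_filter.2 ⟨hb, ?_⟩⟩, e⟩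
  have : b = v + a := by rw [← e, add_comm a b, add_assoc, add_self2, add_zero]
  rw [this, cd_add]
  have h8 : ∀ x < 64, ∀ a < 8, (x ^^^ a) / 8 = x / 8 := by decide +kernel
  rw [h8 _ (cd6 v) _ (hA a ha)]
  simp at hv; omega
theorem slice_sum (B : Finset E) : ∑ y ∈ Finset.range 8, (B.filter (fun v => cd v / 8 = y)).card = B.card := by
  rw [← Finset.card_eq_sum_card_fiberwise (f := fun v => cd v / 8)]
  intro v _
  have := cd6 v
  simp; omega
theorem slice_eq {w : ℕ} {A B : Finset E} (h : GP w A B) (hA : ∀ v ∈ A, cd v < 8) (hc : A.card ≤ 7) : 16 ≤ B.card ∧ (B.card = 16 → ∀ y < 8, (B.filter (fun v => cd v / 8 = y)).card = 2) := by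
  have h2 : ∀ y < 8, 2 ≤ (B.filter (fun v => cd v / 8 = y)).card := by
    intro y hy
    have := slice h hA y hy
    by_contra hlt
    have : A.card * (B.filter (fun v => cd v / 8 = y)).card ≤ 7 * 1 := Nat.mul_le_mul hc (by omega)
    omega
  have hs := slice_sum B
  simp only [Finset.sum_range_succ, Finset.sum_range_zero] at hs
  have g0 := h2 0; have g1 := h2 1; have g2 := h2 2; have g3 := h2 3; have g4 := h2 4; have g5 := h2 5; have g6 := h2 6; have g7 := h2 7
  refine ⟨by omega, fun e y hy => ?_⟩
  interval_cases y <;> omega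
/-- halves when the functional vanishes on few elements of A -/
theorem halfB {w n k : ℕ} {A B : Finset E} (h : GP w A B) (g : ℕ) (hg : g < 64) (hg0 : g ≠ 0) (i : ZMod 2) (hA : (A.filter (fun v => fn g v = i)).card ≤ k) (hn : n + k ≤ w) (j : ZMod 2) :
    n ≤ (B.filter (fun v => fn g v = j)).card := by
  have := h.half (fn g) (fn_ne hg hg0) i j
  omega
theorem halfB2 (B : Finset E) (g : ℕ) : (B.filter (fun v => fn g v = 0)).card + (B.filter (fun v => fn g v = 1)).card = B.card := by
  rw [← Finset.card_filter_add_card_filter_not (fun v => fn g v = 0) (s := B)]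
  congr 2
  ext v
  simp only [Finset.mem_filter]
  refine and_congr_right (fun _ => ?_)
  generalize fn g v = a
  revert a; decide
theorem fn_sum (B : Finset E) (g : ℕ) : fn g (∑ v ∈ B, v) = ((B.filter (fun v => fn g v = 1)).card : ZMod 2) := by
  rw [map_sum, Finset.card_filter, Nat.cast_sum]
  refine Finset.sum_congr rfl (fun v _ => ?_)
  rcases zmod2 (fn g v) with h | h <;> simp [h]
theorem filt_empty {A : Finset E} {m g : ℕ} (hc : ∀ v ∈ A, cd v % 2 ^ m = 0) (hg : g < 2 ^ m) : (A.filter (fun v => fn g v = 1)).card ≤ 0 := by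
  rw [Nat.le_zero, Finset.card_eq_zero, Finset.filter_eq_empty_iff]
  intro v hv
  rw [fn_apply]
  have : g &&& cd v = 0 := by
    apply Nat.eq_of_testBit_eq
    intro i
    rw [Nat.testBit_and, Nat.zero_testBit]
    by_cases hi : i < m
    · have h := congrArg (Nat.testBit · i) (hc v hv)
      simp only [Nat.testBit_mod_two_pow, hi, Nat.zero_testBit, decide_true, Bool.true_and] at h
      rw [h, Bool.and_false]
    · rw [Nat.testBit_lt_two_pow (lt_of_lt_of_le hg (Nat.pow_le_pow_right (by norm_num) (by omega))), Bool.false_and]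
  rw [this]
  decide
set_option maxRecDepth 100000
def Kill (Al : List ℕ) (w M s : ℕ) : Prop := ∀ B : Finset E, GP w (dl Al) B → B.card = M → (s < 64 → ∑ v ∈ B, v = dec 6 s) → False
theorem kodd {Al : List ℕ} {w M s : ℕ} (hk : Kill Al w M s) (hM : M % 2 = 1) (B : Finset E) (h : GP w (dl Al) B) (hB : B.card = M) : False := by
  have h2 := h.map (LinearEquiv.refl _ _) 0 (∑ v ∈ B, v + dec 6 s)
  have e : (dl Al).image (aff (LinearEquiv.refl _ _) 0) = dl Al := by
    conv_rhs => rw [← Finset.image_id (s := dl Al)]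
    congr 1; funext x; simp [aff]
  rw [e] at h2
  refine hk _ h2 ?_ (fun _ => ?_)
  · rw [Finset.card_image_of_injective _ (aff_inj _ _), hB]
  · rw [aff_sum, hB]
    obtain ⟨k, rfl⟩ : ∃ k, M = 2 * k + 1 := ⟨M / 2, by omega⟩
    rw [add_smul, mul_smul, two_smul, ← smul_add, add_self2]
    simp only [LinearEquiv.refl_apply]
    rw [one_smul, smul_zero, zero_add, ← add_assoc, add_self2, zero_add]
theorem GP.rel {Al Al' : List ℕ} {g : Gam} (hg : mapOK Al Al' g = true) {w : ℕ} {B : Finset E} (h : GP w (dl Al) B) :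
    ∃ B', GP w (dl Al') B' ∧ B'.card = B.card ∧ ∑ v ∈ B', v = dec 6 (app g.1 (cd (∑ v ∈ B, v))) ∧ AE (jn (dl Al) B) (jn (dl Al') B') := by
  obtain ⟨hi, e⟩ := mapOK_dl hg
  refine ⟨B.image (aff (linE 6 _ _ hi) 0), e ▸ h.map _ _ _, Finset.card_image_of_injective _ (aff_inj _ _), ?_, e ▸ jn_ae _ _ _ _ _⟩
  rw [aff_sum, smul_zero, add_zero, linE_apply, lin_apply]
def anyc (certs : List ℕ) (Al : List ℕ) (tg : List (List ℕ)) : Bool := certs.any (fun n => tg.any (fun t => mapOK Al t (dG n)))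
theorem GP.any {certs Al : List ℕ} {tg : List (List ℕ)} (hc : anyc certs Al tg = true) {w : ℕ} {B : Finset E} (h : GP w (dl Al) B) :
    ∃ t ∈ tg, ∃ B', GP w (dl t) B' ∧ B'.card = B.card ∧ AE (jn (dl Al) B) (jn (dl t) B') := by
  simp only [anyc, List.any_eq_true] at hc
  obtain ⟨n, _, t, ht, hm⟩ := hc
  obtain ⟨B', h1, h2, _, h4⟩ := h.rel hm
  exact ⟨t, ht, B', h1, h2, h4⟩
def xs (m : ℕ) : List ℕ := (List.range 64).filter (fun x => x % 2 ^ m == 0 && !(frl m).contains x)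
theorem mem_xs {m x : ℕ} (h : x < 64) (h' : x % 2 ^ m = 0) (h2 : x ∉ frl m) : x ∈ xs m := by
  simp [xs, h, h', h2]
theorem c_p4 : anyc [594943948488301412868] [0,16,32,48] [[0,1,2,3]] = true := by decide +kernel
theorem c_5 : ∀ x ∈ xs 3, anyc [5019854080078831813640,5019854151543916725256,5019854152093639509000,19186953635892366279688] (x :: frl 3) [[0,1,2,3,4]] = true := by decide +kernel
theorem c_6 : ∀ x ∈ xs 2, anyc [76162795118053002772609,76762458415636837236865,76767142159249309778049,20393964327574405464193,77961501284036041179265,77966185027648513720449,21593007196007432274049,77975410651485578543233,21602232819844497096833,21897381850923758829697,22197070510431702925441] (x :: frl 2) [[0,4,8,16,32,48],[0,4,8,16,32,60]] = true := by decide +kernel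
theorem c_7 : ∀ x ∈ xs 1, anyc [75860619961381646109697,76160452736073374706689,76162795170829560906881,10197274954975914108033,76760116068841581259777,76762458503597767459969,10796938287744649143425,76767142264802426045569,10801622048949307729025,10949232039132096176513,21883071926939413463809,77959159007609529379841,77961501442365715580033,11995981226546420130945,77966185203570374165633,12000664987751078716545,12148274977933867164033,20683740828229589615361,77975410862591811077249,12009890646772515628161,12157500636955304075649,20674371089205373780737,12452649685626751852929,20379150000532080313089,20229269641983236817153,1189887886112973684993] (x :: frl 1) [[0,2,4,8,16,32,48],[0,2,4,8,16,32,62]] = true := by decide +kernel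
def l7s : List ℕ := [2379775235495957643393,75782148098325847020592,75780976876480987995152,149307873914121623568,75928550828933225579600,296881826366359208016,298034747802246579201,7701734678473512096067,76223698716520400102480,592029713953533730896,593182635389421102081,7401973943508763152707,595488469602541830273,7252058110179322122307,7177099916437671399617,76813992275079754490960,1182323272512888119376,1183476193948775490561,7392894686659852112195,1185782028161896218753,7242978853330411081795,7168020659588760359105,2370695978647046602881,1190392588280419860609,7238368293211887439939,7163410099470236717249,2366085418528522961025,7161104265257115989057,2363779584315402232833,2362626662879514861648,77994295665446381233232,6212591296293225369923,6062675462963784339523,5987717269222133616833,6058064902845260697667,5983106709103609974977,5980800874890489246785,5467771344285906309187,5392813150544255586497,5390507316331134858305,5095359428743960335425,151227869638073573845088]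
theorem c_7s : ∀ s < 64, l7s.any (fun n => mapOK (frl 0) [0,1,2,4,8,16,32] (dG n) && [0,48,15,31].contains (app (dG n).1 s)) = true := by decide +kernel
theorem c_20 : ∀ q < 4, anyc [113708099434672502047768,298651776612275978776,298633762213766497800,297480840709159650312] ([0,1,2,3,4].erase q) [[0,8,16,32]] = true := by decide +kernel
theorem c_8 : ∀ m ∈ [3,4,5,6], m ≤ 6 := by decide
theorem k4 : Kill [0,8,16,32] 4 17 63 := fun B => engine _ _ _ _ _ _ _ r_w4 B
theorem k5 : Kill [0,4,8,16,32] 5 16 64 := fun B => engine _ _ _ _ _ _ _ r_w5 B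
theorem k64 : Kill [0,4,8,16,32,48] 6 15 0 := fun B => engine _ _ _ _ _ _ _ r_w6r4 B
theorem k66 : Kill [0,4,8,16,32,60] 6 15 0 := fun B => engine _ _ _ _ _ _ _ r_w6r6 B
theorem k6 : Kill [0,2,4,8,16,32] 6 15 0 := fun B => engine _ _ _ _ _ _ _ r_w6 B
theorem k74 : Kill [0,2,4,8,16,32,48] 7 14 1 := fun B => engine _ _ _ _ _ _ _ r_w7r4 B
theorem k76 : Kill [0,2,4,8,16,32,62] 7 14 1 := fun B => engine _ _ _ _ _ _ _ r_w7r6 B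
theorem k7 (s : ℕ) (hs : s ∈ [0,48,15,31]) : Kill [0,1,2,4,8,16,32] 7 14 s := by
  simp only [List.mem_cons, List.not_mem_nil, or_false] at hs
  rcases hs with rfl | rfl | rfl | rfl
  · exact fun B => engine _ _ _ _ _ _ _ r_w7s0 B
  · exact fun B => engine _ _ _ _ _ _ _ r_w7s48 B
  · exact fun B => engine _ _ _ _ _ _ _ r_w7s15 B
  · exact fun B => engine _ _ _ _ _ _ _ r_w7s31 B
theorem k8 : Kill [0,1,2,4,8,16,32,63] 8 13 0 := fun B => engine _ _ _ _ _ _ _ r_w8 B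
theorem k20 : Kill [0,8,16,32] 4 16 64 := fun B => engine _ _ _ _ _ _ _ r_n20 B
/-- the sum is odd on functionals vanishing on A when w = 7 -/
theorem odd7 {A B : Finset E} (h : GP 7 A B) (hB : B.card = 14) (m g : ℕ) (hc : ∀ v ∈ A, cd v % 2 ^ m = 0) (hg : g < 2 ^ m) (hg6 : g < 64) (hg0 : g ≠ 0) : fn g (∑ v ∈ B, v) = 1 := by
  have h1 := halfB h g hg6 hg0 1 (filt_empty hc hg) (n := 7) (by omega) 0
  have h2 := halfB h g hg6 hg0 1 (filt_empty hc hg) (n := 7) (by omega) 1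
  have h3 := halfB2 B g
  rw [fn_sum, show (B.filter (fun v => fn g v = 1)).card = 7 by omega]
  decide
theorem shear7 (s : ℕ) (x : ℕ) : s < 64 → s % 2 = 1 → x ∈ [48, 62] → mapOK [0,2,4,8,16,32,x] [0,2,4,8,16,32,x] ([s,2,4,8,16,32], [s,2,4,8,16,32], 0) = true ∧ app [s,2,4,8,16,32] s = 1 := by
  have : ∀ s < 64, (s % 2 != 1 || ([48, 62].all (fun x => mapOK [0,2,4,8,16,32,x] [0,2,4,8,16,32,x] ([s,2,4,8,16,32], [s,2,4,8,16,32], 0)) && app [s,2,4,8,16,32] s == 1)) = true := by decide +kernel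
  intro h1 h2 h3
  have := this s h1
  simp only [h2, bne_self_eq_false, Bool.false_or, Bool.and_eq_true, List.all_eq_true, beq_iff_eq] at this
  exact ⟨this.1 x h3, this.2⟩
theorem par1 : ∀ s < 64, par (1 &&& s) = s % 2 := by decide +kernel
theorem seven {x : ℕ} (hx : x ∈ [48, 62]) {B : Finset E} (h : GP 7 (dl [0,2,4,8,16,32,x]) B) (hB : B.card = 14) : False := by
  have hc : ∀ v ∈ dl [0,2,4,8,16,32,x], cd v % 2 ^ 1 = 0 := by
    intro v hv
    have hx' : x = 48 ∨ x = 62 := by simpa using hx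
    rw [mem_dl (by rcases hx' with rfl | rfl <;> decide)] at hv
    simp only [List.mem_cons, List.not_mem_nil, or_false] at hv
    omega
  have h1 := odd7 h hB 1 1 hc (by norm_num) (by norm_num) (by norm_num)
  rw [fn_apply, par1 _ (cd6 _)] at h1
  have h2 : cd (∑ v ∈ B, v) % 2 = 1 := by
    rcases Nat.mod_two_eq_zero_or_one (cd (∑ v ∈ B, v)) with e | e
    · rw [e] at h1; exact absurd h1 (by decide)
    · exact e
  obtain ⟨h3, h4⟩ := shear7 _ x (cd6 _) h2 hx
  obtain ⟨B', g1, g2, g3, _⟩ := h.rel h3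
  change _ = dec 6 (app [_,2,4,8,16,32] _) at g3
  rw [h4] at g3
  have hx' : x = 48 ∨ x = 62 := by simpa using hx
  rcases hx' with rfl | rfl
  · exact k74 B' g1 (g2.trans hB) (fun _ => g3)
  · exact k76 B' g1 (g2.trans hB) (fun _ => g3)
theorem bit8 : ∀ x ∈ xs 0, x = 63 ∨ ∃ j < 6, cntA (x :: frl 0) (2 ^ j) 1 ≤ 1 := by decide +kernel
theorem dlt {x m : ℕ} (hx : x < 64) (hm : m ≤ 6) : ∀ y ∈ x :: frl m, y < 64 := by
  intro y hy
  rcases List.mem_cons.1 hy with rfl | hy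
  · exact hx
  · exact (frl_ok m hm).1 y hy
theorem rot8 {A B : Finset E} {w : ℕ} (h : GP w A B) (hc : ∀ v ∈ A, cd v % 2 ^ 3 = 0) (hA : A.card ≤ 7) : 16 ≤ B.card := by
  have hi : invOK 6 [8,16,32,1,2,4] [8,16,32,1,2,4] = true := by decide
  have h2 := h.map (linE 6 _ _ hi) 0 0
  have := (slice_eq h2 (fun v hv => ?_) (Finset.card_image_le.trans hA)).1
  · rwa [Finset.card_image_of_injective _ (aff_inj _ _)] at this
  · obtain ⟨x, hx, rfl⟩ := Finset.mem_image.1 hv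
    rw [aff, add_zero, cd_linE]
    have q : ∀ x < 64, x % 2 ^ 3 = 0 → app [8,16,32,1,2,4] x < 8 := by decide +kernel
    exact q _ (cd6 x) (hc x hx)
theorem lens : ∀ m ≤ 6, ((List.range 64).filter (fun x => x % 2 ^ m = 0)).length = 2 ^ (6 - m) := by decide +kernel
theorem vanish8 {A B : Finset E} (h : GP 8 A B) (hB : B.card = 13) (m : ℕ) (hm : 1 ≤ m) (hc : ∀ v ∈ A, cd v % 2 ^ m = 0) : False := by
  have hg : 1 < 2 ^ m := Nat.one_lt_two_pow (by omega)
  have h1 := halfB h 1 (by norm_num) (by norm_num) 1 (filt_empty hc hg) (n := 8) (by omega) 0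
  have h2 := halfB h 1 (by norm_num) (by norm_num) 1 (filt_empty hc hg) (n := 8) (by omega) 1
  have h3 := halfB2 B 1
  omega
theorem vanish7 {A B : Finset E} (h : GP 7 A B) (hB : B.card = 14) (m : ℕ) (hm : 2 ≤ m) (hc : ∀ v ∈ A, cd v % 2 ^ m = 0) : False := by
  have hg : 2 ^ 2 ≤ 2 ^ m := Nat.pow_le_pow_right (by norm_num) hm
  have h1 := odd7 h hB m 1 hc (by omega) (by norm_num) (by norm_num)
  have h2 := odd7 h hB m 2 hc (by omega) (by norm_num) (by norm_num)
  have h3 := odd7 h hB m 3 hc (by omega) (by norm_num) (by norm_num)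
  rw [fn_apply] at h1 h2 h3
  have q : ∀ s < 64, ((par (1 &&& s) : ℕ) : ZMod 2) = 1 → ((par (2 &&& s) : ℕ) : ZMod 2) = 1 → ((par (3 &&& s) : ℕ) : ZMod 2) = 1 → False := by decide +kernel
  exact q _ (cd6 _) h1 h2 h3
abbrev PP : Finset E := dl [0,1,2,3]
abbrev QQ : Finset E := dl [0,1,2,3,4]
theorem red21 {T : Finset V} (hg : Good T) (hT : T.card = 21) :
    (∃ B, GP 4 PP B ∧ B.card = 17 ∧ AE T (jn PP B)) ∨ (∃ B, GP 5 QQ B ∧ B.card = 16 ∧ AE T (jn QQ B)) := by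
  obtain ⟨w, A0, B0, hw4, hw8, hA0, hB0, h0, ae0⟩ := normal hg hT
  obtain ⟨m, hm, L, a, hF, hc⟩ := frame (A := A0) (Finset.card_pos.1 (by omega))
  have h := h0.map L a 0
  have ae := ae0.trans (jn_ae A0 B0 L a 0)
  have hA : (A0.image (aff L a)).card = w := by rw [Finset.card_image_of_injective _ (aff_inj _ _), hA0]
  have hB : (B0.image (aff L 0)).card = 21 - w := by rw [Finset.card_image_of_injective _ (aff_inj _ _), hB0]
  generalize A0.image (aff L a) = A at *
  generalize B0.image (aff L 0) = B at *
  clear h0 ae0 hA0 hB0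
  have c1 := Finset.card_le_card (hF.sub hm)
  rw [dl_card (frl_ok m hm).1 (frl_ok m hm).2.1, (frl_ok m hm).2.2, hA] at c1
  have c2 := FR.le_card hc
  rw [lens m hm, hA] at c2
  have hcs : (w, m) ∈ [(4,4),(4,3),(5,3),(5,2),(6,3),(6,2),(6,1),(7,3),(7,2),(7,1),(7,0),(8,3),(8,2),(8,1),(8,0)] := by
    clear hF hc h ae hA hB
    interval_cases m <;> interval_cases w <;> simp at c1 c2 ⊢
  simp only [List.mem_cons, Prod.mk.injEq, List.not_mem_nil, or_false] at hcs
  rcases hcs with ⟨rfl, rfl⟩ | ⟨rfl, rfl⟩ | ⟨rfl, rfl⟩ | ⟨rfl, rfl⟩ | ⟨rfl, rfl⟩ | ⟨rfl, rfl⟩ | ⟨rfl, rfl⟩ | ⟨rfl, rfl⟩ | ⟨rfl, rfl⟩ | ⟨rfl, rfl⟩ | ⟨rfl, rfl⟩ | ⟨rfl, rfl⟩ | ⟨rfl, rfl⟩ | ⟨rfl, rfl⟩ | ⟨rfl, rfl⟩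
  · obtain ⟨x, hx, hx2, hx3, rfl⟩ := hF.eqx hm hA hc
    have q : ∀ x ∈ xs 4, x = 48 := by decide +kernel
    obtain rfl := q x (mem_xs hx hx2 hx3)
    have e : dl (48 :: frl 4) = dl [0,16,32,48] := by
      ext v; rw [mem_dl (dlt (by norm_num) (by norm_num)), mem_dl (by decide)]
      simp [frl, List.range_succ]; tauto
    rw [e] at h ae
    obtain ⟨t, ht, B', g1, g2, g3⟩ := h.any c_p4
    obtain rfl := List.mem_singleton.1 ht
    exact Or.inl ⟨B', g1, g2.trans hB, ae.trans g3⟩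
  · obtain rfl := hF.eq hm hA
    exact (kodd k4 (by norm_num) B h hB).elim
  · obtain ⟨x, hx, hx2, hx3, rfl⟩ := hF.eqx hm hA hc
    obtain ⟨t, ht, B', g1, g2, g3⟩ := h.any (c_5 x (mem_xs hx hx2 hx3))
    obtain rfl := List.mem_singleton.1 ht
    exact Or.inr ⟨B', g1, g2.trans hB, ae.trans g3⟩
  · obtain rfl := hF.eq hm hA
    exact (k5 B h hB (fun h => absurd h (by norm_num))).elim
  · have := rot8 h hc (by omega)
    omega
  · obtain ⟨x, hx, hx2, hx3, rfl⟩ := hF.eqx hm hA hc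
    obtain ⟨t, ht, B', g1, g2, g3⟩ := h.any (c_6 x (mem_xs hx hx2 hx3))
    simp only [List.mem_cons, List.not_mem_nil, or_false] at ht
    rcases ht with rfl | rfl
    · exact (kodd k64 (by norm_num) B' g1 (g2.trans hB)).elim
    · exact (kodd k66 (by norm_num) B' g1 (g2.trans hB)).elim
  · obtain rfl := hF.eq hm hA
    exact (kodd k6 (by norm_num) B h hB).elim
  · exact (vanish7 h hB 3 (by norm_num) hc).elim
  · exact (vanish7 h hB 2 (by norm_num) hc).elim
  · obtain ⟨x, hx, hx2, hx3, rfl⟩ := hF.eqx hm hA hc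
    obtain ⟨t, ht, B', g1, g2, g3⟩ := h.any (c_7 x (mem_xs hx hx2 hx3))
    simp only [List.mem_cons, List.not_mem_nil, or_false] at ht
    rcases ht with rfl | rfl
    · exact (seven (x := 48) (by simp) g1 (g2.trans hB)).elim
    · exact (seven (x := 62) (by simp) g1 (g2.trans hB)).elim
  · obtain rfl := hF.eq hm hA
    obtain ⟨n, hn, h2⟩ := List.any_eq_true.1 (c_7s _ (cd6 (∑ v ∈ B, v)))
    rw [Bool.and_eq_true] at h2
    obtain ⟨B', g1, g2, g3, _⟩ := h.rel h2.1
    exact (k7 _ (List.contains_iff_mem.1 h2.2) B' g1 (g2.trans hB) (fun _ => g3)).elim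
  · exact (vanish8 h hB 3 (by norm_num) hc).elim
  · exact (vanish8 h hB 2 (by norm_num) hc).elim
  · exact (vanish8 h hB 1 (by norm_num) hc).elim
  · obtain ⟨x, hx, hx2, hx3, rfl⟩ := hF.eqx hm hA hc
    rcases bit8 x (mem_xs hx hx2 hx3) with rfl | ⟨j, hj, hj2⟩
    · have e : dl (63 :: frl 0) = dl [0,1,2,4,8,16,32,63] := by
        ext v; rw [mem_dl (dlt (by norm_num) (by norm_num)), mem_dl (by decide)]
        simp [frl, List.range_succ]; tauto
      rw [e] at h
      exact (kodd k8 (by norm_num) B h hB).elim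
    · have hp : 2 ^ j < 64 := Nat.pow_lt_pow_right (by norm_num) hj
      have hk := (cntA_fn (x :: frl 0) (dlt hx hm) (2 ^ j) 1 (by norm_num)).trans hj2
      have h1 := halfB h (2 ^ j) hp (by positivity) _ hk (n := 7) (by omega) 0
      have h2 := halfB h (2 ^ j) hp (by positivity) _ hk (n := 7) (by omega) 1
      have h3 := halfB2 B (2 ^ j)
      omega
theorem jn_erase (A B : Finset E) (q : V) : (jn A B).erase q = if q 6 = 1 then jn (A.erase (ini q)) B else jn A (B.erase (ini q)) := by
  have hq : ∀ v : V, v = q ↔ ini v = ini q ∧ v 6 = q 6 := fun v => ⟨fun h => by rw [h]; exact ⟨rfl, rfl⟩, fun h => sn_ext h.1 h.2⟩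
  have h01 : ∀ x : ZMod 2, x = 0 ∨ x = 1 := zmod2
  split_ifs with h
  · ext v
    rw [Finset.mem_erase, mem_jn, mem_jn, Finset.mem_erase, ne_eq, hq, h]
    rcases zmod2 (v 6) with e | e <;> simp [e]
  · have h := (zmod2 (q 6)).resolve_right h
    ext v
    rw [Finset.mem_erase, mem_jn, mem_jn, Finset.mem_erase, ne_eq, hq, h]
    rcases zmod2 (v 6) with e | e <;> simp [e]
theorem half20 {T : Finset V} (hg : Good T) (hT : T.card = 20) (f : V →ₗ[ZMod 2] ZMod 2) (hf : f ≠ 0) (j : ZMod 2) : 4 ≤ ct f T j := by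
  have h1 := hg.prod f hf
  have h2 := ct_add f T 0
  rw [zero_add, hT] at h2
  have e : ct f T 1 = 20 - ct f T 0 := by omega
  rw [e] at h1
  have q : ∀ x ≤ 20, 64 ≤ x * (20 - x) → 4 ≤ x ∧ 4 ≤ 20 - x := by decide
  have := q (ct f T 0) (by omega) h1
  rcases zmod2 j with rfl | rfl <;> omega
theorem red20 {T : Finset V} (hg : Good T) (hT : T.card = 20) : ∃ B, GP 4 PP B ∧ B.card = 16 ∧ AE T (jn PP B) := by
  obtain ⟨p, hp⟩ : ∃ p, p ∉ T := by
    by_contra hc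
    push Not at hc
    have h1 : T = Finset.univ := Finset.eq_univ_iff_forall.2 hc
    rw [h1] at hT
    have h3 : (Finset.univ : Finset V).card = 128 := by simp [V]
    omega
  have main : ∀ A B, AE (insert p T) (jn A B) → ∃ q ∈ jn A B, Good ((jn A B).erase q) ∧ AE T ((jn A B).erase q) := by
    rintro A B ⟨L, c, e⟩
    have ae : AE T ((jn A B).erase (L p + c)) := by
      refine ⟨L, c, ?_⟩
      rw [e, Finset.image_insert, Finset.erase_insert]
      intro h
      obtain ⟨x, hx, ex⟩ := Finset.mem_image.1 h
      rw [L.injective (add_right_cancel ex)] at hx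
      exact hp hx
    exact ⟨_, by rw [e, Finset.image_insert]; exact Finset.mem_insert_self _ _, hg.ae ae, ae⟩
  have gp : ∀ A B : Finset E, Good (jn A B) → AE T (jn A B) → GP 4 A B := fun A B h1 h2 =>
    gp_of h1 4 (half20 h1 (h2.card.trans hT)) A B rfl
  have cP : PP.card = 4 := dl_card (by decide) (by decide)
  have cQ : QQ.card = 5 := dl_card (by decide) (by decide)
  have hg1 : Good (insert p T) := fun v => by
    obtain ⟨a, ha, b, hb, e⟩ := hg v
    exact ⟨a, Finset.mem_insert_of_mem ha, b, Finset.mem_insert_of_mem hb, e⟩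
  rcases red21 hg1 (by rw [Finset.card_insert_of_notMem hp, hT]) with ⟨B, h, hB, ae⟩ | ⟨B, h, hB, ae⟩
  · obtain ⟨q, hq, g, ae⟩ := main _ _ ae
    rw [mem_jn] at hq
    rw [jn_erase] at g ae
    rcases hq with ⟨h6, hq⟩ | ⟨h6, hq⟩
    · rw [if_pos h6] at g ae
      have gg := gp _ _ g ae
      have c := half20 g (ae.card.trans hT) (LinearMap.proj 6) (fun h => absurd (LinearMap.congr_fun h (sn 0 1)) (by rw [LinearMap.proj_apply, sn_last, LinearMap.zero_apply]; decide)) 1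
      exfalso
      have e : ((jn (PP.erase (ini q)) B).filter (fun v => (LinearMap.proj 6 : V →ₗ[ZMod 2] ZMod 2) v = 1)).card ≤ 3 := by
        have e2 : ((jn (PP.erase (ini q)) B).filter (fun v => (LinearMap.proj 6 : V →ₗ[ZMod 2] ZMod 2) v = 1)) ⊆ (PP.erase (ini q)).image (fun x => sn x 1) := by
          intro v hv
          rw [Finset.mem_filter, mem_jn, LinearMap.proj_apply] at hv
          rcases hv with ⟨⟨_, h⟩ | ⟨h, _⟩, h1⟩
          · exact Finset.mem_image.2 ⟨_, h, by rw [← h1, sn_ini]⟩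
          · rw [h] at h1; exact absurd h1 (by decide)
        refine (Finset.card_le_card e2).trans (Finset.card_image_le.trans ?_)
        rw [Finset.card_erase_of_mem hq, cP]
      exact absurd (c.trans e) (by norm_num)
    · rw [if_neg (by rw [h6]; decide)] at g ae
      exact ⟨_, gp _ _ g ae, by rw [Finset.card_erase_of_mem hq, hB], ae⟩
  · obtain ⟨q, hq, g, ae⟩ := main _ _ ae
    rw [mem_jn] at hq
    rw [jn_erase] at g ae
    rcases hq with ⟨h6, hq⟩ | ⟨h6, hq⟩
    · rw [if_pos h6] at g ae
      rw [mem_dl (by decide)] at hq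
      have e : QQ.erase (ini q) = dl ([0,1,2,3,4].erase (cd (ini q))) := by
        ext v
        rw [Finset.mem_erase, mem_dl (by decide), mem_dl (fun x hx => by have := List.mem_of_mem_erase hx; simp at this; omega), List.Nodup.mem_erase_iff (by decide), ne_eq, ne_eq, cd_bij]
      rw [e] at g ae
      by_cases h4 : cd (ini q) = 4
      · rw [h4] at g ae
        exact ⟨B, gp _ _ g ae, hB, ae⟩
      · exfalso
        have hlt : cd (ini q) < 4 := by simp at hq; omega
        obtain ⟨t, ht, B', g1, g2, g3⟩ := (gp _ _ g ae).any (c_20 _ hlt)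
        obtain rfl := List.mem_singleton.1 ht
        exact k20 B' g1 (g2.trans hB) (fun h => absurd h (by norm_num))
    · rw [if_neg (by rw [h6]; decide)] at g ae
      exfalso
      have := (slice_eq (gp _ _ g ae) (fun v hv => by rw [mem_dl (by decide)] at hv; simp at hv; omega) (by omega)).1
      rw [Finset.card_erase_of_mem hq, hB] at this
      omega
/-! ### graphs of functions -/
def bt (t y : ℕ) : ℕ := Nat.land (Nat.shiftRight t y) 1
theorem bt_eq (t y : ℕ) : bt t y = (t.testBit y).toNat := by
  rw [Nat.toNat_testBit, ← Nat.shiftRight_eq_div_pow, ← Nat.and_one_is_mod]; rfl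
theorem bt_lt (t y : ℕ) : bt t y < 2 := by rw [bt_eq]; cases t.testBit y <;> decide
theorem bt_xor (s t y : ℕ) : bt (s ^^^ t) y = (bt s y + bt t y) % 2 := by
  simp only [bt_eq, Nat.testBit_xor]; cases s.testBit y <;> cases t.testBit y <;> decide
def pt (t1 t2 y : ℕ) : ℕ := 4 * y + bt t1 y + 2 * bt t2 y
theorem pt_lt (t1 t2 : ℕ) {y : ℕ} (hy : y < 16) : pt t1 t2 y < 64 := by
  have := bt_lt t1 y; have := bt_lt t2 y; unfold pt; omega
def gset (t1 t2 : ℕ) : Finset E := (Finset.range 16).image (fun y => dec 6 (pt t1 t2 y))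
theorem dec_inj {x y : ℕ} (hx : x < 64) (hy : y < 64) (h : dec 6 x = dec 6 y) : x = y := by
  rw [← cd_dec (n := 6) (x := x) (by exact hx), h, cd_dec (by exact hy)]
theorem gset_card (t1 t2 : ℕ) : (gset t1 t2).card = 16 := by
  unfold gset
  rw [Finset.card_image_of_injOn, Finset.card_range]
  intro a ha b hb h
  have ha := Finset.mem_range.1 ha
  have hb := Finset.mem_range.1 hb
  have := dec_inj (pt_lt _ _ ha) (pt_lt _ _ hb) h
  have := bt_lt t1 a; have := bt_lt t2 a; have := bt_lt t1 b; have := bt_lt t2 b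
  unfold pt at *; omega
def HH (n : ℕ) (B : Finset E) : Prop := ∃ c0 : E, (n = 0 → c0 = 0) ∧ ∀ d, d ∉ PP → d + c0 ∉ PP → ∃ b ∈ B, ∃ b' ∈ B, b + b' = d
def KK (n : ℕ) (ex : Finset E) (R : Finset V) (t1 t2 : ℕ) : Prop := AE R (jn PP (ex ∪ gset t1 t2)) ∧ HH n (ex ∪ gset t1 t2)
theorem HH.back {n : ℕ} {B B' : Finset E} (L : E ≃ₗ[ZMod 2] E) (a : E) (hL : PP.image (aff L 0) = PP) (hB : B'.image (aff L a) = B) (h : HH n B) : HH n B' := by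
  obtain ⟨c0, h0, h1⟩ := h
  have mem : ∀ d, L d ∈ PP → d ∈ PP := by
    intro d hd
    rw [← hL] at hd
    obtain ⟨x, hx, e⟩ := Finset.mem_image.1 hd
    simp only [aff, add_zero] at e
    rwa [L.injective e] at hx
  refine ⟨L.symm c0, fun e => by rw [h0 e, map_zero], fun d hd hd' => ?_⟩
  obtain ⟨b, hb, b', hb', e⟩ := h1 (L d) (fun h => hd (mem _ h)) (fun h => hd' (mem _ (by rwa [map_add, LinearEquiv.apply_symm_apply])))
  rw [← hB] at hb hb'
  obtain ⟨x, hx, rfl⟩ := Finset.mem_image.1 hb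
  obtain ⟨x', hx', rfl⟩ := Finset.mem_image.1 hb'
  refine ⟨x, hx, x', hx', L.injective ?_⟩
  rw [map_add, ← e]
  simp only [aff]
  rw [add_add_add_comm, add_self2, add_zero]
/-- columns of a move -/
def mvOK (cs ds : List ℕ) : Bool := mapOK [0,1,2,3] [0,1,2,3] (cs, ds, 0)
theorem mvOK_PP {cs ds : List ℕ} (hm : mvOK cs ds = true) : ∃ hi : invOK 6 cs ds = true, PP.image (aff (linE 6 cs ds hi) 0) = PP := by
  have h := mapOK_dl (g := (cs, ds, 0)) hm
  unfold PP
  generalize dl [0,1,2,3] = Q at h ⊢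
  obtain ⟨hi, e⟩ := h
  refine ⟨hi, ?_⟩
  rw [← dec_zero 6]
  exact e
theorem KK.move {n : ℕ} {ex : Finset E} {R : Finset V} {t1 t2 s1 s2 : ℕ} (h : KK n ex R t1 t2) (cs ds : List ℕ) (a : ℕ) (hm : mvOK cs ds = true)
    (hex : ∀ hi : invOK 6 cs ds = true, ex.image (aff (linE 6 cs ds hi) (dec 6 a)) = ex)
    (hp : ∀ y < 16, ∃ y' < 16, app cs (pt s1 s2 y) ^^^ a = pt t1 t2 y') : KK n ex R s1 s2 := by
  obtain ⟨hi, e⟩ := mvOK_PP hm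
  have hB : (ex ∪ gset s1 s2).image (aff (linE 6 cs ds hi) (dec 6 a)) = ex ∪ gset t1 t2 := by
    suffices hg : (gset s1 s2).image (aff (linE 6 cs ds hi) (dec 6 a)) = gset t1 t2 by rw [Finset.image_union, hex hi, hg]
    refine Finset.eq_of_subset_of_card_le ?_ (by rw [Finset.card_image_of_injective _ (aff_inj _ _), gset_card, gset_card])
    intro v hv
    unfold gset at hv
    rw [Finset.image_image] at hv
    obtain ⟨y, hy, rfl⟩ := Finset.mem_image.1 hv
    have hy := Finset.mem_range.1 hy
    obtain ⟨y', hy', e⟩ := hp y hy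
    refine Finset.mem_image.2 ⟨y', Finset.mem_range.2 hy', ?_⟩
    rw [← e, dec_xor]
    simp only [Function.comp, aff]
    rw [linE_dec hi (pt_lt _ _ hy)]
  refine ⟨h.1.trans ?_, h.2.back _ _ e hB⟩
  have := jn_ae PP (ex ∪ gset s1 s2) (linE 6 cs ds hi) 0 (dec 6 a)
  rw [e, hB] at this
  exact this.symm
/-! elementary moves -/
theorem ex_empty (L : E ≃ₗ[ZMod 2] E) (a : E) : (∅ : Finset E).image (aff L a) = ∅ := Finset.image_empty _
/-- admissible extra sets -/
def EX (ex : Finset E) : Prop := ex = ∅ ∨ ex = {dec 6 2}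
theorem EX.im {ex : Finset E} (h : EX ex) {cs ds : List ℕ} (hi : invOK 6 cs ds = true) (h2 : app cs 2 = 2) : ex.image (aff (linE 6 cs ds hi) (dec 6 0)) = ex := by
  rcases h with rfl | rfl
  · rfl
  · rw [Finset.image_singleton, aff, linE_dec hi (by norm_num), h2, dec_zero, add_zero]
/-- bit pairs -/
theorem pt_dec (s1 s2 y : ℕ) (P : ℕ → Prop) (h : ∀ u < 2, ∀ v < 2, u = bt s1 y → v = bt s2 y → P (4 * y + u + 2 * v)) : P (pt s1 s2 y) :=
  h _ (bt_lt _ _) _ (bt_lt _ _) rfl rfl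
def shOK (cs ds : List ℕ) (a m1 m2 : ℕ) : Bool := mvOK cs ds && Nat.beq (app cs 2) 2 && (List.range 16).all (fun y => (List.range 2).all (fun u => (List.range 2).all (fun v =>
  Nat.beq (Nat.xor (app cs (4 * y + u + 2 * v)) a) (4 * y + (u + bt m1 y) % 2 + 2 * ((v + bt m2 y) % 2)))))
theorem KK.shear {n : ℕ} {ex : Finset E} {R : Finset V} {t1 t2 : ℕ} (h : KK n ex R t1 t2) (cs ds : List ℕ) (a m1 m2 : ℕ)
    (hex : (a = 0 ∧ EX ex) ∨ ex = ∅) (hm : shOK cs ds a m1 m2 = true) : KK n ex R (t1 ^^^ m1) (t2 ^^^ m2) := by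
  simp only [shOK, Bool.and_eq_true, List.all_eq_true, List.mem_range] at hm
  refine h.move cs ds a hm.1.1 (fun hi => ?_) (fun y hy => ⟨y, hy, ?_⟩)
  · rcases hex with ⟨rfl, h⟩ | rfl
    · exact h.im hi (Nat.eq_of_beq_eq_true hm.1.2)
    · rfl
  · have := Nat.eq_of_beq_eq_true (hm.2 y hy _ (bt_lt (t1 ^^^ m1) y) _ (bt_lt (t2 ^^^ m2) y))
    change app cs (pt (t1 ^^^ m1) (t2 ^^^ m2) y) ^^^ a = _ at this
    rw [this, bt_xor, bt_xor, pt]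
    have := bt_lt t1 y; have := bt_lt t2 y; have := bt_lt m1 y; have := bt_lt m2 y
    omega
def cx (t y m : ℕ) : ℕ := Nat.xor t (Nat.mul (bt t y) m)
def nrm (t : ℕ) : ℕ := cx (cx (cx (cx t 1 0xAAAA) 2 0xCCCC) 4 0xF0F0) 8 0xFF00
theorem cx_ind (P : ℕ → Prop) (m : ℕ) (h : ∀ t, P t → P (t ^^^ m)) (t y : ℕ) (ht : P t) : P (cx t y m) := by
  unfold cx
  have : bt t y = 0 ∨ bt t y = 1 := by have := bt_lt t y; omega
  rcases this with e | e <;> rw [e]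
  · rw [show Nat.mul 0 m = 0 from Nat.zero_mul m, show Nat.xor t 0 = t ^^^ 0 from rfl, Nat.xor_zero]; exact ht
  · rw [show Nat.mul 1 m = m from Nat.one_mul m]; exact h t ht
def l1 (i v : ℕ) : List ℕ := (List.range 6).map (fun j => if j = i + 2 then 2 ^ j + v else 2 ^ j)
theorem sh_ok : ∀ i < 4, shOK (l1 i 1) (l1 i 1) 0 ([0xAAAA, 0xCCCC, 0xF0F0, 0xFF00].getD i 0) 0 = true ∧ shOK (l1 i 2) (l1 i 2) 0 0 ([0xAAAA, 0xCCCC, 0xF0F0, 0xFF00].getD i 0) = true := by decide +kernel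
theorem KK.nrm1 {n : ℕ} {ex : Finset E} (hex : EX ex) {R : Finset V} {t1 t2 : ℕ} (h : KK n ex R t1 t2) : KK n ex R (nrm t1) t2 := by
  have step : ∀ i < 4, ∀ y t, KK n ex R t t2 → KK n ex R (cx t y ([0xAAAA, 0xCCCC, 0xF0F0, 0xFF00].getD i 0)) t2 := fun i hi y t h =>
    cx_ind (fun t => KK n ex R t t2) _ (fun t h => by simpa using h.shear _ _ 0 _ 0 (Or.inl ⟨rfl, hex⟩) (sh_ok i hi).1) t y h
  exact step 3 (by norm_num) 8 _ (step 2 (by norm_num) 4 _ (step 1 (by norm_num) 2 _ (step 0 (by norm_num) 1 _ h)))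
theorem KK.nrm2 {n : ℕ} {ex : Finset E} (hex : EX ex) {R : Finset V} {t1 t2 : ℕ} (h : KK n ex R t1 t2) : KK n ex R t1 (nrm t2) := by
  have step : ∀ i < 4, ∀ y t, KK n ex R t1 t → KK n ex R t1 (cx t y ([0xAAAA, 0xCCCC, 0xF0F0, 0xFF00].getD i 0)) := fun i hi y t h =>
    cx_ind (fun t => KK n ex R t1 t) _ (fun t h => by simpa using h.shear _ _ 0 0 _ (Or.inl ⟨rfl, hex⟩) (sh_ok i hi).2) t y h
  exact step 3 (by norm_num) 8 _ (step 2 (by norm_num) 4 _ (step 1 (by norm_num) 2 _ (step 0 (by norm_num) 1 _ h)))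
/-- adding t1 to t2 -/
theorem KK.addt {n : ℕ} {ex : Finset E} (hex : EX ex) {R : Finset V} {t1 t2 : ℕ} (h : KK n ex R t1 t2) : KK n ex R t1 (t2 ^^^ t1) := by
  refine h.move [3,2,4,8,16,32] [3,2,4,8,16,32] 0 (by decide +kernel) (fun hi => hex.im hi (by decide)) (fun y hy => ⟨y, hy, ?_⟩)
  have q : ∀ y < 16, ∀ u < 2, ∀ v < 2, app [3,2,4,8,16,32] (4 * y + u + 2 * v) = 4 * y + u + 2 * ((u + v) % 2) := by decide +kernel
  rw [pt, q y hy _ (bt_lt _ _) _ (bt_lt _ _), bt_xor, Nat.xor_zero, pt]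
  have := bt_lt t1 y; have := bt_lt t2 y
  omega
/-- permutations -/
def tr (s : List ℕ) (t : ℕ) : ℕ := List.rec 0 (fun x _ ih => Nat.add (bt t x) (Nat.mul 2 ih)) s
theorem tr_bt (t : ℕ) : ∀ (s : List ℕ) (y : ℕ) (h : y < s.length), bt (tr s t) y = bt t s[y] := by
  intro s
  induction s with
  | nil => intro y h; simp at h
  | cons x s ih =>
    intro y h
    have e : tr (x :: s) t = bt t x + 2 * tr s t := rfl
    have := bt_lt t x
    rcases y with _ | y
    · rw [e, bt_eq _ 0, Nat.toNat_testBit]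
      simp only [List.getElem_cons_zero]; omega
    · rw [e, bt_eq _ (y+1), Nat.testBit_succ, show (bt t x + 2 * tr s t) / 2 = tr s t by omega, ← bt_eq]
      simpa using ih y (by simpa using h)
def sC (s : List ℕ) : List ℕ := [1, 2, 4 * s.getD 1 0, 4 * s.getD 2 0, 4 * s.getD 4 0, 4 * s.getD 8 0]
def sD (s : List ℕ) : List ℕ := [1, 2, 4 * s.idxOf 1, 4 * s.idxOf 2, 4 * s.idxOf 4, 4 * s.idxOf 8]
def sOK (s : List ℕ) : Bool := mvOK (sC s) (sD s) && Nat.beq s.length 16 && Nat.beq (app (sC s) 2) 2 && (List.range 16).all (fun y => Nat.blt (s.getD y 0) 16 && (List.range 2).all (fun u => (List.range 2).all (fun v =>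
  Nat.beq (app (sC s) (4 * y + u + 2 * v)) (4 * s.getD y 0 + u + 2 * v))))
theorem KK.perm {n : ℕ} {ex : Finset E} (hex : EX ex) {R : Finset V} {t1 t2 : ℕ} (h : KK n ex R t1 t2) (s : List ℕ) (hs : sOK s = true) : KK n ex R (tr s t1) (tr s t2) := by
  simp only [sOK, Bool.and_eq_true, List.all_eq_true, List.mem_range] at hs
  obtain ⟨⟨⟨h1, h2⟩, h3⟩, h4⟩ := hs
  have h2 := Nat.eq_of_beq_eq_true h2
  refine h.move _ _ 0 h1 (fun hi => hex.im hi (Nat.eq_of_beq_eq_true h3)) (fun y hy => ⟨s.getD y 0, blt_lt (h4 y hy).1, ?_⟩)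
  rw [pt, Nat.eq_of_beq_eq_true ((h4 y hy).2 _ (bt_lt _ _) _ (bt_lt _ _)), Nat.xor_zero, tr_bt _ _ _ (by omega), tr_bt _ _ _ (by omega), pt,
    List.getD_eq_getElem _ _ (by omega)]
/-- flip -/
theorem KK.flip {n : ℕ} {R : Finset V} {t1 t2 : ℕ} (h1 : bt t1 0 = 0) (h2 : bt t2 0 = 0) (h : KK n {dec 6 2} R t1 t2) : KK n {dec 6 2} R t1 (t2 ^^^ 0xFFFE) := by
  have e : ({dec 6 2} ∪ gset t1 (t2 ^^^ 0xFFFE)).image (aff (LinearEquiv.refl (ZMod 2) E) (dec 6 2)) = {dec 6 2} ∪ gset t1 t2 := by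
    have hpt : ∀ y < 16, y ≠ 0 → dec 6 (pt t1 (t2 ^^^ 0xFFFE) y) + dec 6 2 = dec 6 (pt t1 t2 y) := by
      intro y hy hy0
      rw [← dec_xor]
      congr 1
      have q : ∀ y < 16, ∀ u < 2, ∀ v < 2, (4 * y + u + 2 * ((v + 1) % 2)) ^^^ 2 = 4 * y + u + 2 * v := by decide +kernel
      have q2 : ∀ y < 16, y ≠ 0 → bt 0xFFFE y = 1 := by decide
      rw [pt, bt_xor, q2 y hy hy0, q y hy _ (bt_lt _ _) _ (bt_lt _ _), pt]
    have e0 : pt t1 t2 0 = 0 := by rw [pt, h1, h2]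
    have e1 : pt t1 (t2 ^^^ 0xFFFE) 0 = 0 := by rw [pt, h1, bt_xor, h2]; rfl
    ext v
    simp only [Finset.mem_image, Finset.mem_union, Finset.mem_singleton, gset, Finset.mem_range, aff, LinearEquiv.refl_apply]
    constructor
    · rintro ⟨_, rfl | ⟨y, hy, rfl⟩, rfl⟩
      · right; exact ⟨0, by norm_num, by rw [e0, dec_zero, add_self2]⟩
      · by_cases hy0 : y = 0
        · subst hy0; left; rw [e1, dec_zero, zero_add]
        · right; exact ⟨y, hy, (hpt y hy hy0).symm⟩
    · rintro (rfl | ⟨y, hy, rfl⟩)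
      · exact ⟨_, Or.inr ⟨0, by norm_num, rfl⟩, by rw [e1, dec_zero, zero_add]⟩
      · by_cases hy0 : y = 0
        · subst hy0; exact ⟨_, Or.inl rfl, by rw [e0, dec_zero, add_self2]⟩
        · exact ⟨_, Or.inr ⟨y, hy, rfl⟩, hpt y hy hy0⟩
  have e2 : PP.image (aff (LinearEquiv.refl (ZMod 2) E) 0) = PP := by
    conv_rhs => rw [← Finset.image_id (s := PP)]
    congr 1; funext x; simp [aff]
  refine ⟨h.1.trans ?_, h.2.back _ _ e2 e⟩
  have := jn_ae PP ({dec 6 2} ∪ gset t1 (t2 ^^^ 0xFFFE)) (LinearEquiv.refl (ZMod 2) E) 0 (dec 6 2)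
  rw [e, e2] at this
  exact this.symm
/-! ### condition check -/
noncomputable section
def sw (d m t : ℕ) : ℕ := Nat.lor (Nat.shiftLeft (Nat.land t m) d) (Nat.land (Nat.shiftRight t d) m)
def okc (M x z : ℕ) : Bool :=
  force (Nat.land x z) (fun a => Bool.rec (Bool.rec (Bool.rec (Bool.rec true false (Nat.beq (Nat.lor x z) M)) false (Nat.beq a z)) false (Nat.beq a x)) false (Nat.beq a 0))
def ok (e x z : ℕ) : Bool :=
  force (Nat.add (Nat.mul 2 x) (Nat.mod x 2)) (fun x' => force (Nat.add (Nat.mul 2 z) (Nat.mod (Nat.add z e) 2)) (fun z' => okc 0x1FFFF x' z'))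
def okx (x : ℕ) : Bool := Bool.rec true false (Nat.beq x 0)
def walk (f : ℕ → ℕ → Bool) (t1 t2 : ℕ) (ks : List (ℕ × ℕ)) : ℕ → ℕ → ℕ → Bool :=
  List.rec (fun _ _ _ => true) (fun k _ ih n s1 s2 =>
    force (sw k.1 k.2 s1) (fun s1 => force (sw k.1 k.2 s2) (fun s2 =>
    force (Nat.xor t1 s1) (fun x => force (Nat.xor t2 s2) (fun z =>
      Bool.rec (Nat.rec false (fun m _ => ih m s1 s2) n) (ih n s1 s2) (f x z)))))) ks
def K1 : ℕ × ℕ := (1, 0x5555)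
def K2 : ℕ × ℕ := (2, 0x3333)
def K4 : ℕ × ℕ := (4, 0x0F0F)
def K8 : ℕ × ℕ := (8, 0x00FF)
def KS : List (ℕ × ℕ) := [K1,K2,K1,K4,K1,K2,K1,K8,K1,K2,K1,K4,K1,K2,K1]
def chk (n e t1 t2 : ℕ) : Bool := walk (ok e) t1 t2 KS n t1 t2
def chkx (n t1 : ℕ) : Bool := walk (fun x _ => okx x) t1 0 KS n t1 0
end
theorem okc_t {M x z : ℕ} (h0 : x &&& z ≠ 0) (h1 : x &&& z ≠ x) (h2 : x &&& z ≠ z) (h3 : x ||| z ≠ M) : okc M x z = true := by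
  have b : ∀ {a b : ℕ}, a ≠ b → Nat.beq a b = false := fun h => by
    rw [Bool.eq_false_iff]; exact fun h' => h (Nat.eq_of_beq_eq_true h')
  unfold okc
  change (Bool.rec (Bool.rec (Bool.rec (Bool.rec true false (Nat.beq (x ||| z) M)) false (Nat.beq (x &&& z) z)) false (Nat.beq (x &&& z) x)) false (Nat.beq (x &&& z) 0) : Bool) = true
  rw [b h0, b h1, b h2, b h3]
/-- shifted tables -/
def Sh (c s t : ℕ) : Prop := ∀ y < 16, bt s y = bt t (y ^^^ c)
theorem sw_bt {k : ℕ × ℕ} (hk : k ∈ [K1, K2, K4, K8]) (t y : ℕ) (hy : y < 16) : bt (sw k.1 k.2 t) y = bt t (y ^^^ k.1) := by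
  have q : ∀ k ∈ [K1, K2, K4, K8], ∀ y < 16, (y &&& k.1 = 0 ∧ k.2.testBit y = true ∧ y ^^^ k.1 = k.1 + y ∧ (k.1 ≤ y → k.2.testBit (y - k.1) = false)) ∨ (k.1 ≤ y ∧ k.2.testBit y = false ∧ y ^^^ k.1 = y - k.1 ∧ k.2.testBit (y - k.1) = true) := by decide
  rw [bt_eq, bt_eq]
  congr 1
  change (((t &&& k.2) <<< k.1) ||| ((t >>> k.1) &&& k.2)).testBit y = _
  rw [Nat.testBit_or, Nat.testBit_shiftLeft, Nat.testBit_and, Nat.testBit_and, Nat.testBit_shiftRight]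
  rcases q k hk y hy with ⟨_, h2, h3, h4⟩ | ⟨h1, h2, h3, h4⟩
  · rw [h2, h3]
    by_cases h : k.1 ≤ y
    · rw [h4 h]; simp
    · simp [h]
  · rw [h2, h3, h4]; simp [h1]
theorem Sh.ex : ∀ c < 16, ∀ t, ∃ s, Sh c s t := by
  intro c hc t
  refine ⟨tr ((List.range 16).map (fun y => y ^^^ c)) t, fun y hy => ?_⟩
  rw [tr_bt _ _ _ (by simpa using hy)]
  simp
def vis (ks : List (ℕ × ℕ)) (c : ℕ) : List ℕ := List.rec (fun _ => []) (fun k _ ih c => (c ^^^ k.1) :: ih (c ^^^ k.1)) ks c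
theorem walk_t {f : ℕ → ℕ → Bool} {t1 t2 : ℕ} (cb : ℕ) (h : ∀ c < 16, c ≠ 0 → c ≠ cb → ∀ s1 s2, Sh c s1 t1 → Sh c s2 t2 → f (t1 ^^^ s1) (t2 ^^^ s2) = true) :
    ∀ (ks : List (ℕ × ℕ)) (n c s1 s2 : ℕ), c < 16 → (∀ k ∈ ks, k ∈ [K1, K2, K4, K8]) → (vis ks c).count cb ≤ n → 0 ∉ vis ks c → Sh c s1 t1 → Sh c s2 t2 → walk f t1 t2 ks n s1 s2 = true := by
  intro ks
  induction ks with
  | nil => intros; rfl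
  | cons k ks ih =>
    intro n c s1 s2 hc hk hn h0 h1 h2
    have hkk := hk k (by simp)
    have hk16 : k.1 < 16 := by
      have : ∀ k ∈ [K1, K2, K4, K8], k.1 < 16 := by decide
      exact this k hkk
    have ev : vis (k :: ks) c = (c ^^^ k.1) :: vis ks (c ^^^ k.1) := rfl
    rw [ev] at hn h0
    have hc' : c ^^^ k.1 < 16 := Nat.xor_lt_two_pow (n := 4) hc hk16
    have sh : ∀ {s t}, Sh c s t → Sh (c ^^^ k.1) (sw k.1 k.2 s) t := by
      intro s t hs y hy
      rw [sw_bt hkk _ _ hy, hs _ (Nat.xor_lt_two_pow (n := 4) hy hk16), Nat.xor_assoc, Nat.xor_comm k.1 c]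
    have hr : ∀ m, (vis ks (c ^^^ k.1)).count cb ≤ m → walk f t1 t2 ks m (sw k.1 k.2 s1) (sw k.1 k.2 s2) = true := fun m hm =>
      ih m _ _ _ hc' (fun k hk' => hk k (by simp [hk'])) hm (fun h => h0 (by simp [h])) (sh h1) (sh h2)
    change (Bool.rec (Nat.rec false (fun m _ => walk f t1 t2 ks m (sw k.1 k.2 s1) (sw k.1 k.2 s2)) n) (walk f t1 t2 ks n (sw k.1 k.2 s1) (sw k.1 k.2 s2)) (f (t1 ^^^ sw k.1 k.2 s1) (t2 ^^^ sw k.1 k.2 s2)) : Bool) = true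
    by_cases hb : c ^^^ k.1 = cb
    · rw [List.count_cons, hb] at hn
      simp only [beq_self_eq_true, if_true] at hn
      rw [← hb] at hn
      rcases n with _ | n
      · omega
      · cases f (t1 ^^^ sw k.1 k.2 s1) (t2 ^^^ sw k.1 k.2 s2)
        · exact hr n (by rw [hb] at hn ⊢; omega)
        · exact hr (n + 1) (by rw [hb] at hn ⊢; omega)
    · rw [h _ hc' (fun e => h0 (by simp [e])) hb _ _ (sh h1) (sh h2)]
      refine hr n ?_
      rw [List.count_cons] at hn
      omega
theorem ok_t (e x z : ℕ) (h : ∀ u < 4, (∃ y, bt x y = u % 2 ∧ bt z y = u / 2 ∧ y < 16) ∨ (bt x 0 = u % 2 ∧ (bt z 0 + e) % 2 = u / 2)) : ok e x z = true := by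
  have key : ∀ u < 4, ∃ y < 17, bt (2 * x + x % 2) y = u % 2 ∧ bt (2 * z + (z + e) % 2) y = u / 2 := by
    intro u hu
    have e0 : ∀ w, bt w 0 = w % 2 := fun w => by rw [bt_eq, Nat.toNat_testBit]; simp
    have es : ∀ w r y, r < 2 → bt (2 * w + r) (y + 1) = bt w y := fun w r y hr => by
      rw [bt_eq, Nat.testBit_succ, show (2 * w + r) / 2 = w by omega, ← bt_eq]
    rcases h u hu with ⟨y, h1, h2, hy⟩ | ⟨h1, h2⟩
    · exact ⟨y + 1, by omega, by rw [es _ _ _ (Nat.mod_lt _ (by norm_num)), h1], by rw [es _ _ _ (Nat.mod_lt _ (by norm_num)), h2]⟩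
    · refine ⟨0, by omega, ?_, ?_⟩
      · rw [e0] at h1 ⊢; omega
      · rw [e0] at h2 ⊢; omega
  change okc 0x1FFFF (2 * x + x % 2) (2 * z + (z + e) % 2) = true
  generalize 2 * x + x % 2 = X at key
  generalize 2 * z + (z + e) % 2 = Z at key
  have g : ∀ w y, (bt w y = 1 ↔ w.testBit y = true) ∧ (bt w y = 0 ↔ w.testBit y = false) := fun w y => by
    rw [bt_eq]; cases w.testBit y <;> decide
  obtain ⟨y0, l0, a0, b0⟩ := key 0 (by norm_num)
  obtain ⟨y1, l1, a1, b1⟩ := key 1 (by norm_num)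
  obtain ⟨y2, l2, a2, b2⟩ := key 2 (by norm_num)
  obtain ⟨y3, l3, a3, b3⟩ := key 3 (by norm_num)
  have a0 := (g _ _).2.1 a0; have b0 := (g _ _).2.1 b0
  have a1 := (g _ _).1.1 a1; have b1 := (g _ _).2.1 b1
  have a2 := (g _ _).2.1 a2; have b2 := (g _ _).1.1 b2
  have a3 := (g _ _).1.1 a3; have b3 := (g _ _).1.1 b3
  refine okc_t ?_ ?_ ?_ ?_ <;> intro hh
  · have := congrArg (fun w => Nat.testBit w y3) hh
    simp [a3, b3] at this
  · have := congrArg (fun w => Nat.testBit w y1) hh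
    simp [a1, b1] at this
  · have := congrArg (fun w => Nat.testBit w y2) hh
    simp [a2, b2] at this
  · have := congrArg (fun w => Nat.testBit w y0) hh
    have q : ∀ y < 17, Nat.testBit 0x1FFFF y = true := by decide
    simp only [Nat.testBit_or, a0, b0, q y0 l0] at this
    simp at this
theorem ok_okx {e x z : ℕ} (h : ok e x z = true) : okx x = true := by
  change (Bool.rec true false (Nat.beq x 0) : Bool) = true
  change (Bool.rec (Bool.rec (Bool.rec (Bool.rec true false (Nat.beq ((2 * x + x % 2) ||| (2 * z + (z + e) % 2)) 0x1FFFF)) false (Nat.beq ((2 * x + x % 2) &&& (2 * z + (z + e) % 2)) (2 * z + (z + e) % 2))) false (Nat.beq ((2 * x + x % 2) &&& (2 * z + (z + e) % 2)) (2 * x + x % 2))) false (Nat.beq ((2 * x + x % 2) &&& (2 * z + (z + e) % 2)) 0) : Bool) = true at h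
  generalize 2 * z + (z + e) % 2 = Z at h
  by_cases h0 : x = 0
  · subst h0; simp at h
  · have b : ∀ {a b : ℕ}, a ≠ b → Nat.beq a b = false := fun h => by
      rw [Bool.eq_false_iff]; exact fun h' => h (Nat.eq_of_beq_eq_true h')
    rw [b h0]
/-! from HH to the check -/
def exs (e : ℕ) : Finset E := if e = 0 then ∅ else {dec 6 2}
theorem exs_EX (e : ℕ) : EX (exs e) := by unfold exs EX; split <;> simp
theorem mem_PP {v : E} : v ∈ PP ↔ cd v < 4 := by
  rw [mem_dl (by decide)]
  have : ∀ x, x ∈ [0,1,2,3] ↔ x < 4 := fun x => by simp; omega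
  exact this _
theorem xor4 : ∀ y < 16, ∀ y' < 16, ∀ p < 4, ∀ p' < 4, (4 * y + p) ^^^ (4 * y' + p') = 4 * (y ^^^ y') + (p ^^^ p') := by decide +kernel
theorem xor2 : ∀ u < 2, ∀ v < 2, ∀ u' < 2, ∀ v' < 2, (u + 2 * v) ^^^ (u' + 2 * v') = (u + u') % 2 + 2 * ((v + v') % 2) := by decide
theorem pt_xor (t1 t2 : ℕ) {y y' : ℕ} (hy : y < 16) (hy' : y' < 16) : pt t1 t2 y ^^^ pt t1 t2 y' = 4 * (y ^^^ y') + ((bt t1 y + bt t1 y') % 2 + 2 * ((bt t2 y + bt t2 y') % 2)) := by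
  have a1 := bt_lt t1 y; have a2 := bt_lt t2 y; have a3 := bt_lt t1 y'; have a4 := bt_lt t2 y'
  rw [pt, pt, add_assoc, add_assoc, xor4 _ hy _ hy' _ (by omega) _ (by omega), xor2 _ a1 _ a2 _ a3 _ a4]
theorem HH.chk {n e t1 t2 : ℕ} (hn : n < 2) (he : e < 2) (h1 : bt t1 0 = 0) (h2 : bt t2 0 = 0) (h : HH n (exs e ∪ gset t1 t2)) : chk n e t1 t2 = true ∧ chkx n t1 = true := by
  obtain ⟨c0, hc0, h⟩ := h
  have vk : (vis KS 0).Nodup ∧ 0 ∉ vis KS 0 ∧ ∀ k ∈ KS, k ∈ [K1, K2, K4, K8] := by decide +kernel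
  have hct : (vis KS 0).count (cd c0 / 4) ≤ n := by
    rcases Nat.eq_zero_or_pos n with rfl | hp
    · rw [hc0 rfl, cd_zero]; exact (List.count_eq_zero.2 vk.2.1).le
    · have := List.nodup_iff_count_le_one.1 vk.1 (cd c0 / 4)
      omega
  suffices hall : ∀ c < 16, c ≠ 0 → c ≠ cd c0 / 4 → ∀ s1 s2, Sh c s1 t1 → Sh c s2 t2 → ok e (t1 ^^^ s1) (t2 ^^^ s2) = true by
    refine ⟨walk_t (cd c0 / 4) hall KS n 0 t1 t2 (by norm_num) vk.2.2 hct vk.2.1 (fun y _ => by rw [Nat.xor_zero]) (fun y _ => by rw [Nat.xor_zero]),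
      walk_t (cd c0 / 4) ?_ KS n 0 t1 0 (by norm_num) vk.2.2 hct vk.2.1 (fun y _ => by rw [Nat.xor_zero]) (fun y _ => by rw [Nat.xor_zero])⟩
    intro c hc hcz hcb s1 _ hs1 _
    obtain ⟨s2, hs2⟩ := Sh.ex c hc t2
    exact ok_okx (hall c hc hcz hcb s1 s2 hs1 hs2)
  intro c hc hcz hcb s1 s2 hs1 hs2
  apply ok_t
  intro u hu
  have hd : 4 * c + u < 2 ^ 6 := by norm_num; omega
  obtain ⟨b, hb, b', hb', eb⟩ := h (dec 6 (4 * c + u)) (by rw [mem_PP, cd_dec hd]; omega) (by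
    rw [mem_PP, cd_add, cd_dec hd]
    have q := xor4 c hc (cd c0 / 4) (by have := cd6 c0; omega) u hu (cd c0 % 4) (Nat.mod_lt _ (by norm_num))
    rw [Nat.div_add_mod] at q
    rw [q]
    have : c ^^^ (cd c0 / 4) ≠ 0 := by rw [Ne, Nat.xor_eq_zero_iff]; exact hcb
    omega)
  have eb := congrArg cd eb
  rw [cd_add, cd_dec hd] at eb
  -- shape of members
  have shp : ∀ b ∈ exs e ∪ gset t1 t2, (e = 1 ∧ cd b = 2) ∨ ∃ y < 16, cd b = pt t1 t2 y := by
    intro b hb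
    rcases Finset.mem_union.1 hb with hb | hb
    · left
      unfold exs at hb
      split at hb
      · simp at hb
      · rw [Finset.mem_singleton.1 hb, cd_dec (by norm_num)]
        exact ⟨by omega, rfl⟩
    · right
      obtain ⟨y, hy, rfl⟩ := Finset.mem_image.1 hb
      exact ⟨y, Finset.mem_range.1 hy, cd_dec (by exact pt_lt _ _ (Finset.mem_range.1 hy))⟩
  have p0 : ∀ y < 16, (e = 1 ∧ pt t1 t2 y ^^^ 2 = 4 * c + u) → (bt (t1 ^^^ s1) 0 = u % 2 ∧ (bt (t2 ^^^ s2) 0 + e) % 2 = u / 2) := by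
    rintro y hy ⟨rfl, q⟩
    have a1 := bt_lt t1 y; have a2 := bt_lt t2 y
    have := xor4 y hy 0 (by norm_num) (bt t1 y + 2 * bt t2 y) (by omega) (0 + 2 * 1) (by norm_num)
    rw [xor2 _ a1 _ a2 0 (by norm_num) 1 (by norm_num), ← add_assoc] at this
    change pt t1 t2 y ^^^ 2 = _ at this
    rw [this, Nat.xor_zero] at q
    obtain rfl : y = c := by omega
    rw [bt_xor, bt_xor, hs1 0 (by norm_num), hs2 0 (by norm_num), h1, h2, Nat.zero_xor]
    omega
  rcases shp b hb with ⟨he1, e1⟩ | ⟨y, hy, e1⟩ <;> rcases shp b' hb' with ⟨he2, e2⟩ | ⟨y', hy', e2⟩ <;> rw [e1, e2] at eb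
  · simp at eb; omega
  · right; exact p0 y' hy' ⟨he1, by rw [Nat.xor_comm]; exact eb⟩
  · right; exact p0 y hy ⟨he2, eb⟩
  · left
    rw [pt_xor _ _ hy hy'] at eb
    have hyy : y ^^^ y' = c := by omega
    have hy2 : y ^^^ c = y' := by rw [← hyy, ← Nat.xor_assoc, Nat.xor_self, Nat.zero_xor]
    refine ⟨y, ?_, ?_, hy⟩
    · rw [bt_xor, hs1 y hy, hy2]; omega
    · rw [bt_xor, hs2 y hy, hy2]; omega
/-! ### classification of tables -/
noncomputable section
def sp (i : ℕ) : ℕ := Nat.add (Nat.mul 8 (Nat.mod i 2)) (Nat.add (Nat.mul 32 (Nat.mod (Nat.div i 2) 8)) (Nat.mul 512 (Nat.div i 16)))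
def allB (n : ℕ) (f : ℕ → Bool) : Bool := Nat.rec true (fun i ih => Bool.rec false ih (f i)) n
def lor (l : List (List ℕ)) (f : List ℕ → Bool) : Bool := List.rec false (fun x _ ih => bor (f x) ih) l
def nrmF (t : ℕ) (k : ℕ → Bool) : Bool := force (cx t 1 0xAAAA) (fun t => force (cx t 2 0xCCCC) (fun t => force (cx t 4 0xF0F0) (fun t => force (cx t 8 0xFF00) k)))
def elt (t : ℕ) (u : ℕ) : Bool := force u (fun u => nrmF u (fun v => Nat.blt v t))
def st1 (G : List (List ℕ)) (reps : List ℕ) : Bool := allB 2048 (fun i => force (sp i) (fun t => bor (reps.contains t) (lor G (fun s => elt t (tr s t)))))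
def st2 (n e r : ℕ) (fs : List ℕ) (G : List (List ℕ)) : Bool := G.all (fun s => Nat.beq (nrm (tr s r)) r) &&
  Bool.rec true (allB 2048 (fun i => force (sp i) (fun t => Bool.rec true (bor (fs.contains t) (lor G (fun s => force (tr s t) (fun t' =>
    bor (elt t t') (bor (elt t (Nat.xor t' r)) (Bool.rec false (bor (elt t (Nat.xor t' 0xFFFE)) (elt t (Nat.xor (Nat.xor t' r) 0xFFFE))) (Nat.beq e 1))))))) (chk n e r t)))) (chkx n r)
end
def G1 : List (List ℕ) := [[0,2,4,6,13,15,9,11,7,5,3,1,10,8,14,12], [0,8,1,9,2,10,3,11,4,12,5,13,6,14,7,15], [0,2,1,3,4,6,5,7,8,10,9,11,12,14,13,15], [0,1,4,5,13,12,9,8,7,6,3,2,10,11,14,15], [0,1,10,11,13,12,7,6,8,9,2,3,5,4,15,14], [0,13,14,3,5,8,11,6,9,4,7,10,12,1,2,15], [0,4,1,5,2,6,3,7,13,9,12,8,15,11,14,10], [0,4,13,9,14,10,3,7,2,6,15,11,12,8,1,5], [0,12,15,3,8,4,7,11,10,6,5,9,2,14,13,1], [0,12,10,6,15,3,5,9,11,7,1,13,4,8,14,2],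 [0,4,6,2,1,5,7,3,13,9,11,15,12,8,10,14]]
def TI : List (ℕ × List ℕ × List (List ℕ)) := [(0, [], []), (8, [], []), (40, [], []), (104, [], []), (168, [], []), (232, [], []), (680, [], []), (744, [7264], [[0,1,9,8,2,3,11,10,5,4,12,13,7,6,14,15], [0,12,7,11,10,6,13,1,3,15,4,8,9,5,14,2], [0,1,2,3,4,5,6,7,8,9,10,11,12,13,14,15]]), (1632, [], []), (1640, [], []), (2760, [9448], [[0,1,3,2,15,14,12,13,10,11,9,8,5,4,6,7], [0,1,2,3,4,5,6,7,8,9,10,11,12,13,14,15], [0,1,2,3,4,5,6,7,10,11,8,9,14,15,12,13], [0,1,8,9,6,7,14,15,3,2,11,10,5,4,13,12]]), (5736, [], []), (6376, [1704, 8928, 11848], [[0,14,8,6,13,3,5,11,1,15,9,7,12,2,4,10], [0,15,8,7,4,11,12,3,2,13,10,5,6,9,14,1], [0,2,1,3,4,6,5,7,8,10,9,11,12,14,13,15], [0,7,11,12,10,13,1,6,3,4,8,15,9,14,2,5], [0,2,4,6,11,9,15,13,7,5,3,1,12,14,8,10], [0,8,14,6,7,15,9,1,10,2,4,12,13,5,3,11]]),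 (38504, [], [])]
def TII : List (ℕ × List ℕ × List (List ℕ)) := [(0, [], []), (8, [], []), (40, [], []), (104, [1568, 11808], [[0,9,10,3,12,5,6,15,1,8,11,2,13,4,7,14], [0,1,2,3,4,5,6,7,8,9,10,11,12,13,14,15], [0,1,2,3,7,6,5,4,8,9,10,11,15,14,13,12], [0,1,4,5,2,3,6,7,8,9,12,13,10,11,14,15]]), (168, [], []), (232, [], []), (680, [], []), (744, [2088, 3240], [[0,2,4,6,1,3,5,7,11,9,15,13,10,8,14,12], [0,9,4,13,2,11,6,15,8,1,12,5,10,3,14,7], [0,4,2,6,1,5,3,7,13,9,15,11,12,8,14,10], [0,1,2,3,4,5,6,7,8,9,10,11,12,13,14,15]]), (1632, [], []), (1640, [], []), (2760, [9448], [[0,4,6,2,14,10,8,12,9,13,15,11,7,3,1,5], [0,1,2,3,4,5,6,7,8,9,10,11,12,13,14,15]]), (5736, [], []), (6376, [680, 8928], [[0,13,14,3,8,5,6,11,4,9,10,7,12,1,2,15], [0,14,2,12,9,7,11,5,15,1,13,3,6,8,4,10], [0,5,8,13,4,1,12,9,2,7,10,15,6,3,14,11], [0,10,1,11,3,9,2,8,14,4,15,5,13,7,12,6],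 [0,2,1,3,4,6,5,7,8,10,9,11,12,14,13,15], [0,4,2,6,1,5,3,7,13,9,15,11,12,8,14,10]]), (38504, [168, 680, 2760], [[0,8,4,12,7,15,3,11,13,5,9,1,10,2,14,6], [0,8,2,10,1,9,3,11,7,15,5,13,6,14,4,12], [0,4,1,5,2,6,3,7,14,10,15,11,12,8,13,9], [0,4,13,9,14,10,3,7,2,6,15,11,12,8,1,5], [0,5,9,12,10,15,3,6,2,7,11,14,8,13,1,4], [0,10,12,6,15,5,3,9,1,11,13,7,14,4,2,8], [0,5,7,2,3,6,4,1,12,9,11,14,15,10,8,13], [0,2,4,6,1,3,5,7,11,9,15,13,10,8,14,12], [0,1,3,2,4,5,7,6,8,9,11,10,12,13,15,14]])]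
def pOK (n : List ℕ) : Bool := sOK n && Nat.beq (n.getD 0 1) 0
theorem tab_ok : (G1.all pOK && TI.all (fun x => x.2.2.all pOK) && TII.all (fun x => x.2.2.all pOK)) = true := by decide +kernel
set_option maxRecDepth 100000
theorem s_1 : st1 G1 (TI.map (·.1)) = true := by decide +kernel
theorem s_I : TI.all (fun x => st2 1 0 x.1 x.2.1 x.2.2) = true := by decide +kernel
theorem s_II : TII.all (fun x => st2 0 1 x.1 x.2.1 x.2.2) = true := by decide +kernel
theorem bor_or {a b : Bool} (h : bor a b = true) : a = true ∨ b = true := by cases a <;> simp_all [bor]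
theorem allB_t {n : ℕ} {f : ℕ → Bool} (h : allB n f = true) : ∀ i < n, f i = true := by
  induction n with
  | zero => intro i hi; omega
  | succ n ih =>
    change (Bool.rec false (allB n f) (f n) : Bool) = true at h
    intro i hi
    cases e : f n <;> rw [e] at h
    · simp at h
    · rcases Nat.lt_succ_iff_lt_or_eq.1 hi with hi | rfl
      · exact ih h i hi
      · exact e
theorem lor_t {l : List (List ℕ)} {f : List ℕ → Bool} (h : lor l f = true) : ∃ s ∈ l, f s = true := by
  induction l with
  | nil => exact absurd h (by change ¬ (false = true); decide)
  | cons s l ih =>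
    rcases bor_or (show bor (f s) (lor l f) = true from h) with h | h
    · exact ⟨s, by simp, h⟩
    · obtain ⟨s', hs, h⟩ := ih h; exact ⟨s', by simp [hs], h⟩
theorem elt_t {t u : ℕ} (h : elt t u = true) : nrm u < t := blt_lt h
/-- tables with zero value at zero -/
def TT (t : ℕ) : Prop := t < 2 ^ 16 ∧ bt t 0 = 0
theorem TT.xor {s t : ℕ} (hs : TT s) (ht : TT t) : TT (s ^^^ t) := ⟨Nat.xor_lt_two_pow hs.1 ht.1, by rw [bt_xor, hs.2, ht.2]⟩
theorem cx_bt (t y m y' : ℕ) : bt (cx t y m) y' = (bt t y' + bt t y * bt m y') % 2 := by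
  change bt (t ^^^ (bt t y * m)) y' = _
  rw [bt_xor]
  have : bt t y = 0 ∨ bt t y = 1 := by have := bt_lt t y; omega
  rcases this with e | e <;> rw [e]
  · simp [bt_eq]
  · simp
theorem TT.cx {t m : ℕ} (ht : TT t) (hm : TT m) (y : ℕ) : TT (cx t y m) :=
  cx_ind TT m (fun _ h => h.xor hm) t y ht
theorem tms : TT 0xAAAA ∧ TT 0xCCCC ∧ TT 0xF0F0 ∧ TT 0xFF00 ∧ TT 0xFFFE := by unfold TT; decide +kernel
theorem TT.nrm {t : ℕ} (ht : TT t) : TT (nrm t) := (((ht.cx tms.1 1).cx tms.2.1 2).cx tms.2.2.1 4).cx tms.2.2.2.1 8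
theorem tr_lt (t : ℕ) : ∀ s : List ℕ, tr s t < 2 ^ s.length := by
  intro s
  induction s with
  | nil => exact Nat.one_pos
  | cons x s ih =>
    have e : tr (x :: s) t = bt t x + 2 * tr s t := rfl
    have := bt_lt t x
    rw [e, List.length_cons, pow_succ]; omega
theorem pOK_len {s : List ℕ} (h : pOK s = true) : sOK s = true ∧ s.length = 16 ∧ s.getD 0 1 = 0 := by
  have h := (Bool.and_eq_true _ _ ▸ h : _ ∧ _)
  have h2 := h.1
  simp only [sOK, Bool.and_eq_true] at h2
  exact ⟨h.1, Nat.eq_of_beq_eq_true h2.1.1.2, Nat.eq_of_beq_eq_true h.2⟩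
theorem TT.tr {t : ℕ} (ht : TT t) {s : List ℕ} (h : pOK s = true) : TT (tr s t) := by
  obtain ⟨_, h2, h3⟩ := pOK_len h
  refine ⟨by have := tr_lt t s; rwa [h2] at this, ?_⟩
  rw [tr_bt _ _ _ (by omega)]
  rw [List.getD_eq_getElem _ _ (by omega)] at h3
  rw [h3, ht.2]
theorem nrm_sp {t : ℕ} (ht : TT t) : ∃ i < 2048, sp i = nrm t := by
  have hn := ht.nrm
  have b : ∀ y, y = 1 ∨ y = 2 ∨ y = 4 ∨ y = 8 → bt (MS.nrm t) y = 0 := by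
    intro y hy
    have q : bt 0xAAAA 1 = 1 ∧ bt 0xAAAA 2 = 0 ∧ bt 0xAAAA 4 = 0 ∧ bt 0xAAAA 8 = 0 ∧ bt 0xCCCC 1 = 0 ∧ bt 0xCCCC 2 = 1 ∧ bt 0xCCCC 4 = 0 ∧ bt 0xCCCC 8 = 0 ∧
      bt 0xF0F0 1 = 0 ∧ bt 0xF0F0 2 = 0 ∧ bt 0xF0F0 4 = 1 ∧ bt 0xF0F0 8 = 0 ∧ bt 0xFF00 1 = 0 ∧ bt 0xFF00 2 = 0 ∧ bt 0xFF00 4 = 0 ∧ bt 0xFF00 8 = 1 := by decide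
    obtain ⟨q1, q2, q3, q4, q5, q6, q7, q8, q9, q10, q11, q12, q13, q14, q15, q16⟩ := q
    have := bt_lt t 1; have := bt_lt t 2; have := bt_lt t 4; have := bt_lt t 8
    rcases hy with rfl | rfl | rfl | rfl <;> simp only [MS.nrm, cx_bt, q1, q2, q3, q4, q5, q6, q7, q8, q9, q10, q11, q12, q13, q14, q15, q16] <;> omega
  generalize MS.nrm t = u at hn b
  have e : ∀ y, bt u y = u / 2 ^ y % 2 := fun y => by rw [bt_eq, Nat.toNat_testBit]
  have b1 := b 1 (by simp); have b2 := b 2 (by simp); have b4 := b 4 (by simp); have b8 := b 8 (by simp)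
  have b0 := hn.2
  have hl := hn.1
  rw [e] at b0 b1 b2 b4 b8
  norm_num at b0 b1 b2 b4 b8 hl
  refine ⟨u / 8 % 2 + 2 * (u / 32 % 8) + 16 * (u / 512), by omega, ?_⟩
  change 8 * ((u / 8 % 2 + 2 * (u / 32 % 8) + 16 * (u / 512)) % 2) + (32 * ((u / 8 % 2 + 2 * (u / 32 % 8) + 16 * (u / 512)) / 2 % 8) + 512 * ((u / 8 % 2 + 2 * (u / 32 % 8) + 16 * (u / 512)) / 16)) = u
  omega
def SP (t : ℕ) : Prop := ∃ i < 2048, sp i = t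
theorem cls1 {n : ℕ} {ex : Finset E} (hex : EX ex) {R : Finset V} (t1 : ℕ) : ∀ t2, TT t1 → TT t2 → SP t1 → KK n ex R t1 t2 →
    ∃ r ∈ TI.map (·.1), ∃ t, TT r ∧ TT t ∧ KK n ex R r t := by
  induction t1 using Nat.strong_induction_on with
  | _ t1 ih =>
    intro t2 h1 h2 ⟨i, hi, e⟩ h
    have hs := allB_t s_1 i hi
    change bor ((TI.map (·.1)).contains (sp i)) (lor G1 (fun s => elt (sp i) (tr s (sp i)))) = true at hs
    rw [e] at hs
    rcases bor_or hs with hs | hs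
    · exact ⟨t1, List.contains_iff_mem.1 hs, t2, h1, h2, h⟩
    · obtain ⟨s, hs, hl⟩ := lor_t hs
      have hl := elt_t hl
      have hp : pOK s = true := by
        have := tab_ok
        simp only [Bool.and_eq_true, List.all_eq_true] at this
        exact this.1.1 s hs
      exact ih _ hl _ (h1.tr hp).nrm (h2.tr hp) (nrm_sp (h1.tr hp)) ((h.perm hex s (pOK_len hp).1).nrm1 hex)
theorem cls2 {n e : ℕ} (hn : n < 2) (he : e < 2) {R : Finset V} (r : ℕ) (hr : TT r) (fs : List ℕ) (G : List (List ℕ)) (hG : ∀ s ∈ G, pOK s = true) (hst : st2 n e r fs G = true)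
    (t2 : ℕ) : TT t2 → SP t2 → KK n (exs e) R r t2 → ∃ f ∈ fs, KK n (exs e) R r f := by
  have hst := (Bool.and_eq_true _ _ ▸ hst : _ ∧ _)
  obtain ⟨hfix, hst⟩ := hst
  rw [List.all_eq_true] at hfix
  induction t2 using Nat.strong_induction_on with
  | _ t2 ih =>
    intro h2 ⟨i, hi, es⟩ h
    obtain ⟨hc, hcx⟩ := h.2.chk hn he hr.2 h2.2
    have hex := exs_EX e
    rw [hcx] at hst
    have hs := allB_t hst i hi
    change (Bool.rec true (bor (fs.contains (sp i)) (lor G (fun s => bor (elt (sp i) (tr s (sp i))) (bor (elt (sp i) (tr s (sp i) ^^^ r)) (Bool.rec false (bor (elt (sp i) (tr s (sp i) ^^^ 0xFFFE)) (elt (sp i) (tr s (sp i) ^^^ r ^^^ 0xFFFE))) (Nat.beq e 1)))))) (chk n e r (sp i)) : Bool) = true at hs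
    rw [es, hc] at hs
    rcases bor_or hs with hs | hs
    · exact ⟨t2, List.contains_iff_mem.1 hs, h⟩
    · obtain ⟨s, hs, hl⟩ := lor_t hs
      have hp := hG s hs
      have k : KK n (exs e) R r (tr s t2) := by
        have := (h.perm hex s (pOK_len hp).1).nrm1 hex
        rwa [Nat.eq_of_beq_eq_true (hfix s hs)] at this
      have ht := h2.tr hp
      have fin : ∀ u, TT u → KK n (exs e) R r u → nrm u < t2 → ∃ f ∈ fs, KK n (exs e) R r f := fun u hu hk hlt =>
        ih _ hlt hu.nrm (nrm_sp hu) (hk.nrm2 hex)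
      rcases bor_or hl with hl | hl
      · exact fin _ ht k (elt_t hl)
      rcases bor_or hl with hl | hl
      · exact fin _ (ht.xor hr) (k.addt hex) (elt_t hl)
      have he1 : e = 1 := by
        by_contra hne
        have : Nat.beq e 1 = false := by rw [Bool.eq_false_iff]; exact fun h' => hne (Nat.eq_of_beq_eq_true h')
        rw [this] at hl; simp at hl
      subst he1
      rcases bor_or (show bor (elt t2 (tr s t2 ^^^ 0xFFFE)) (elt t2 (tr s t2 ^^^ r ^^^ 0xFFFE)) = true from hl) with hl | hl
      · exact fin _ (ht.xor tms.2.2.2.2) (KK.flip hr.2 ht.2 k) (elt_t hl)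
      · exact fin _ ((ht.xor hr).xor tms.2.2.2.2) (KK.flip hr.2 (ht.xor hr).2 (k.addt hex)) (elt_t hl)
theorem cls {n e : ℕ} (hn : n < 2) (he : e < 2) {R : Finset V} (TB : List (ℕ × List ℕ × List (List ℕ))) (hTB : TB.map (·.1) = TI.map (·.1))
    (hG : ∀ x ∈ TB, ∀ s ∈ x.2.2, pOK s = true) (hst : TB.all (fun x => st2 n e x.1 x.2.1 x.2.2) = true)
    (t1 t2 : ℕ) (h1 : TT t1) (h2 : TT t2) (h : KK n (exs e) R t1 t2) : ∃ x ∈ TB, ∃ f ∈ x.2.1, KK n (exs e) R x.1 f := by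
  have hex := exs_EX e
  obtain ⟨r, hr, t, hr', ht, k⟩ := cls1 hex _ _ h1.nrm h2 (nrm_sp h1) (h.nrm1 hex)
  rw [← hTB] at hr
  obtain ⟨x, hx, rfl⟩ := List.mem_map.1 hr
  exact ⟨x, hx, cls2 hn he _ hr' _ _ (hG x hx) (List.all_eq_true.1 hst x hx) _ ht.nrm (nrm_sp ht) (k.nrm2 hex)⟩
theorem clsI {R : Finset V} {t1 t2 : ℕ} (h1 : TT t1) (h2 : TT t2) (h : KK 1 ∅ R t1 t2) :
    ∃ x ∈ [(744, 7264), (2760, 9448), (6376, 1704), (6376, 8928), (6376, 11848)], AE R (jn PP (gset x.1 x.2)) := by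
  have tb := tab_ok
  simp only [Bool.and_eq_true, List.all_eq_true] at tb
  obtain ⟨x, hx, f, hf, k⟩ := cls (n := 1) (e := 0) (by norm_num) (by norm_num) TI rfl tb.1.2 s_I t1 t2 h1 h2 h
  have q : ∀ x ∈ TI, ∀ f ∈ x.2.1, (x.1, f) ∈ [(744, 7264), (2760, 9448), (6376, 1704), (6376, 8928), (6376, 11848)] := by decide
  have k1 := k.1
  change AE R (jn PP (∅ ∪ gset x.1 f)) at k1
  rw [Finset.empty_union] at k1
  exact ⟨_, q x hx f hf, k1⟩
theorem clsII {R : Finset V} {t1 t2 : ℕ} (h1 : TT t1) (h2 : TT t2) (h : KK 0 {dec 6 2} R t1 t2) :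
    ∃ x ∈ [(104, 1568), (104, 11808), (744, 2088), (744, 3240), (2760, 9448), (6376, 680), (6376, 8928), (38504, 168), (38504, 680), (38504, 2760)],
      AE R (jn PP ({dec 6 2} ∪ gset x.1 x.2)) := by
  have tb := tab_ok
  simp only [Bool.and_eq_true, List.all_eq_true] at tb
  obtain ⟨x, hx, f, hf, k⟩ := cls (n := 0) (e := 1) (by norm_num) (by norm_num) TII (by decide) tb.2 s_II t1 t2 h1 h2 h
  have q : ∀ x ∈ TII, ∀ f ∈ x.2.1, (x.1, f) ∈ [(104, 1568), (104, 11808), (744, 2088), (744, 3240), (2760, 9448), (6376, 680), (6376, 8928), (38504, 168), (38504, 680), (38504, 2760)] := by decide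
  exact ⟨_, q x hx f hf, k.1⟩
/-! ### linking -/
theorem graph (G : Finset E) (hs : ∀ y < 16, ∃ v ∈ G, cd v / 4 = y) (hc : G.card = 16) (h0 : (0 : E) ∈ G) : ∃ t1 t2, TT t1 ∧ TT t2 ∧ G = gset t1 t2 := by
  choose! f hf hf4 using hs
  let t1 := Nat.ofBits (fun i : Fin 16 => decide (cd (f i) % 2 = 1))
  let t2 := Nat.ofBits (fun i : Fin 16 => decide (cd (f i) / 2 % 2 = 1))
  have hb1 : ∀ y < 16, bt t1 y = cd (f y) % 2 := by
    intro y hy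
    rw [bt_eq, Nat.testBit_ofBits_lt _ _ hy]
    rcases Nat.mod_two_eq_zero_or_one (cd (f y)) with h | h <;> simp [h]
  have hb2 : ∀ y < 16, bt t2 y = cd (f y) / 2 % 2 := by
    intro y hy
    rw [bt_eq, Nat.testBit_ofBits_lt _ _ hy]
    rcases Nat.mod_two_eq_zero_or_one (cd (f y) / 2) with h | h <;> simp [h]
  have hG : G = gset t1 t2 := by
    symm
    refine Finset.eq_of_subset_of_card_le ?_ (by rw [gset_card, hc])
    intro v hv
    obtain ⟨y, hy, rfl⟩ := Finset.mem_image.1 hv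
    have hy := Finset.mem_range.1 hy
    have : pt t1 t2 y = cd (f y) := by
      rw [pt, hb1 y hy, hb2 y hy]
      have := hf4 y hy
      omega
    rw [this, dec_cd]; exact hf y hy
  have h0' := h0
  rw [hG] at h0'
  obtain ⟨y, hy, e⟩ := Finset.mem_image.1 h0'
  have hy := Finset.mem_range.1 hy
  have e := congrArg cd e
  rw [cd_dec (by exact pt_lt _ _ hy), cd_zero, pt] at e
  obtain rfl : y = 0 := by omega
  exact ⟨t1, t2, ⟨Nat.ofBits_lt_two_pow _, by omega⟩, ⟨Nat.ofBits_lt_two_pow _, by omega⟩, hG⟩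
theorem q4 : ∀ x < 64, ∀ a < 4, (x ^^^ a) / 4 = x / 4 := by decide +kernel
theorem q4x : ∀ x < 64, ∀ a < 64, (x ^^^ a) / 4 = (x / 4) ^^^ (a / 4) := by decide +kernel
theorem eq_add {n : ℕ} {a b v : Fin n → ZMod 2} (e : a + b = v) : b = v + a := by rw [← e, add_comm a b, add_assoc, add_self2, add_zero]
theorem GP.sl {w : ℕ} {B : Finset E} (h : GP w PP B) (y : ℕ) (hy : y < 16) : ∃ v ∈ B, cd v / 4 = y := by
  obtain ⟨a, ha, b, hb, e⟩ := h.cov (dec 6 (4 * y))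
  refine ⟨b, hb, ?_⟩
  rw [eq_add e, cd_add, cd_dec (by norm_num; omega), q4 _ (by omega) _ (mem_PP.1 ha)]
  omega
theorem GP.HH {w : ℕ} {B : Finset E} (h : GP w PP B) (n : ℕ) : HH n B := by
  refine ⟨0, fun _ => rfl, fun d hd _ => (h.dif d ?_).resolve_left ?_⟩
  · rintro rfl; exact hd (mem_PP.2 (by rw [cd_zero]; norm_num))
  · rintro ⟨a, ha, a', ha', rfl⟩
    refine hd (mem_PP.2 ?_)
    rw [cd_add]
    exact Nat.xor_lt_two_pow (n := 2) (mem_PP.1 ha) (mem_PP.1 ha')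
theorem rf0 (A : Finset E) : A.image (aff (LinearEquiv.refl (ZMod 2) E) 0) = A := by
  conv_rhs => rw [← Finset.image_id (s := A)]
  congr 1; funext x; simp [aff]
theorem trl (A B : Finset E) (b : E) : AE (jn A B) (jn A (B.image (aff (LinearEquiv.refl (ZMod 2) E) b))) := by
  have := jn_ae A B (LinearEquiv.refl (ZMod 2) E) 0 b
  rwa [rf0] at this
theorem GP.tr {w : ℕ} {A B : Finset E} (h : GP w A B) (b : E) : GP w A (B.image (aff (LinearEquiv.refl (ZMod 2) E) b)) := by
  have := h.map (LinearEquiv.refl (ZMod 2) E) 0 b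
  rwa [rf0] at this
theorem zero_tr {B : Finset E} {b : E} (hb : b ∈ B) : (0 : E) ∈ B.image (aff (LinearEquiv.refl (ZMod 2) E) b) :=
  Finset.mem_image.2 ⟨b, hb, by simp [aff, add_self2]⟩
def LI : List (ℕ × ℕ) := [(744, 7264), (2760, 9448), (6376, 1704), (6376, 8928), (6376, 11848)]
def LII : List (ℕ × ℕ) := [(104, 1568), (104, 11808), (744, 2088), (744, 3240), (2760, 9448), (6376, 680), (6376, 8928), (38504, 168), (38504, 680), (38504, 2760)]
theorem case20 {T : Finset V} (hg : Good T) (hT : T.card = 20) : ∃ x ∈ LI, AE T (jn PP (gset x.1 x.2)) := by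
  obtain ⟨B, h, hB, hA⟩ := red20 hg hT
  obtain ⟨b, hb, _⟩ := h.sl 0 (by norm_num)
  have h' := h.tr b
  have hA' := hA.trans (trl PP B b)
  have z := zero_tr hb
  have hc : (B.image (aff (LinearEquiv.refl (ZMod 2) E) b)).card = 16 := by rw [Finset.card_image_of_injective _ (aff_inj _ _), hB]
  generalize B.image (aff (LinearEquiv.refl (ZMod 2) E) b) = B' at *
  obtain ⟨t1, t2, h1, h2, rfl⟩ := graph B' h'.sl hc z
  exact clsI h1 h2 (R := T) ⟨by rwa [Finset.empty_union], by rw [Finset.empty_union]; exact h'.HH 1⟩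
theorem mem_QQ {v : E} : v ∈ QQ ↔ cd v < 5 := by
  rw [mem_dl (by decide)]
  have : ∀ x, x ∈ [0,1,2,3,4] ↔ x < 5 := fun x => by simp; omega
  exact this _
theorem case5 {B : Finset E} (h : GP 5 QQ B) (hB : B.card = 16) : ∃ x ∈ LI, AE (jn PP B) (jn PP (gset x.1 x.2)) := by
  obtain ⟨b, hb⟩ : B.Nonempty := Finset.card_pos.1 (by omega)
  have h' := h.tr b
  have hA' := trl PP B b
  have z := zero_tr hb
  have hc : (B.image (aff (LinearEquiv.refl (ZMod 2) E) b)).card = 16 := by rw [Finset.card_image_of_injective _ (aff_inj _ _), hB]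
  generalize B.image (aff (LinearEquiv.refl (ZMod 2) E) b) = B' at *
  have sl := (slice_eq h' (fun v hv => by have := mem_QQ.1 hv; omega) (by rw [dl_card (by decide) (by decide)]; decide)).2 hc
  have hs : ∀ y < 16, ∃ v ∈ B', cd v / 4 = y := by
    intro y hy
    by_contra hcon
    push Not at hcon
    have hm : ∀ j < 4, dec 6 ((4 * y + j) ^^^ 4) ∈ B' := by
      intro j hj
      obtain ⟨a, ha, b, hb, e⟩ := h'.cov (dec 6 (4 * y + j))
      have eb := eq_add e
      have ha5 := mem_QQ.1 ha
      by_cases ha4 : cd a < 4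
      · exfalso
        apply hcon b hb
        rw [eb, cd_add, cd_dec (by norm_num; omega), q4 _ (by omega) _ ha4]; omega
      · have : cd a = 4 := by omega
        rw [dec_xor, show dec 6 4 = a by rw [← this, dec_cd], ← eb]; exact hb
    have hsub : dl ((List.range 4).map (fun j => (4 * y + j) ^^^ 4)) ⊆ B'.filter (fun v => cd v / 8 = y / 2) := by
      intro v hv
      simp only [dl, List.mem_toFinset, List.mem_map, List.mem_range] at hv
      obtain ⟨_, ⟨j, hj, rfl⟩, rfl⟩ := hv
      refine Finset.mem_filter.2 ⟨hm j hj, ?_⟩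
      have q : ∀ y < 16, ∀ j < 4, (4 * y + j) ^^^ 4 < 64 ∧ ((4 * y + j) ^^^ 4) / 8 = y / 2 := by decide +kernel
      rw [cd_dec (by exact (q y hy j hj).1)]; exact (q y hy j hj).2
    have := Finset.card_le_card hsub
    have q : ∀ y < 16, (∀ x ∈ (List.range 4).map (fun j => (4 * y + j) ^^^ 4), x < 64) ∧ ((List.range 4).map (fun j => (4 * y + j) ^^^ 4)).Nodup := by decide +kernel
    rw [sl _ (by omega), dl_card (q y hy).1 (q y hy).2] at this
    simp at this
  obtain ⟨t1, t2, h1, h2, rfl⟩ := graph B' hs hc z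
  refine clsI h1 h2 (R := jn PP B) ⟨by rwa [Finset.empty_union], ?_⟩
  rw [Finset.empty_union]
  refine ⟨dec 6 4, fun h => by omega, fun d hd hd' => (h'.dif d ?_).resolve_left ?_⟩
  · rintro rfl; exact hd (mem_PP.2 (by rw [cd_zero]; norm_num))
  · rintro ⟨a, ha, a', ha', rfl⟩
    rw [mem_PP, cd_add, cd_dec (by norm_num)] at hd'
    rw [mem_PP] at hd
    rw [cd_add] at hd hd'
    have q : ∀ a < 5, ∀ b < 5, a ^^^ b < 4 ∨ a ^^^ b ^^^ 4 < 4 := by decide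
    rcases q _ (mem_QQ.1 ha) _ (mem_QQ.1 ha') with q | q
    · exact hd q
    · exact hd' q
theorem mv2 : ∀ q < 4, q ≠ 0 → ∃ cs, ∃ _ : mvOK cs cs = true, app cs q = 2 := by
  intro q hq h0
  interval_cases q
  · exact absurd rfl h0
  · exact ⟨[2,1,4,8,16,32], by decide +kernel, by decide⟩
  · exact ⟨[1,2,4,8,16,32], by decide +kernel, by decide⟩
  · exact ⟨[1,3,4,8,16,32], by decide +kernel, by decide⟩
theorem case4 {B : Finset E} (h : GP 4 PP B) (hB : B.card = 17) : ∃ x ∈ LII, AE (jn PP B) (jn PP ({dec 6 2} ∪ gset x.1 x.2)) := by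
  obtain ⟨p, hp, q, hq, hpq, e⟩ : ∃ p ∈ B, ∃ q ∈ B, p ≠ q ∧ cd p / 4 = cd q / 4 :=
    Finset.exists_ne_map_eq_of_card_lt_of_maps_to (t := Finset.range 16) (by rw [Finset.card_range]; omega) (fun v _ => by have := cd6 v; simp; omega)
  have hpq4 : cd (q + p) < 4 := by
    have := q4x _ (cd6 q) _ (cd6 p)
    rw [e, Nat.xor_self] at this
    rw [cd_add]; omega
  have hpq0 : cd (q + p) ≠ 0 := by
    rw [Ne, cd_eq_zero, add_eq_zero2]; exact fun h => hpq h.symm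
  obtain ⟨cs, hcs, h2⟩ := mv2 _ hpq4 hpq0
  obtain ⟨hi, hP⟩ := mvOK_PP hcs
  have h' := (h.tr p).map (linE 6 cs cs hi) 0 0
  have hA' := (trl PP B p).trans (jn_ae _ _ (linE 6 cs cs hi) 0 0)
  rw [hP] at h' hA'
  have z : (0 : E) ∈ (B.image (aff (LinearEquiv.refl (ZMod 2) E) p)).image (aff (linE 6 cs cs hi) 0) := Finset.mem_image.2 ⟨0, zero_tr hp, by simp [aff]⟩
  have z2 : dec 6 2 ∈ (B.image (aff (LinearEquiv.refl (ZMod 2) E) p)).image (aff (linE 6 cs cs hi) 0) := by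
    refine Finset.mem_image.2 ⟨q + p, Finset.mem_image.2 ⟨q, hq, by simp [aff]⟩, ?_⟩
    rw [aff, add_zero, linE_apply, lin_apply, h2]
  have hc : ((B.image (aff (LinearEquiv.refl (ZMod 2) E) p)).image (aff (linE 6 cs cs hi) 0)).card = 17 := by
    rw [Finset.card_image_of_injective _ (aff_inj _ _), Finset.card_image_of_injective _ (aff_inj _ _), hB]
  generalize (B.image (aff (LinearEquiv.refl (ZMod 2) E) p)).image (aff (linE 6 cs cs hi) 0) = B' at *
  have c2 : cd (dec 6 2) = 2 := cd_dec (by norm_num)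
  have n0 : (0 : E) ≠ dec 6 2 := fun h => by rw [← h, cd_zero] at c2; omega
  obtain ⟨t1, t2, h1, h2, e⟩ := graph (B'.erase (dec 6 2)) (fun y hy => by
    rcases Nat.eq_zero_or_pos y with rfl | hy0
    · exact ⟨0, Finset.mem_erase.2 ⟨n0, z⟩, by rw [cd_zero]⟩
    · obtain ⟨v, hv, e⟩ := h'.sl y hy
      refine ⟨v, Finset.mem_erase.2 ⟨?_, hv⟩, e⟩
      rintro rfl
      rw [c2] at e; omega) (by rw [Finset.card_erase_of_mem z2, hc]) (Finset.mem_erase.2 ⟨n0, z⟩)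
  have eB : {dec 6 2} ∪ gset t1 t2 = B' := by
    rw [← e]; exact Finset.insert_erase z2
  exact clsII h1 h2 (R := jn PP B) ⟨by rwa [eB], by rw [eB]; exact h'.HH 0⟩
theorem Good.er {T T' : Finset V} (h : AE T T') {t' : V} (ht : t' ∈ T') (hg : Good (T'.erase t')) : ∃ t ∈ T, Good (T.erase t) := by
  obtain ⟨L, c, rfl⟩ := h.symm
  refine ⟨L t' + c, Finset.mem_image_of_mem _ ht, hg.ae ⟨L, c, ?_⟩⟩
  rw [Finset.image_erase (fun x y e => L.injective (add_right_cancel e))]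
theorem PPe (B : Finset E) : (jn QQ B).erase (sn (dec 6 4) 1) = jn PP B := by
  rw [jn_erase, if_pos (sn_last _ _), ini_sn]
  congr 1
theorem case21 {T : Finset V} (hX : ∀ x ∈ LI, Good (jn PP (gset x.1 x.2))) (hg : Good T) (hT : T.card = 21) :
    (∃ x ∈ LII, AE T (jn PP ({dec 6 2} ∪ gset x.1 x.2))) ∨ ∃ t ∈ T, Good (T.erase t) := by
  rcases red21 hg hT with ⟨B, h, hB, hA⟩ | ⟨B, h, hB, hA⟩
  · left
    obtain ⟨x, hx, h⟩ := case4 h hB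
    exact ⟨x, hx, hA.trans h⟩
  · right
    obtain ⟨x, hx, h⟩ := case5 h hB
    refine Good.er hA (t' := sn (dec 6 4) 1) (mem_jn.2 (Or.inl ⟨sn_last _ _, by rw [ini_sn, mem_QQ, cd_dec (by norm_num)]; norm_num⟩)) ?_
    rw [PPe]
    exact (hX x hx).ae h.symm
/-! ### explicit sets in dimension 7 -/
noncomputable section
def fK {α : Type} (n : ℕ) (k : ℕ → α) : α := Nat.rec (k 0) (fun m _ => k m) (Nat.succ n)
def fcL {α : Type} (l : List ℕ) : (List ℕ → α) → α := List.rec (fun k => k []) (fun a _ ih k => fK a fun a => ih fun l => k (a :: l)) l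
theorem fcL_eq {α : Type} (l : List ℕ) : ∀ k : List ℕ → α, fcL l k = k l := by
  induction l with
  | nil => exact fun k => rfl
  | cons a l ih => exact fun k => ih _
def mask (l : List ℕ) : ℕ := List.rec 0 (fun a _ ih => Nat.lor (Nat.shiftLeft 1 a) ih) l
def dv (l : List ℕ) : Finset V := (l.map (dec 7)).toFinset
def sm (l : List ℕ) (f : ℕ → ℕ) : ℕ := List.rec 0 (fun a _ ih => Nat.add (f a) ih) l
def rl (l : List ℕ) (M x : ℕ) : ℕ := sm l (fun a => bt M (Nat.xor a x))
def sq (n : ℕ) : ℕ := fK n fun n => Nat.mul n n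
def JJ (l : List ℕ) : ℕ := fcL l fun l => fK (mask l) fun M => sm l fun s => sq (Nat.add (sq (rl l M s)) (sm l fun t => sq (rl l M (Nat.xor s t))))
def goodB (l : List ℕ) : Bool := fcL l fun l => fK (mask l) fun M => allB 128 fun x => l.any fun a => Nat.beq (bt M (Nat.xor a x)) 1
def minB (l : List ℕ) : Bool := fcL l fun l => fK (mask (0 :: l)) fun M => l.all fun s => (0 :: l).any fun t => !(Nat.beq t s) &&
  fK (Nat.xor s t) fun u => (0 :: l).all fun a => bor (Nat.beq (bt M (Nat.xor a u)) 0) (Nat.beq a s || Nat.beq a t)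
def lineB (l : List ℕ) : Bool := fcL l fun l => l.any fun s => l.any fun t => !(Nat.beq t s) && l.contains (Nat.xor s t)
def W (l : List ℕ) : Prop := (∀ x ∈ l, x < 128) ∧ l.Nodup
instance (l : List ℕ) : Decidable (W l) := inferInstanceAs (Decidable (_ ∧ _))
theorem bt_mask (l : List ℕ) (x : ℕ) : bt (mask l) x = if x ∈ l then 1 else 0 := by
  have : ((mask l).testBit x) = decide (x ∈ l) := by
    induction l with
    | nil => simp [mask]
    | cons a l ih =>
      show (1 <<< a ||| mask l).testBit x = _
      rw [Nat.testBit_or, ih, Nat.one_shiftLeft, Nat.testBit_two_pow]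
      simp [eq_comm]
  rw [bt_eq, this]
  by_cases h : x ∈ l <;> simp [h]
theorem sm_eq (l : List ℕ) (f : ℕ → ℕ) : sm l f = (l.map f).sum := by
  induction l with
  | nil => rfl
  | cons a l ih => show f a + sm l f = _; rw [ih]; simp
theorem dec7i {x y : ℕ} (hx : x < 128) (hy : y < 128) (h : dec 7 x = dec 7 y) : x = y := by
  rw [← cd_dec (n := 7) (x := x) (by exact hx), h, cd_dec (by exact hy)]
theorem mem_dv {l : List ℕ} (hl : W l) {v : V} : v ∈ dv l ↔ cd v ∈ l := by
  simp only [dv, List.mem_toFinset, List.mem_map]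
  constructor
  · rintro ⟨x, hx, rfl⟩; rwa [cd_dec (by exact hl.1 x hx)]
  · exact fun h => ⟨_, h, dec_cd v⟩
theorem dec_mem {l : List ℕ} {x : ℕ} (h : x ∈ l) : dec 7 x ∈ dv l := List.mem_toFinset.2 (List.mem_map_of_mem h)
theorem sum_dv {l : List ℕ} (hl : W l) (f : V → ℕ) : ∑ v ∈ dv l, f v = sm l (fun x => f (dec 7 x)) := by
  unfold dv
  rw [List.sum_toFinset f (List.Nodup.map_on (fun x hx y hy e => dec7i (hl.1 x hx) (hl.1 y hy) e) hl.2), List.map_map, sm_eq]; rfl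
theorem dv_card {l : List ℕ} (hl : W l) : (dv l).card = l.length := by
  unfold dv
  rw [List.toFinset_card_of_nodup (List.Nodup.map_on (fun x hx y hy e => dec7i (hl.1 x hx) (hl.1 y hy) e) hl.2), List.length_map]
theorem dv_erase {l : List ℕ} (hl : W l) {a : ℕ} (ha : a < 128) : (dv l).erase (dec 7 a) = dv (l.filter (· ≠ a)) := by
  have hl' : W (l.filter (· ≠ a)) := ⟨fun x hx => hl.1 x (List.mem_filter.1 hx).1, hl.2.filter _⟩
  ext v
  rw [Finset.mem_erase, mem_dv hl, mem_dv hl', List.mem_filter, and_comm]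
  have : v ≠ dec 7 a ↔ cd v ≠ a := not_congr ⟨fun h => by rw [h, cd_dec (by exact ha)], fun h => by rw [← h, dec_cd]⟩
  simp [this]
theorem dv_cons0 (l : List ℕ) : dv (0 :: l) = insert 0 (dv l) := by simp [dv, dec_zero]
theorem good_of {l : List ℕ} (h : goodB l = true) : Good (dv l) := by
  unfold goodB at h
  rw [fcL_eq] at h
  change allB 128 (fun x => l.any fun a => Nat.beq (bt (mask l) (Nat.xor a x)) 1) = true at h
  intro v
  obtain ⟨a, ha, e⟩ := List.any_eq_true.1 (allB_t h (cd v) (cd_lt v))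
  have e : bt (mask l) (a ^^^ cd v) = 1 := Nat.eq_of_beq_eq_true e
  rw [bt_mask] at e
  refine ⟨_, dec_mem ha, dec 7 (a ^^^ cd v), dec_mem (by by_contra h; simp [h] at e), ?_⟩
  rw [dec_xor, ← add_assoc, add_self2, zero_add, dec_cd]
def rF (S : Finset V) (x : V) : ℕ := ∑ a ∈ S, if a + x ∈ S then 1 else 0
def JF (S : Finset V) : ℕ := ∑ s ∈ S, (rF S s ^ 2 + ∑ t ∈ S, rF S (s + t) ^ 2) ^ 2
theorem JF_image (S : Finset V) (L : V ≃ₗ[ZMod 2] V) : JF (S.image L) = JF S := by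
  have hr : ∀ x, rF (S.image L) (L x) = rF S x := by
    intro x
    unfold rF
    rw [Finset.sum_image (fun x _ y _ e => L.injective e)]
    refine Finset.sum_congr rfl (fun a _ => ?_)
    simp only [← map_add, L.injective.mem_finset_image]
  unfold JF
  rw [Finset.sum_image (fun x _ y _ e => L.injective e)]
  refine Finset.sum_congr rfl (fun a _ => ?_)
  rw [hr, Finset.sum_image (fun x _ y _ e => L.injective e)]
  simp only [← map_add, hr]
theorem JF_dv {l : List ℕ} (hl : W l) : JF (dv l) = JJ l := by
  have hr : ∀ x < 128, rF (dv l) (dec 7 x) = rl l (mask l) x := by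
    intro x hx
    unfold rF rl
    rw [sum_dv hl]
    simp only [sm_eq]
    congr 1
    refine List.map_congr_left (fun a ha => ?_)
    simp only [← dec_xor, mem_dv hl, cd_dec (Nat.xor_lt_two_pow (n := 7) (hl.1 a ha) hx)]
    exact (bt_mask _ _).symm
  unfold JF JJ
  rw [fcL_eq, sum_dv hl]
  show _ = sm l fun s => sq (sq (rl l (mask l) s) + sm l fun t => sq (rl l (mask l) (Nat.xor s t)))
  simp only [sm_eq]
  congr 1
  refine List.map_congr_left (fun a ha => ?_)
  rw [sum_dv hl, hr a (hl.1 a ha)]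
  have hs : ∀ n, sq n = n ^ 2 := fun n => (Nat.pow_two n).symm
  rw [hs, hs, sm_eq]
  congr 3
  refine List.map_congr_left (fun b hb => ?_)
  rw [hs, ← dec_xor, hr _ (Nat.xor_lt_two_pow (n := 7) (hl.1 a ha) (hl.1 b hb))]; rfl
theorem minB_of {l : List ℕ} (hl : W l) (h0 : 0 ∉ l) (h : minB l = true) : ∀ s ∈ dv l, ¬ Good (insert 0 ((dv l).erase s)) := by
  intro s hs hg
  unfold minB at h
  rw [fcL_eq] at h
  rw [mem_dv hl] at hs
  obtain ⟨t, ht, e⟩ := List.any_eq_true.1 (List.all_eq_true.1 h _ hs)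
  obtain ⟨e1, e⟩ := (Bool.and_eq_true _ _).mp e
  obtain ⟨a, ha, b, hb, ab⟩ := hg (s + dec 7 t)
  have hm : ∀ x, x ∈ insert 0 ((dv l).erase s) → cd x ∈ 0 :: l ∧ cd x ≠ cd s := by
    intro x hx
    rcases Finset.mem_insert.1 hx with rfl | hx
    · rw [cd_zero]
      exact ⟨by simp, fun e => h0 (by rw [e]; exact hs)⟩
    · rw [Finset.mem_erase, mem_dv hl] at hx
      exact ⟨List.mem_cons_of_mem _ hx.2, fun e => hx.1 (cd_inj e)⟩
  have ht' : t < 128 := by rcases List.mem_cons.1 ht with rfl | ht; · norm_num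
                           exact hl.1 _ ht
  have hcb : cd b = cd a ^^^ (cd s ^^^ t) := by rw [eq_add ab, cd_add, cd_add, cd_dec (by exact ht'), Nat.xor_comm]
  have e2 := List.all_eq_true.1 e _ (hm a ha).1
  change bor (Nat.beq (bt (mask (0 :: l)) (cd a ^^^ (cd s ^^^ t))) 0) _ = true at e2
  rw [← hcb, bt_mask, if_pos (hm b hb).1] at e2
  change (Nat.beq (cd a) (cd s) || Nat.beq (cd a) t) = true at e2
  rcases (Bool.or_eq_true _ _).mp e2 with e2 | e2
  · exact (hm a ha).2 (Nat.eq_of_beq_eq_true e2)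
  · rw [Nat.eq_of_beq_eq_true e2, Nat.xor_comm, Nat.xor_assoc, Nat.xor_self, Nat.xor_zero] at hcb
    exact (hm b hb).2 hcb
end
/-! ### from sets of points to finsets -/
theorem sat_good {F : Finset V} (h0 : (0 : V) ∉ F) : Saturating (↑F : Set V) ↔ Good (insert 0 F) := by
  constructor
  · rintro ⟨_, h⟩ v
    by_cases hv : v ∈ insert 0 F
    · exact ⟨0, by simp, v, hv, zero_add v⟩
    · simp only [Finset.mem_insert, not_or] at hv
      obtain ⟨a, ha, b, hb, _, e⟩ := h v hv.1 (by simpa using hv.2)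
      exact ⟨a, Finset.mem_insert_of_mem ha, b, Finset.mem_insert_of_mem hb, e.symm⟩
  · refine fun h => ⟨fun s hs e => h0 (by rw [← e]; exact hs), fun x hx hxF => ?_⟩
    obtain ⟨a, ha, b, hb, rfl⟩ := h x
    rcases Finset.mem_insert.1 ha with rfl | ha
    · rw [zero_add] at hx hxF
      exact absurd ((Finset.mem_insert.1 hb).resolve_left hx) hxF
    · rcases Finset.mem_insert.1 hb with rfl | hb
      · rw [add_zero] at hxF; exact absurd ha hxF
      · exact ⟨a, ha, b, hb, fun e => hx (add_eq_zero2.2 e), rfl⟩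
def FM (F : Finset V) : Prop := (0 : V) ∉ F ∧ Good (insert 0 F) ∧ ∀ s ∈ F, ¬ Good (insert 0 (F.erase s))
theorem minSat_iff (F : Finset V) : MinSat (↑F : Set V) ↔ FM F := by
  have key : (0 : V) ∉ F → ∀ s, Saturating ((↑F : Set V) \ {s}) ↔ Good (insert 0 (F.erase s)) := fun h0 s => by
    rw [← sat_good (fun h => h0 (Finset.mem_of_mem_erase h)), Finset.coe_erase]
  constructor
  · rintro ⟨h, h'⟩
    have h0 : (0 : V) ∉ F := fun h1 => h.1 0 h1 rfl
    exact ⟨h0, (sat_good h0).1 h, fun s hs hg => h' s hs ((key h0 s).2 hg)⟩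
  · rintro ⟨h0, h, h'⟩
    exact ⟨(sat_good h0).2 h, fun s hs hg => h' s hs ((key h0 s).1 hg)⟩
def LE (F G : Finset V) : Prop := ∃ L : V ≃ₗ[ZMod 2] V, G = F.image L
theorem LE.proj {F G : Finset V} (h : LE F G) : ProjEquiv (↑F : Set V) ↑G := by
  obtain ⟨L, rfl⟩ := h
  refine ⟨⟨LinearMap.toMatrix' (L : V →ₗ[ZMod 2] V), LinearMap.toMatrix' (L.symm : V →ₗ[ZMod 2] V), ?_, ?_⟩, ?_⟩
  · rw [← LinearMap.toMatrix'_comp]; simp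
  · rw [← LinearMap.toMatrix'_comp]; simp
  · rw [Finset.coe_image]
    congr 1; funext x
    exact LinearMap.toMatrix'_mulVec _ _
theorem proj_LE {F G : Finset V} (h : ProjEquiv (↑F : Set V) ↑G) : LE F G := by
  obtain ⟨g, hg⟩ := h
  have hi : Function.Injective (Matrix.mulVecLin (g : Matrix (Fin 7) (Fin 7) (ZMod 2))) := Matrix.mulVec_injective_of_isUnit g.isUnit
  refine ⟨LinearEquiv.ofInjectiveEndo _ hi, ?_⟩
  apply Finset.coe_injective
  rw [Finset.coe_image, ← hg]; rfl
theorem cap_image {F G : Finset V} (h : LE F G) (hc : IsCap (↑F : Set V)) : IsCap (↑G : Set V) := by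
  obtain ⟨L, rfl⟩ := h
  rw [Finset.coe_image]
  refine ⟨?_, ?_⟩
  · rintro _ ⟨s, hs, rfl⟩; simpa using hc.1 s hs
  · rintro _ ⟨a, ha, rfl⟩ _ ⟨b, hb, rfl⟩ _ ⟨c, hcc, rfl⟩ ab ac bc
    rw [← map_add, ← map_add]
    have := hc.2 a ha b hb c hcc (fun e => ab (by rw [e])) (fun e => ac (by rw [e])) (fun e => bc (by rw [e]))
    exact fun e => this (L.map_eq_zero_iff.1 e)
theorem FM.bad {F G : Finset V} (hF : FM F) (h : LE F G) : ∀ s ∈ G, ¬ Good (insert 0 (G.erase s)) := by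
  obtain ⟨L, rfl⟩ := h
  intro s hs hg
  obtain ⟨s, hs', rfl⟩ := Finset.mem_image.1 hs
  refine hF.2.2 s hs' (hg.ae (AE.symm ⟨L, 0, ?_⟩))
  simp only [add_zero]
  rw [Finset.image_insert, map_zero, Finset.image_erase L.injective]
def PE (T : Finset V) (p : V) (T' : Finset V) (p' : V) : Prop := ∃ (L : V ≃ₗ[ZMod 2] V) (c : V), T' = T.image (fun x => L x + c) ∧ p' = L p + c
theorem PE.trans {T T' T'' : Finset V} {p p' p'' : V} (h : PE T p T' p') (h' : PE T' p' T'' p'') : PE T p T'' p'' := by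
  obtain ⟨L, c, rfl, rfl⟩ := h
  obtain ⟨L', c', rfl, rfl⟩ := h'
  refine ⟨L.trans L', L' c + c', ?_, by simp [add_assoc]⟩
  rw [Finset.image_image]
  congr 1; funext x; simp [add_assoc]
def shF (T : Finset V) (p : V) : Finset V := (T.erase p).image (· + p)
theorem PE.LE {T T' : Finset V} {p p' : V} (h : PE T p T' p') : LE (shF T p) (shF T' p') := by
  obtain ⟨L, c, rfl, rfl⟩ := h
  refine ⟨L, ?_⟩
  unfold shF
  have hi : Function.Injective (fun x => L x + c) := fun x y e => L.injective (add_right_cancel e)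
  have := Finset.image_erase hi T p
  rw [← this, Finset.image_image, Finset.image_image]
  congr 1; funext x
  simp only [Function.comp, map_add]
  rw [add_add_add_comm, add_self2, add_zero]
theorem PE.mem {T T' : Finset V} {p p' : V} (h : PE T p T' p') : p' ∈ T' ↔ p ∈ T := by
  obtain ⟨L, c, rfl, rfl⟩ := h
  have hi : Function.Injective (fun x => L x + c) := fun x y e => L.injective (add_right_cancel e)
  exact hi.mem_finset_image (a := p)
theorem AE.PE {T T' : Finset V} (h : AE T T') (p : V) : ∃ p', PE T p T' p' := by
  obtain ⟨L, c, e⟩ := h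
  exact ⟨_, L, c, e, rfl⟩
theorem shF0 {F : Finset V} (h : (0 : V) ∉ F) : shF F 0 = F := by simp [shF, h]
theorem shF0' {F : Finset V} (h : (0 : V) ∉ F) : shF (insert 0 F) 0 = F := by simp [shF, h]
def shl (l : List ℕ) (p : ℕ) : List ℕ := (l.filter (· ≠ p)).map (· ^^^ p)
theorem shl_eq {l : List ℕ} (hl : W l) {p : ℕ} (hp : p < 128) : shF (dv l) (dec 7 p) = dv (shl l p) := by
  unfold shF shl
  rw [dv_erase hl hp]
  ext v
  simp only [dv, Finset.mem_image, List.mem_toFinset, List.mem_map, exists_exists_and_eq_and, dec_xor]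
theorem noCap {l : List ℕ} (hl : W l) (h : lineB l = true) : ¬ IsCap (↑(dv l) : Set V) := by
  unfold lineB at h
  rw [fcL_eq] at h
  obtain ⟨s, hs, h⟩ := List.any_eq_true.1 h
  obtain ⟨t, ht, h⟩ := List.any_eq_true.1 h
  simp only [Bool.and_eq_true, Bool.not_eq_true', List.contains_iff_mem] at h
  obtain ⟨h1, h2⟩ := h
  intro hc
  have ne : dec 7 s ≠ dec 7 t := fun e => by
    rw [dec7i (hl.1 s hs) (hl.1 t ht) e] at h1
    exact absurd (Nat.beq_refl t) (by rw [h1]; decide)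
  have z : ∀ x ∈ l, dec 7 x ≠ 0 := fun x hx => hc.1 _ (dec_mem hx)
  refine hc.2 _ (dec_mem hs) _ (dec_mem ht) _ (dec_mem h2) ne ?_ ?_ ?_
  · intro e
    have := dec_xor 7 s t
    rw [show dec 7 (s ^^^ t) = dec 7 s from e.symm] at this
    exact z t ht (by simpa using this)
  · intro e
    have := dec_xor 7 s t
    rw [show dec 7 (s ^^^ t) = dec 7 t from e.symm] at this
    exact z s hs (by simpa using this)
  · show dec 7 s + dec 7 t + dec 7 (s ^^^ t) = 0
    rw [dec_xor, add_self2]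
/-! ### explicit affine maps, orbits of base points -/
def ap (g : List ℕ) (x : ℕ) : ℕ := app g.tail x ^^^ g.headI
def afOK (b b' : List ℕ) (g : List ℕ) : Bool := g.all (· < 128) && (List.range 127).all (fun x => app g.tail (x + 1) != 0) && b.all (fun x => b'.contains (ap g x))
theorem afOK_map {b b' g : List ℕ} (hb : W b) (hb' : W b') (hl : b.length = b'.length) (h : afOK b b' g = true) :
    ∃ (L : V ≃ₗ[ZMod 2] V) (c : V), dv b' = (dv b).image (fun x => L x + c) ∧ ∀ v, L v + c = dec 7 (ap g (cd v)) := by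
  simp only [afOK, Bool.and_eq_true, List.all_eq_true, decide_eq_true_eq, List.contains_iff_mem, List.mem_range, bne_iff_ne] at h
  obtain ⟨⟨h1, h2⟩, h3⟩ := h
  have ht : ∀ x, app g.tail x < 128 := app_lt (n := 7) (fun c hc => h1 c (List.mem_of_mem_tail hc))
  have hi : Function.Injective (lin 7 g.tail) := by
    rw [← LinearMap.ker_eq_bot, LinearMap.ker_eq_bot']
    intro v hv
    by_contra hne
    have hc : cd v ≠ 0 := fun e => hne (cd_eq_zero.1 e)
    have : cd v < 128 := cd_lt v
    have h5 := h2 (cd v - 1) (by omega)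
    rw [Nat.sub_add_cancel (by omega)] at h5
    rw [lin_apply, ← cd_eq_zero, cd_dec (by exact ht _)] at hv
    exact h5 hv
  have hA : ∀ v, LinearEquiv.ofInjectiveEndo _ hi v + dec 7 g.headI = dec 7 (ap g (cd v)) := by
    intro v
    rw [ap, dec_xor]; rfl
  refine ⟨_, _, ?_, hA⟩
  symm
  apply Finset.eq_of_subset_of_card_le
  · intro v hv
    obtain ⟨u, hu, rfl⟩ := Finset.mem_image.1 hv
    rw [mem_dv hb] at hu
    rw [hA]
    exact dec_mem (h3 _ hu)
  · rw [Finset.card_image_of_injective _ (fun x y e => (LinearEquiv.ofInjectiveEndo _ hi).injective (add_right_cancel e)), dv_card hb, dv_card hb', hl]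
theorem ap_lt {b b' g : List ℕ} (h : afOK b b' g = true) (x : ℕ) : ap g x < 128 := by
  simp only [afOK, Bool.and_eq_true, List.all_eq_true, decide_eq_true_eq] at h
  refine Nat.xor_lt_two_pow (n := 7) (app_lt (n := 7) (fun c hc => h.1.1 c (List.mem_of_mem_tail hc)) x) ?_
  cases g with
  | nil => decide
  | cons a l => exact h.1.1 a (by simp)
def fdr (G : List (List ℕ)) (R : List ℕ) : ℕ → ℕ → Bool
  | 0, x => R.contains x
  | n + 1, x => R.contains x || G.any (fun g => fdr G R n (ap g x))
theorem fdr_of {b : List ℕ} (hb : W b) {G : List (List ℕ)} (hG : ∀ g ∈ G, afOK b b g = true) {R : List ℕ} (n : ℕ) :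
    ∀ x < 128, fdr G R n x = true → ∃ r ∈ R, PE (dv b) (dec 7 x) (dv b) (dec 7 r) := by
  have h0 : ∀ x, R.contains x = true → ∃ r ∈ R, PE (dv b) (dec 7 x) (dv b) (dec 7 r) :=
    fun x h => ⟨x, List.contains_iff_mem.1 h, LinearEquiv.refl _ _, 0, by simp, by simp⟩
  induction n with
  | zero => exact fun x _ h => h0 x h
  | succ n ih =>
    intro x hx h
    rw [fdr, Bool.or_eq_true] at h
    rcases h with h | h
    · exact h0 x h
    · obtain ⟨g, hg, h⟩ := List.any_eq_true.1 h
      obtain ⟨r, hr, h⟩ := ih _ (ap_lt (hG g hg) x) h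
      obtain ⟨L, c, e, hL⟩ := afOK_map hb hb rfl (hG g hg)
      exact ⟨r, hr, PE.trans ⟨L, c, e, by rw [hL, cd_dec (by exact hx)]⟩ h⟩
/-- a base set with its generators and orbit representatives -/
def orbOK (b : List ℕ) (G : List (List ℕ)) (R D : List ℕ) : Bool := decide (W b) && G.all (afOK b b) && D.all (fdr G R 7) && R.all (· < 128)
theorem orb {b : List ℕ} {G : List (List ℕ)} {R D : List ℕ} (h : orbOK b G R D = true) {T : Finset V} (hT : AE T (dv b)) (p : V) (hD : ∀ x < 128, (x ∈ b ↔ p ∈ T) → x ∈ D) :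
    ∃ r ∈ R, LE (shF T p) (dv (shl b r)) := by
  simp only [orbOK, Bool.and_eq_true, List.all_eq_true, decide_eq_true_eq] at h
  obtain ⟨⟨⟨hb, hG⟩, hd⟩, hR⟩ := h
  obtain ⟨p', hp⟩ := hT.PE p
  have hx := hp.mem
  rw [mem_dv hb] at hx
  obtain ⟨r, hr, h⟩ := fdr_of hb hG 7 _ (cd_lt p') (hd _ (hD _ (cd_lt p') hx))
  refine ⟨r, hr, ?_⟩
  rw [← shl_eq hb (hR r hr)]
  rw [dec_cd] at h
  exact (hp.trans h).LE
theorem sn1 : ∀ x < 64, sn (dec 6 x) 1 = dec 7 (64 + x) := by decide +kernel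
theorem sn0 : ∀ x < 64, sn (dec 6 x) 0 = dec 7 x := by decide +kernel
def X (t : ℕ × ℕ) : List ℕ := [64,65,66,67] ++ (List.range 16).map (pt t.1 t.2)
theorem mem_gs {t1 t2 : ℕ} {v : V} : v ∈ (gset t1 t2).image (fun x => sn x 0) ↔ ∃ y < 16, dec 7 (pt t1 t2 y) = v := by
  simp only [gset, Finset.mem_image, Finset.mem_range, exists_exists_and_eq_and]
  exact exists_congr (fun y => and_congr_right (fun hy => by rw [sn0 _ (pt_lt _ _ hy)]))
theorem mem_P7 {v : V} : v ∈ PP.image (fun x => sn x 1) ↔ ∃ x ∈ [64,65,66,67], dec 7 x = v := by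
  simp [PP, dl, sn1, eq_comm]
theorem mem_X {t : ℕ × ℕ} {v : V} : v ∈ dv (X t) ↔ (∃ x ∈ [64,65,66,67], dec 7 x = v) ∨ ∃ y < 16, dec 7 (pt t.1 t.2 y) = v := by
  rw [dv, X, List.mem_toFinset, List.map_append, List.mem_append, List.map_map, List.mem_map, List.mem_map]
  simp only [List.mem_range, Function.comp]
theorem jnX (t : ℕ × ℕ) : jn PP (gset t.1 t.2) = dv (X t) := by
  ext v
  rw [jn, Finset.mem_union, mem_gs, mem_P7, mem_X]
theorem jnY (t : ℕ × ℕ) : jn PP ({dec 6 2} ∪ gset t.1 t.2) = dv (2 :: X t) := by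
  have : dv (2 :: X t) = insert (dec 7 2) (dv (X t)) := by rw [dv, List.map_cons, List.toFinset_cons]; rfl
  rw [this]
  ext v
  rw [jn, Finset.image_union, Finset.image_singleton, sn0 _ (by norm_num), Finset.mem_union, Finset.mem_union, Finset.mem_insert, Finset.mem_singleton, mem_gs, mem_P7, mem_X]
  exact or_left_comm
/-! ### the classification -/
def b0 : List ℕ := X (2760,9448)
def b1 : List ℕ := X (6376,11848)
def Ga : List (List ℕ) := [[0,1,3,8,32,15,31,64],[0,1,2,42,31,32,48,67]]
def Gb : List (List ℕ) := [[38,1,3,38,34,9,59,101],[21,2,3,21,17,51,63,85]]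
def YD : List ((ℕ × ℕ) × List (List ℕ) × List ℕ) := [((104,1568),[[2,3,2,46,34,58,18,65],[0,1,2,32,44,52,8,67]],[0,4,13,23,25,38,64]),
  ((104,11808),[[2,3,2,36,50,62,18,66],[2,3,2,34,58,44,62,67]],[0,4,13,64]),
  ((744,2088),[[0,1,2,60,48,40,32,66],[0,1,2,8,4,37,25,67]],[0,2,4,15,16,23,25,52,56,64]),
  ((38504,168),[[65,64,2,69,81,88,124,65],[0,1,2,4,16,8,41,67]],[0,4,8,15,32]),
  ((38504,680),[[2,3,2,37,18,27,34,67],[64,65,2,79,113,72,96,64]],[0,4,8,32]),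
  ((38504,2760),[[65,64,2,111,124,95,121,3],[67,66,2,106,88,83,71,67]],[0,4])]
def LA : List (List ℕ) := [0,4,64].map (shl b0) ++ [0,64].map (shl b1)
def LB : List (List ℕ) := [5,6,68].map (shl b0) ++ [68].map (shl b1) ++ YD.flatMap (fun d => d.2.2.map (shl (2 :: X d.1)))
noncomputable def repOK (n : ℕ) (l : List ℕ) : Bool := fcL l fun l => decide (W l) && (!l.contains 0) && l.length == n && goodB (0 :: l) && minB l && lineB l
def cmp (b : List ℕ) : List ℕ := (List.range 128).filter (fun x => !b.contains x)
theorem ckA : LA.all (repOK 19) = true := by decide +kernel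
theorem ckB : LB.all (repOK 20) = true := by decide +kernel
theorem JA : fcL (LA.map JJ) (fun l => decide l.Nodup) = true := by decide +kernel
theorem JB : fcL (LB.map JJ) (fun l => decide l.Nodup) = true := by decide +kernel
theorem ck0 : fcL b0 (fun b => orbOK b Ga [0,4,64] b && fcL (cmp b) (fun D => orbOK b Ga [5,6,68,1,2] D)) = true := by decide +kernel
theorem ck1 : fcL b1 (fun b => orbOK b Gb [0,64] b && fcL (cmp b) (fun D => orbOK b Gb [68,1] D)) = true := by decide +kernel
theorem ckY : YD.all (fun d => fcL (2 :: X d.1) (fun b => orbOK b d.2.1 d.2.2 b)) = true := by decide +kernel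
theorem ckI : LI.all (fun x => fcL (X x) (fun b => goodB b && decide (W b) && b.length == 20 && (b == b1 || fcL b0 (fun b0 => [[0,1,2,4,8,16,32,64],[4,2,3,31,41,12,33,68],[4,2,1,12,4,20,36,68],[0,2,1,4,16,8,32,64]].any (afOK b b0))))) = true := by decide +kernel
theorem ckII : LII.all (fun x => YD.any (fun d => d.1 == x) || fcL (2 :: X x) (fun b => decide (W b) && b.contains 0 && goodB (b.filter (· ≠ 0)))) = true := by decide +kernel
theorem ckbad : [shl b0 1, shl b0 2, shl b1 1].all (fun l => fcL l (fun l => decide (W l) && l.any (fun s => decide (s < 128) && goodB (0 :: l.filter (· ≠ s))))) = true := by decide +kernel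
theorem rep_of {n : ℕ} {l : List ℕ} (h : repOK n l = true) : W l ∧ (MinSat (↑(dv l) : Set V) ∧ (↑(dv l) : Set V).ncard = n) ∧ ¬ IsCap (↑(dv l) : Set V) := by
  unfold repOK at h
  rw [fcL_eq] at h
  simp only [Bool.and_eq_true, decide_eq_true_eq, beq_iff_eq, Bool.not_eq_true', ← Bool.not_eq_true, List.contains_iff_mem] at h
  obtain ⟨⟨⟨⟨⟨hw, h0⟩, hn⟩, hg⟩, hm⟩, hc⟩ := h
  refine ⟨hw, ⟨(minSat_iff _).2 ⟨?_, ?_, minB_of hw h0 hm⟩, ?_⟩, noCap hw hc⟩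
  · rwa [mem_dv hw, cd_zero]
  · rw [← dv_cons0]; exact good_of hg
  · rw [Set.ncard_coe_finset, dv_card hw, hn]
theorem M20 {T : Finset V} (hg : Good T) (hT : T.card = 20) : AE T (dv b0) ∨ AE T (dv b1) := by
  obtain ⟨x, hx, h⟩ := case20 hg hT
  rw [jnX] at h
  have hc := List.all_eq_true.1 ckI x hx
  have hw : W b0 ∧ b0.length = 20 := by decide +kernel
  simp only [fcL_eq, Bool.and_eq_true, Bool.or_eq_true, decide_eq_true_eq, beq_iff_eq, List.any_eq_true] at hc
  obtain ⟨⟨⟨_, hW⟩, hl⟩, e | ⟨g, _, hc⟩⟩ := hc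
  · right; rwa [← e]
  · left
    obtain ⟨L, c, e, _⟩ := afOK_map hW hw.1 (hl.trans hw.2.symm) hc
    exact h.trans ⟨L, c, e⟩
theorem M21 {T : Finset V} (hg : Good T) (hT : T.card = 21) : (∃ d ∈ YD, AE T (dv (2 :: X d.1))) ∨ ∃ t ∈ T, Good (T.erase t) := by
  have hX : ∀ x ∈ LI, Good (jn PP (gset x.1 x.2)) := by
    intro x hx
    have hc := List.all_eq_true.1 ckI x hx
    simp only [fcL_eq, Bool.and_eq_true] at hc
    rw [jnX]; exact good_of hc.1.1.1
  rcases case21 hX hg hT with ⟨x, hx, h⟩ | h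
  · rw [jnY] at h
    have hc := List.all_eq_true.1 ckII x hx
    simp only [fcL_eq, Bool.and_eq_true, Bool.or_eq_true, decide_eq_true_eq, beq_iff_eq, List.any_eq_true, List.contains_iff_mem] at hc
    rcases hc with ⟨d, hd, rfl⟩ | ⟨⟨hw, h0⟩, hgd⟩
    · exact Or.inl ⟨d, hd, h⟩
    · right
      refine Good.er h (dec_mem h0) ?_
      rw [dv_erase hw (by norm_num)]
      exact good_of hgd
  · exact Or.inr h
theorem bad {F : Finset V} (hF : FM F) {l : List ℕ} (hl : l ∈ [shl b0 1, shl b0 2, shl b1 1]) (h : LE F (dv l)) : False := by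
  have hc := List.all_eq_true.1 ckbad l hl
  simp only [fcL_eq, Bool.and_eq_true, decide_eq_true_eq, List.any_eq_true] at hc
  obtain ⟨hw, s, hs, h128, hg⟩ := hc
  refine hF.bad h (dec 7 s) (dec_mem hs) ?_
  rw [dv_erase hw h128, ← dv_cons0]
  exact good_of hg
theorem mem_cmp {b : List ℕ} {P : Prop} (h : ¬ P) (x : ℕ) (hx : x < 128) (e : x ∈ b ↔ P) : x ∈ cmp b := by
  simp only [cmp, List.mem_filter, List.mem_range, Bool.not_eq_true', ← Bool.not_eq_true, List.contains_iff_mem]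
  exact ⟨hx, fun hb => h (e.1 hb)⟩
theorem F19 {F : Finset V} (hF : FM F) (hc : F.card = 19) : ∃ l ∈ LA, LE F (dv l) := by
  have h0 := ck0
  have h1 := ck1
  simp only [fcL_eq, Bool.and_eq_true] at h0 h1
  have z : (0 : V) ∈ insert 0 F := by simp
  rcases M20 hF.2.1 (by rw [Finset.card_insert_of_notMem hF.1, hc]) with h | h
  · obtain ⟨r, hr, h⟩ := orb h0.1 h 0 (fun x _ e => e.2 z)
    rw [shF0' hF.1] at h
    exact ⟨_, List.mem_append_left _ (List.mem_map_of_mem hr), h⟩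
  · obtain ⟨r, hr, h⟩ := orb h1.1 h 0 (fun x _ e => e.2 z)
    rw [shF0' hF.1] at h
    exact ⟨_, List.mem_append_right _ (List.mem_map_of_mem hr), h⟩
theorem F20 {F : Finset V} (hF : FM F) (hc : F.card = 20) : ∃ l ∈ LB, LE F (dv l) := by
  have h0 := ck0
  have h1 := ck1
  simp only [fcL_eq, Bool.and_eq_true] at h0 h1
  have z : (0 : V) ∈ insert 0 F := by simp
  rcases M21 hF.2.1 (by rw [Finset.card_insert_of_notMem hF.1, hc]) with ⟨d, hd, h⟩ | ⟨t, ht, hg⟩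
  · have hy := List.all_eq_true.1 ckY d hd
    rw [fcL_eq] at hy
    obtain ⟨r, hr, h⟩ := orb hy h 0 (fun x _ e => e.2 z)
    rw [shF0' hF.1] at h
    exact ⟨_, List.mem_append_right _ (List.mem_flatMap.2 ⟨d, hd, List.mem_map_of_mem hr⟩), h⟩
  · by_cases t0 : t = 0
    · subst t0
      rw [Finset.erase_insert hF.1] at hg
      rcases M20 hg hc with h | h
      · obtain ⟨r, hr, h⟩ := orb h0.2 h 0 (mem_cmp hF.1)
        rw [shF0 hF.1] at h
        rcases List.mem_append.1 (show r ∈ [5,6,68] ++ [1,2] from hr) with hr | hr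
        · exact ⟨_, List.mem_append_left _ (List.mem_append_left _ (List.mem_map_of_mem hr)), h⟩
        · exact (bad hF (List.mem_append_left [shl b1 1] (List.mem_map_of_mem (f := shl b0) hr)) h).elim
      · obtain ⟨r, hr, h⟩ := orb h1.2 h 0 (mem_cmp hF.1)
        rw [shF0 hF.1] at h
        rcases List.mem_append.1 (show r ∈ [68] ++ [1] from hr) with hr | hr
        · exact ⟨_, List.mem_append_left _ (List.mem_append_right _ (List.mem_map_of_mem hr)), h⟩
        · exact (bad hF (List.mem_append_right [shl b0 1, shl b0 2] (List.mem_map_of_mem (f := shl b1) hr)) h).elim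
    · refine (hF.2.2 t ((Finset.mem_insert.1 ht).resolve_left t0) ?_).elim
      rwa [Finset.erase_insert_of_ne (Ne.symm t0)] at hg
theorem nonEq {LL : List (List ℕ)} (hw : ∀ l ∈ LL, W l) (hJ : fcL (LL.map JJ) (fun l => decide l.Nodup) = true) (i j : Fin LL.length) (hij : i ≠ j) :
    ¬ ProjEquiv (↑(dv LL[i]) : Set V) ↑(dv LL[j]) := by
  intro h
  obtain ⟨L, e⟩ := proj_LE h
  have := JF_image (dv LL[i]) L
  rw [← e, JF_dv (hw LL[j] (List.getElem_mem _)), JF_dv (hw LL[i] (List.getElem_mem _))] at this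
  rw [fcL_eq, decide_eq_true_eq] at hJ
  apply hij
  have h2 := (List.Nodup.getElem_inj_iff hJ (i := i) (j := j) (hi := by simp) (hj := by simp)).1 (by simpa using this.symm)
  exact Fin.ext h2
end MS
theorem minSat_PG6_sizes19_20 :
    ∃ (A : Fin 5 → Set (Fin 7 → ZMod 2)) (B : Fin 36 → Set (Fin 7 → ZMod 2)),
      (∀ i, MinSat (A i) ∧ (A i).ncard = 19) ∧
      (∀ i, MinSat (B i) ∧ (B i).ncard = 20) ∧
      (∀ i j, i ≠ j → ¬ ProjEquiv (A i) (A j)) ∧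
      (∀ i j, i ≠ j → ¬ ProjEquiv (B i) (B j)) ∧
      (∀ S : Set (Fin 7 → ZMod 2), MinSat S → S.ncard = 19 → ∃ i, ProjEquiv S (A i)) ∧
      (∀ S : Set (Fin 7 → ZMod 2), MinSat S → S.ncard = 20 → ∃ i, ProjEquiv S (B i)) ∧
      (∀ S : Set (Fin 7 → ZMod 2), MinSat S → (S.ncard = 19 ∨ S.ncard = 20) →
        ¬ IsCap S) := by
  have hA : MS.LA.length = 5 := by decide +kernel
  have hB : MS.LB.length = 36 := by decide +kernel
  have rA := fun l hl => MS.rep_of (List.all_eq_true.1 MS.ckA l hl)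
  have rB := fun l hl => MS.rep_of (List.all_eq_true.1 MS.ckB l hl)
  have fin : ∀ S : Set (Fin 7 → ZMod 2), ∃ F : Finset MS.V, S = ↑F := fun S => ⟨S.toFinite.toFinset, by simp⟩
  have c19 : ∀ S : Set (Fin 7 → ZMod 2), MinSat S → S.ncard = 19 → ∃ F : Finset MS.V, S = ↑F ∧ ∃ l ∈ MS.LA, MS.LE F (MS.dv l) := by
    intro S hS hn
    obtain ⟨F, rfl⟩ := fin S
    rw [Set.ncard_coe_finset] at hn
    exact ⟨F, rfl, MS.F19 ((MS.minSat_iff F).1 hS) hn⟩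
  have c20 : ∀ S : Set (Fin 7 → ZMod 2), MinSat S → S.ncard = 20 → ∃ F : Finset MS.V, S = ↑F ∧ ∃ l ∈ MS.LB, MS.LE F (MS.dv l) := by
    intro S hS hn
    obtain ⟨F, rfl⟩ := fin S
    rw [Set.ncard_coe_finset] at hn
    exact ⟨F, rfl, MS.F20 ((MS.minSat_iff F).1 hS) hn⟩
  refine ⟨fun i => ↑(MS.dv MS.LA[i.cast hA.symm]), fun i => ↑(MS.dv MS.LB[i.cast hB.symm]), fun i => (rA _ (List.getElem_mem _)).2.1,
    fun i => (rB _ (List.getElem_mem _)).2.1, fun i j hij => MS.nonEq (fun l hl => (rA l hl).1) MS.JA _ _ (fun e => hij (Fin.cast_injective _ e)),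
    fun i j hij => MS.nonEq (fun l hl => (rB l hl).1) MS.JB _ _ (fun e => hij (Fin.cast_injective _ e)), fun S hS hn => ?_, fun S hS hn => ?_, fun S hS hn hc => ?_⟩
  · obtain ⟨F, rfl, l, hl, h⟩ := c19 S hS hn
    obtain ⟨i, hi, rfl⟩ := List.mem_iff_getElem.1 hl
    exact ⟨⟨i, hA ▸ hi⟩, h.proj⟩
  · obtain ⟨F, rfl, l, hl, h⟩ := c20 S hS hn
    obtain ⟨i, hi, rfl⟩ := List.mem_iff_getElem.1 hl
    exact ⟨⟨i, hB ▸ hi⟩, h.proj⟩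
  · rcases hn with hn | hn
    · obtain ⟨F, rfl, l, hl, h⟩ := c19 S hS hn
      exact (rA l hl).2.2 (MS.cap_image h hc)
    · obtain ⟨F, rfl, l, hl, h⟩ := c20 S hS hn
      exact (rB l hl).2.2 (MS.cap_image h hc)
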